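/- arXiv:1707.05619 — 2 statements merged into one kernel-verified Lean document; each statement's English description precedes it below -/
import Mathlib

section
/- Under Plurality with fixed tie-breaking, every voting manipulation game (with players being all strategic voters — GS-manipulators and countermanipulators — each having his sincere vote and some manipulation/countermanipulation strategies) has a pure-strategy Nash equilibrium. -/
def approvalScore {C : Type*} [Fintype C] [DecidableEq C] {n : ℕ} (k : ℕ)
    (V : Fin n → C → ℕ) (c : C) : ℕ :=
  (Finset.univ.filter fun i => V i c < k).card

def IsWinner {C : Type*} [Fintype C] [DecidableEq C] {n : ℕ} (k : ℕ)
    (V : Fin n → C → ℕ) (tb : C → ℕ) (w : C) : Prop :=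
  ∀ c, c ≠ w → approvalScore k V c < approvalScore k V w ∨
    (approvalScore k V c = approvalScore k V w ∧ tb w < tb c)

open scoped Classical in
noncomputable def winner {C : Type*} [Fintype C] [DecidableEq C] [Nonempty C] {n : ℕ} (k : ℕ)
    (V : Fin n → C → ℕ) (tb : C → ℕ) : C :=
  if h : ∃ w, IsWinner k V tb w then h.choose else Classical.arbitrary C

/-- `v'` is a GS-manipulation of voter `i` at profile `V` under k-Approval
(Definition 2): it is an insincere vote making a candidate strictly preferred
by `i` to the current winner win, and the resulting winner is `i`'s most
preferred candidate among all winners he can obtain unilaterally. -/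
def IsGSManipulation {C : Type*} [Fintype C] [DecidableEq C] [Nonempty C] {n : ℕ}
    (k : ℕ) (V : Fin n → C → ℕ) (tb : C → ℕ) (i : Fin n) (v' : C → ℕ) : Prop :=
  Function.Injective v' ∧ v' ≠ V i ∧
  V i (winner k (Function.update V i v') tb) < V i (winner k V tb) ∧
  ∀ v'' : C → ℕ, Function.Injective v'' →
    V i (winner k (Function.update V i v') tb) ≤
      V i (winner k (Function.update V i v'') tb)

/-- `vj'` is a countermanipulation of voter `j` against the manipulation
`vi'` of voter `i` (Definition 3). -/
def IsCounterManip {C : Type*} [Fintype C] [DecidableEq C] [Nonempty C] {n : ℕ}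
    (k : ℕ) (V : Fin n → C → ℕ) (tb : C → ℕ)
    (i : Fin n) (vi' : C → ℕ) (j : Fin n) (vj' : C → ℕ) : Prop :=
  i ≠ j ∧ Function.Injective vj' ∧ vj' ≠ V j ∧
  V j (winner k (Function.update (Function.update V i vi') j vj') tb) <
    V j (winner k (Function.update V i vi') tb) ∧
  ∀ vj'' : C → ℕ, Function.Injective vj'' →
    V j (winner k (Function.update (Function.update V i vi') j vj') tb) ≤
      V j (winner k (Function.update (Function.update V i vi') j vj'') tb)

/-- A weighted voting game in which every voter is either sincere (`none`) or moves one unit of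
weight from their top candidate to one of their targets (`some c`). -/
structure SwingGame (ι C : Type*) where
  base : C → ℤ
  unit : ℤ
  top : ι → C → Prop
  rank : ι → C → ℕ
  targets : ι → Set C

namespace SwingGame

variable {ι C : Type*} (G : SwingGame ι C)

/-- Voter `i` may be sincere or support one of their targets. -/
def Allowed (i : ι) (o : Option C) : Prop := ∀ c, o = some c → c ∈ G.targets i

/-- In the presence of voter `b` supporting `q`, the best deviation of voter `a` that makes
a new candidate win is to support `x`. -/
structure IsBestAgainst (b : ι) (q : C) (a : ι) (x : C) : Prop where
  ne : a ≠ b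
  mem_left : q ∈ G.targets b
  mem_right : x ∈ G.targets a
  base_lt : G.base q < G.base x
  not_top : ¬ G.top b x
  rank_lt : G.rank a x < G.rank a q
  best : ∀ e ∈ G.targets a, G.base q < G.base e → ¬ G.top b e → G.rank a x ≤ G.rank a e

theorem exists_isBestAgainst [Finite C] {b a : ι} {q e : C}
    (hab : a ≠ b) (hq : q ∈ G.targets b) (he : e ∈ G.targets a) (hqe : G.base q < G.base e)
    (hbe : ¬ G.top b e) (hrank : G.rank a e < G.rank a q) :
    ∃ x, G.IsBestAgainst b q a x ∧ G.rank a x ≤ G.rank a e := by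
  obtain ⟨x, ⟨hx, hqx, hbx⟩, hmin⟩ := Set.exists_min_image
    {e | e ∈ G.targets a ∧ G.base q < G.base e ∧ ¬ G.top b e} (G.rank a) (Set.toFinite _)
    ⟨e, he, hqe, hbe⟩
  have hxe := hmin e ⟨he, hqe, hbe⟩
  exact ⟨x, ⟨hab, hq, hx, hqx, hbx, hxe.trans_lt hrank, fun d h₁ h₂ h₃ => hmin d ⟨h₁, h₂, h₃⟩⟩, hxe⟩

open scoped Classical in
/-- The change of the weight of `c` when voter `i` plays `o` instead of being sincere. -/
noncomputable def contrib (i : ι) (o : Option C) (c : C) : ℤ :=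
  match o with
  | none => 0
  | some t => (if t = c then G.unit else 0) - (if G.top i c then G.unit else 0)

variable [Fintype ι]

/-- The weight of `c` when each voter `i` plays `f i`. -/
noncomputable def key (f : ι → Option C) (c : C) : ℤ :=
  G.base c + ∑ i, G.contrib i (f i) c

theorem key_none (c : C) : G.key (fun _ => none) c = G.base c := by
  simp [key, contrib]

/-- Tops are ranked first, targets can win with one more unit, and the heaviest candidate wins. -/
structure IsRegular (win : (ι → Option C) → C) : Prop where
  unit_pos : 0 < G.unit
  rank_injective : ∀ i, Function.Injective (G.rank i)
  base_injective : Function.Injective G.base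
  rank_lt : ∀ i c d, G.top i c → d ≠ c → G.rank i c < G.rank i d
  not_top : ∀ i, ∀ c ∈ G.targets i, ¬ G.top i c
  near : ∀ i, ∀ c ∈ G.targets i, ∀ d, G.base d < G.base c + G.unit
  key_lt : ∀ f c, c ≠ win f → G.key f c < G.key f (win f)

variable {G} {win : (ι → Option C) → C}

theorem IsRegular.win_eq (hG : G.IsRegular win) {f : ι → Option C} {x : C}
    (h : ∀ c, c ≠ x → G.key f c < G.key f x) :
    win f = x := by
  by_contra hx
  exact lt_asymm (h _ hx) (hG.key_lt f x (Ne.symm hx))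

theorem IsRegular.key_le (hG : G.IsRegular win) (f : ι → Option C) (c : C) :
    G.key f c ≤ G.key f (win f) := by
  by_cases h : c = win f
  · rw [← h]
  · exact (hG.key_lt f c h).le

variable [DecidableEq ι]

theorem key_update (G : SwingGame ι C) (f : ι → Option C) (i : ι) (o : Option C) (c : C) :
    G.key (Function.update f i o) c =
      G.key f c + G.contrib i o c - G.contrib i (f i) c := by
  have h : ∀ j, G.contrib j (Function.update f i o j) c =
      G.contrib j (f j) c + if j = i then G.contrib i o c - G.contrib i (f i) c else 0 := by
    intro j
    by_cases hj : j = i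
    · subst hj; simp
    · simp [hj]
  simp only [key, h, Finset.sum_add_distrib, Finset.sum_ite_eq', Finset.mem_univ, if_true]
  ring

/-- Pure-strategy Nash equilibrium, where lower ranks are preferred. -/
def IsEquilibrium (G : SwingGame ι C) (win : (ι → Option C) → C) (f : ι → Option C) : Prop :=
  (∀ i, G.Allowed i (f i)) ∧
    ∀ i o, G.Allowed i o → G.rank i (win f) ≤ G.rank i (win (Function.update f i o))

theorem IsRegular.exists_of_triple (hG : G.IsRegular win) {q : C} {i j k : ι}
    (hij : i ≠ j) (hik : i ≠ k) (hjk : j ≠ k)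
    (hi : q ∈ G.targets i) (hj : q ∈ G.targets j) (hk : q ∈ G.targets k) :
    ∃ f, G.IsEquilibrium win f := by
  have hu := hG.unit_pos
  have hit := hG.not_top i q hi
  have hjt := hG.not_top j q hj
  have hkt := hG.not_top k q hk
  have hnear := hG.near i q hi
  obtain ⟨f, f_eq⟩ : ∃ f : ι → Option C, f = Function.update
      (Function.update (Function.update (fun _ => none) i (some q)) j (some q)) k (some q) :=
    ⟨_, rfl⟩
  have hf : ∀ l, f l = if l = k then some q else if l = j then some q else if l = i then some q
      else none := by
    intro l; simp [f_eq, Function.update_apply]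
  have key_f : ∀ c, G.key f c = G.base c + G.contrib i (some q) c + G.contrib j (some q) c
      + G.contrib k (some q) c := by
    intro c
    simp [f_eq, key_update, key_none, hij.symm, hik.symm, hjk.symm, contrib]
  have hwin : ∀ l o, win (Function.update f l o) = q := by
    intro l o
    apply hG.win_eq
    intro c hc
    have := hnear c
    rw [key_update, key_update, key_f, key_f, hf]
    cases o <;> grind (splits := 25) [contrib]
  refine ⟨f, ?_, ?_⟩
  · intro l c; rw [hf]; grind
  · intro l o _
    rw [hwin, ← Function.update_eq_self k f, hwin]

theorem IsRegular.exists_of_single (hG : G.IsRegular win) {a : ι} {x : C} (hx : x ∈ G.targets a)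
    (hbest : ∀ e ∈ G.targets a, G.rank a x ≤ G.rank a e)
    (hnone : G.rank a x ≤ G.rank a (win fun _ => none))
    (hladder : ∀ l, l ≠ a → ∀ e ∈ G.targets l, G.base x < G.base e → ¬ G.top a e →
      G.rank l x ≤ G.rank l e) :
    ∃ f, G.IsEquilibrium win f := by
  have hu := hG.unit_pos
  have hxt := hG.not_top a x hx
  have hnear := hG.near a x hx
  obtain ⟨f, f_eq⟩ : ∃ f : ι → Option C, f = Function.update (fun _ => none) a (some x) := ⟨_, rfl⟩
  have hf : ∀ l, f l = if l = a then some x else none := by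
    intro l; simp [f_eq, Function.update_apply]
  have key_f : ∀ c, G.key f c = G.base c + G.contrib a (some x) c := by
    intro c; simp [f_eq, key_update, key_none, contrib]
  have hwin : win f = x := by
    apply hG.win_eq
    intro c hc
    have := hnear c
    rw [key_f, key_f]
    grind (splits := 25) [contrib]
  refine ⟨f, ?_, ?_⟩
  · intro l c; rw [hf]; grind
  · intro l o ho
    rw [hwin]
    by_contra! hlt
    obtain ⟨y, hy⟩ : ∃ y, y = win (Function.update f l o) := ⟨_, rfl⟩
    have hkey := hG.key_le (Function.update f l o)
    have hyx := hnear y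
    have hrx := fun h => hG.rank_lt l x y h
    have hinj := fun h => hG.base_injective (a₁ := x) (a₂ := y) h
    rw [← hy] at hkey hlt
    by_cases hla : l = a
    · subst hla
      cases o with
      | none =>
        have : Function.update f l none = fun _ => none := by simp [f_eq]
        rw [this] at hy
        subst hy
        omega
      | some e =>
        have he := ho e rfl
        have h1 := hkey e
        have := hG.near l e he y
        have := hG.not_top l e he
        have := hbest e he
        rw [key_update, key_update, key_f, key_f, hf] at h1
        grind (splits := 25) [contrib]
    · have h1 := hkey x
      rw [key_update, key_update, key_f, key_f, hf] at h1
      cases o with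
      | none => grind (splits := 25) [contrib]
      | some e =>
        have he := ho e rfl
        have := hladder l hla e he
        grind (splits := 25) [contrib]

theorem IsRegular.equilibrium_of_pair (hG : G.IsRegular win) {a b : ι} {x q : C}
    (hab : a ≠ b) (hq : q ∈ G.targets b) (hx : x ∈ G.targets a) (hqx : G.base q < G.base x)
    (hbx : ¬ G.top b x)
    (hrank : G.rank a x < G.rank a q)
    (hbest : ∀ e ∈ G.targets a, G.base q < G.base e → ¬ G.top b e → G.rank a x ≤ G.rank a e)
    (hladder : ∀ l, l ≠ a → ∀ e ∈ G.targets l, G.base x < G.base e → ¬ G.top a e →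
      G.rank l x ≤ G.rank l e)
    (hswap : ∀ m, m ≠ a → m ≠ b → q ∈ G.targets m → G.rank m x ≤ G.rank m q) :
    ∃ f, G.IsEquilibrium win f := by
  have hu := hG.unit_pos
  have hxt := hG.not_top a x hx
  have hqt := hG.not_top b q hq
  have hnear := hG.near a x hx
  have hnearq := hG.near b q hq
  have hqa : ¬ G.top a q := fun h => by
    have := hG.rank_lt a q x h (by grind)
    omega
  obtain ⟨f, f_eq⟩ : ∃ f : ι → Option C, f = Function.update
      (Function.update (fun _ => none) b (some q)) a (some x) := ⟨_, rfl⟩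
  have hf : ∀ l, f l = if l = a then some x else if l = b then some q else none := by
    intro l; simp [f_eq, Function.update_apply]
  have key_f : ∀ c, G.key f c = G.base c + G.contrib b (some q) c + G.contrib a (some x) c := by
    intro c; simp [f_eq, key_update, key_none, hab, contrib]
  have hwin : win f = x := by
    apply hG.win_eq
    intro c hc
    have := hnear c
    rw [key_f, key_f]
    grind (splits := 25) [contrib]
  refine ⟨f, ?_, ?_⟩
  · intro l c; rw [hf]; grind
  · intro l o ho
    rw [hwin]
    by_contra! hlt
    obtain ⟨y, hy⟩ : ∃ y, y = win (Function.update f l o) := ⟨_, rfl⟩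
    have hkey := hG.key_le (Function.update f l o)
    have hyx := hnear y
    have hyq := hnearq y
    have hrx := fun h => hG.rank_lt l x y h
    have hinj := fun h => hG.base_injective (a₁ := x) (a₂ := y) h
    have hinjq := fun h => hG.base_injective (a₁ := q) (a₂ := y) h
    rw [← hy] at hkey hlt
    by_cases hla : l = a
    · subst hla
      have h1 := hkey q
      rw [key_update, key_update, key_f, key_f, hf] at h1
      cases o with
      | none => grind (splits := 25) [contrib]
      | some e =>
        have he := ho e rfl
        have := hG.not_top l e he
        have := hbest e he
        grind (splits := 25) [contrib]
    · have h1 := hkey x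
      rw [key_update, key_update, key_f, key_f, hf] at h1
      cases o with
      | none => grind (splits := 25) [contrib]
      | some e =>
        have he := ho e rfl
        have := hladder l hla e he
        have := hswap l hla
        have := hG.not_top l e he
        by_cases hlb : l = b
        · grind (splits := 25) [contrib]
        · grind (splits := 25) [contrib]

theorem IsRegular.equilibrium_of_two_on_runner_up (hG : G.IsRegular win) {a b m : ι} {x q : C}
    (hab : a ≠ b) (ham : a ≠ m) (hbm : b ≠ m) (hqb : q ∈ G.targets b) (hqm : q ∈ G.targets m)
    (hx : x ∈ G.targets a) (hqx : G.base q < G.base x) (hrank : G.rank a x < G.rank a q)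
    (hb : G.rank b q < G.rank b x) (hm : G.rank m q < G.rank m x)
    (hladder : ∀ l, l ≠ a → ∀ e ∈ G.targets l, G.base x < G.base e → ¬ G.top a e →
      G.rank l x ≤ G.rank l e)
    (hother : ∀ l, l ≠ a → l ≠ b → l ≠ m → x ∈ G.targets l → G.rank l q ≤ G.rank l x) :
    ∃ f, G.IsEquilibrium win f := by
  have hu := hG.unit_pos
  have hxt := hG.not_top a x hx
  have hqt := hG.not_top b q hqb
  have hqtm := hG.not_top m q hqm
  have hnear := hG.near a x hx
  have hnearq := hG.near b q hqb
  have hne : q ≠ x := by rintro rfl; omega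
  have hqa : ¬ G.top a q := fun h => by
    have := hG.rank_lt a q x h hne.symm
    omega
  have hxb : ¬ G.top b x := fun h => by
    have := hG.rank_lt b x q h hne
    omega
  have hxm : ¬ G.top m x := fun h => by
    have := hG.rank_lt m x q h hne
    omega
  obtain ⟨f, f_eq⟩ : ∃ f : ι → Option C, f = Function.update (Function.update
      (Function.update (fun _ => none) m (some q)) b (some q)) a (some x) := ⟨_, rfl⟩
  have hf : ∀ l, f l = if l = a then some x else if l = b then some q else if l = m then some q
      else none := by
    intro l; simp [f_eq, Function.update_apply]
  have key_f : ∀ c, G.key f c = G.base c + G.contrib m (some q) c + G.contrib b (some q) c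
      + G.contrib a (some x) c := by
    intro c; simp [f_eq, key_update, key_none, hab, ham, hbm, contrib]
  have hwin : win f = q := by
    apply hG.win_eq
    intro c hc
    have := hnearq c
    rw [key_f, key_f]
    grind (splits := 25) [contrib]
  refine ⟨f, ?_, ?_⟩
  · intro l c; rw [hf]; grind
  · intro l o ho
    rw [hwin]
    by_contra! hlt
    obtain ⟨y, hy⟩ : ∃ y, y = win (Function.update f l o) := ⟨_, rfl⟩
    have hkey := hG.key_le (Function.update f l o)
    have hyx := hnear y
    have hyq := hnearq y
    have hinj := fun h => hG.base_injective (a₁ := x) (a₂ := y) h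
    rw [← hy] at hkey hlt
    by_cases hlbm : l = b ∨ l = m
    · have hla : l ≠ a := by rcases hlbm with rfl | rfl <;> exact Ne.symm ‹_›
      have h1 := hkey x
      have hlx : G.rank l q < G.rank l x := by rcases hlbm with rfl | rfl <;> assumption
      rw [key_update, key_update, key_f, key_f, hf] at h1
      cases o with
      | none => grind (splits := 25) [contrib]
      | some e =>
        have := hladder l hla e (ho e rfl)
        clear hladder hother hkey hf key_f f_eq ho
        grind (splits := 25) [contrib]
    · have h1 := hkey q
      have hql := fun h => hG.rank_lt l q y h
      rw [key_update, key_update, key_f, key_f, hf] at h1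
      cases o with
      | none => grind (splits := 25) [contrib]
      | some e =>
        have he := ho e rfl
        have := hother l
        have := hG.not_top l e he
        clear hladder hother hkey hf key_f f_eq ho
        grind (splits := 25) [contrib]

theorem IsRegular.equilibrium_of_two_on_each (hG : G.IsRegular win) {a b m l : ι} {x q : C}
    (hab : a ≠ b) (ham : a ≠ m) (hbm : b ≠ m) (hal : a ≠ l) (hbl : b ≠ l) (hml : m ≠ l)
    (hqb : q ∈ G.targets b) (hqm : q ∈ G.targets m)
    (hxa : x ∈ G.targets a) (hxl : x ∈ G.targets l) (hqx : G.base q < G.base x)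
    (ha : G.rank a x < G.rank a q) (hl : G.rank l x < G.rank l q)
    (hb : G.rank b q < G.rank b x) (hm : G.rank m q < G.rank m x)
    (hthird : ∀ k, k ≠ b → k ≠ m → q ∉ G.targets k) :
    ∃ f, G.IsEquilibrium win f := by
  have hu := hG.unit_pos
  have hxt := hG.not_top a x hxa
  have hxtl := hG.not_top l x hxl
  have hqt := hG.not_top b q hqb
  have hqtm := hG.not_top m q hqm
  have hnear := hG.near a x hxa
  have hnearq := hG.near b q hqb
  have hne : q ≠ x := by rintro rfl; omega
  have hqa : ¬ G.top a q := fun h => by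
    have := hG.rank_lt a q x h hne.symm
    omega
  have hql : ¬ G.top l q := fun h => by
    have := hG.rank_lt l q x h hne.symm
    omega
  have hxb : ¬ G.top b x := fun h => by
    have := hG.rank_lt b x q h hne
    omega
  have hxm : ¬ G.top m x := fun h => by
    have := hG.rank_lt m x q h hne
    omega
  obtain ⟨f, f_eq⟩ : ∃ f : ι → Option C, f = Function.update (Function.update (Function.update
      (Function.update (fun _ => none) m (some q)) b (some q)) l (some x)) a (some x) := ⟨_, rfl⟩
  have hf : ∀ k, f k = if k = a then some x else if k = l then some x else
      if k = b then some q else if k = m then some q else none := by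
    intro k; simp [f_eq, Function.update_apply]
  have key_f : ∀ c, G.key f c = G.base c + G.contrib m (some q) c + G.contrib b (some q) c
      + G.contrib l (some x) c + G.contrib a (some x) c := by
    intro c
    simp [f_eq, key_update, key_none, hab, ham, hbm, hal, hbl.symm, hml.symm, contrib]
  have hwin : win f = x := by
    apply hG.win_eq
    intro c hc
    have := hnear c
    rw [key_f, key_f]
    clear hf key_f f_eq hthird
    grind (splits := 25) [contrib]
  refine ⟨f, ?_, ?_⟩
  · intro l c; rw [hf]; grind
  · intro k o ho
    rw [hwin]
    by_contra! hlt
    obtain ⟨y, hy⟩ : ∃ y, y = win (Function.update f k o) := ⟨_, rfl⟩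
    have hkey := hG.key_le (Function.update f k o)
    have hyx := hnear y
    have hyq := hnearq y
    rw [← hy] at hkey hlt
    have hxk := fun h => hG.rank_lt k x y h
    by_cases hkal : k = a ∨ k = l
    · have h1 := hkey q
      have hkq : G.rank k x < G.rank k q := by rcases hkal with rfl | rfl <;> assumption
      rw [key_update, key_update, key_f, key_f, hf] at h1
      cases o with
      | none =>
        clear hthird hkey hf key_f f_eq ho
        grind (splits := 25) [contrib]
      | some e =>
        have he := ho e rfl
        have := hthird k
        have := hG.not_top k e he
        clear hthird hkey hf key_f f_eq ho
        grind (splits := 25) [contrib]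
    · have h1 := hkey x
      rw [key_update, key_update, key_f, key_f, hf] at h1
      cases o with
      | none =>
        clear hthird hkey hf key_f f_eq ho
        grind (splits := 25) [contrib]
      | some e =>
        have he := ho e rfl
        have := hthird k
        have := hG.not_top k e he
        clear hthird hkey hf key_f f_eq ho
        grind (splits := 25) [contrib]

theorem IsRegular.exists_of_isBestAgainst (hG : G.IsRegular win) [Finite C] {b a : ι} {q x : C}
    (h : G.IsBestAgainst b q a x)
    (hmax : ∀ b' q' a' x', G.IsBestAgainst b' q' a' x' → G.base q' ≤ G.base q) :
    ∃ f, G.IsEquilibrium win f := by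
  have hladder : ∀ b a x, G.IsBestAgainst b q a x →
      ∀ l, l ≠ a → ∀ e ∈ G.targets l, G.base x < G.base e → ¬ G.top a e →
        G.rank l x ≤ G.rank l e := by
    intro b a x h l hla e he hxe hae
    by_contra! hlt
    obtain ⟨y, hy, -⟩ := G.exists_isBestAgainst hla h.mem_right he hxe hae hlt
    exact (hmax _ _ _ _ hy).not_gt h.base_lt
  have hl := hladder b a x h
  by_cases hswap : ∀ m, m ≠ a → m ≠ b → q ∈ G.targets m → G.rank m x ≤ G.rank m q
  · exact hG.equilibrium_of_pair h.ne h.mem_left h.mem_right h.base_lt h.not_top h.rank_lt h.best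
      hl hswap
  push Not at hswap
  obtain ⟨m, hma, hmb, hqm, hm⟩ := hswap
  by_cases hthird : ∃ k, k ≠ b ∧ k ≠ m ∧ q ∈ G.targets k
  · obtain ⟨k, hkb, hkm, hk⟩ := hthird
    exact hG.exists_of_triple hmb.symm hkb.symm hkm.symm h.mem_left hqm hk
  push Not at hthird
  have hne : q ≠ x := fun hqx => (hqx ▸ h.base_lt).false
  rcases lt_or_gt_of_ne (fun hr => hne (hG.rank_injective b hr)) with hb | hb
  · by_cases hother : ∃ l, l ≠ a ∧ l ≠ b ∧ l ≠ m ∧ x ∈ G.targets l ∧ G.rank l x < G.rank l q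
    · obtain ⟨l, hla, hlb, hlm, hxl, hlr⟩ := hother
      exact hG.equilibrium_of_two_on_each h.ne hma.symm hmb.symm hla.symm hlb.symm hlm.symm
        h.mem_left hqm h.mem_right hxl h.base_lt h.rank_lt hlr hb hm hthird
    · push Not at hother
      exact hG.equilibrium_of_two_on_runner_up h.ne hma.symm hmb.symm h.mem_left hqm h.mem_right
        h.base_lt h.rank_lt hb hm hl hother
  · have hmx : ¬ G.top m x := fun ht => (hG.rank_lt m x q ht hne).not_gt hm
    obtain ⟨y, hy, hyx⟩ := G.exists_isBestAgainst hma.symm hqm h.mem_right h.base_lt hmx h.rank_lt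
    refine hG.equilibrium_of_pair hy.ne hy.mem_left hy.mem_right hy.base_lt hy.not_top hy.rank_lt
      hy.best (hladder m a y hy) fun k _ hkm hk => ?_
    have hkb : k = b := by
      by_contra hkb
      exact hthird k hkb hkm hk
    subst hkb
    by_cases ht : G.top k y
    · by_cases hyq : q = y
      · rw [hyq]
      · exact (hG.rank_lt k y q ht hyq).le
    · have := h.best y hy.mem_right hy.base_lt ht
      rw [hG.rank_injective a (le_antisymm hyx this)]
      exact hb.le

theorem IsRegular.exists_isEquilibrium (hG : G.IsRegular win) [Finite C] :
    ∃ f, G.IsEquilibrium win f := by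
  by_cases hbest : ∃ b q a x, G.IsBestAgainst b q a x
  · obtain ⟨b, q, a, x, h⟩ := hbest
    obtain ⟨q', ⟨b', a', x', h'⟩, hmax⟩ := Set.exists_max_image
      {q | ∃ b a x, G.IsBestAgainst b q a x} G.base (Set.toFinite _) ⟨q, b, a, x, h⟩
    exact hG.exists_of_isBestAgainst h' fun b'' q'' a'' x'' h'' => hmax q'' ⟨b'', a'', x'', h''⟩
  push Not at hbest
  by_cases hsincere : G.IsEquilibrium win fun _ => none
  · exact ⟨_, hsincere⟩
  obtain ⟨a, o, ho, hlt⟩ : ∃ a o, G.Allowed a o ∧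
      G.rank a (win (Function.update (fun _ => none) a o)) < G.rank a (win fun _ => none) := by
    by_contra! hcon
    exact hsincere ⟨by simp [Allowed], hcon⟩
  cases o with
  | none => exact absurd hlt (by simp)
  | some t =>
    obtain ⟨x, hx, hmin⟩ := Set.exists_min_image (G.targets a) (G.rank a) (Set.toFinite _)
      ⟨t, ho t rfl⟩
    have ht : win (Function.update (fun _ => none) a (some t)) = t := by
      by_contra hne
      obtain ⟨y, hy⟩ : ∃ y, y = win (Function.update (fun _ => none) a (some t)) := ⟨_, rfl⟩
      obtain ⟨w, hw⟩ : ∃ w, w = win (fun _ : ι => (none : Option C)) := ⟨_, rfl⟩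
      rw [← hy, ← hw] at hlt
      rw [← hy] at hne
      have h₁ := hG.key_le (Function.update (fun _ => none) a (some t)) w
      have hwy : y ≠ w := by rintro rfl; omega
      have h₂ := hG.key_lt (fun _ => none) y (hw ▸ hwy)
      have htop := fun h => hG.rank_lt a w y h hwy
      have hu := hG.unit_pos
      rw [← hy, key_update, key_update, key_none, key_none] at h₁
      rw [← hw, key_none, key_none] at h₂
      grind [contrib]
    refine hG.exists_of_single hx hmin ?_ fun l hla e he hxe hae => ?_
    · have := hmin t (ho t rfl)
      rw [ht] at hlt
      omega
    · by_contra! hr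
      obtain ⟨y, hy, -⟩ := G.exists_isBestAgainst hla hx he hxe hae hr
      exact hbest _ _ _ _ hy

end SwingGame

section Plurality

variable {C : Type*} [Fintype C] {n : ℕ}

/-- The weight of one approval in `pluralityKey`: more than any tie-breaking index. -/
def approvalWeight (tb : C → ℕ) : ℤ := (Finset.univ.sup tb : ℕ) + 1

theorem lt_approvalWeight (tb : C → ℕ) (c : C) : (tb c : ℤ) < approvalWeight tb := by
  have := Finset.le_sup (f := tb) (Finset.mem_univ c)
  unfold approvalWeight
  omega

/-- The Plurality score and the tie-breaking index merged into a single integer. -/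
def pluralityKey (tb : C → ℕ) (P : Fin n → C → ℕ) (c : C) : ℤ :=
  ∑ i, (if P i c = 0 then approvalWeight tb else 0) - tb c

theorem pluralityKey_update (tb : C → ℕ) (P : Fin n → C → ℕ) (i : Fin n) (v : C → ℕ) (c : C) :
    pluralityKey tb (Function.update P i v) c =
      pluralityKey tb P c + (if v c = 0 then approvalWeight tb else 0) -
        (if P i c = 0 then approvalWeight tb else 0) := by
  have h : ∀ j, (if Function.update P i v j c = 0 then approvalWeight tb else 0) =
      (if P j c = 0 then approvalWeight tb else 0) + if j = i then
        (if v c = 0 then approvalWeight tb else 0) - (if P i c = 0 then approvalWeight tb else 0)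
        else 0 := by
    intro j
    by_cases hj : j = i
    · subst hj; simp
    · simp [hj]
  simp only [pluralityKey, h, Finset.sum_add_distrib, Finset.sum_ite_eq', Finset.mem_univ, if_true]
  ring

variable [DecidableEq C]

theorem pluralityKey_eq (tb : C → ℕ) (P : Fin n → C → ℕ) (c : C) :
    pluralityKey tb P c = approvalScore 1 P c * approvalWeight tb - tb c := by
  simp [pluralityKey, approvalScore, ← Finset.sum_filter]

theorem pluralityKey_lt_iff (tb : C → ℕ) (P : Fin n → C → ℕ) (c d : C) :
    pluralityKey tb P c < pluralityKey tb P d ↔ approvalScore 1 P c < approvalScore 1 P d ∨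
      (approvalScore 1 P c = approvalScore 1 P d ∧ tb d < tb c) := by
  have hc := lt_approvalWeight tb c
  have hd := lt_approvalWeight tb d
  rw [pluralityKey_eq, pluralityKey_eq]
  rcases lt_trichotomy (approvalScore 1 P c) (approvalScore 1 P d) with h | h | h
  · have : (approvalScore 1 P c : ℤ) + 1 ≤ approvalScore 1 P d := by exact_mod_cast h
    simp only [h, true_or, iff_true]
    nlinarith
  · simp [h]
  · have : (approvalScore 1 P d : ℤ) + 1 ≤ approvalScore 1 P c := by exact_mod_cast h
    simp only [h.not_gt, h.ne', false_and, or_self, iff_false, not_lt]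
    nlinarith

theorem pluralityKey_injective {tb : C → ℕ} (htb : Function.Injective tb) (P : Fin n → C → ℕ) :
    Function.Injective (pluralityKey tb P) := by
  intro c d h
  have hcd := (pluralityKey_lt_iff tb P c d).not.1 h.not_lt
  have hdc := (pluralityKey_lt_iff tb P d c).not.1 h.symm.not_lt
  exact htb (by omega)

/-- The game in which the deviations of voter `i` are identified with the candidates they put
on top, restricted to those that can win if they gain one vote. -/
def swingGame (V : Fin n → C → ℕ) (tb : C → ℕ) (A : Fin n → Set (C → ℕ)) :
    SwingGame (Fin n) C where
  base := pluralityKey tb V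
  unit := approvalWeight tb
  top i c := V i c = 0
  rank := V
  targets i := {c | V i c ≠ 0 ∧
    (∀ d, pluralityKey tb V d < pluralityKey tb V c + approvalWeight tb) ∧ ∃ v ∈ A i, v c = 0}

theorem exists_profile_of_swingGame (V : Fin n → C → ℕ) (tb : C → ℕ) {A : Fin n → Set (C → ℕ)}
    (hsin : ∀ i, V i ∈ A i) (hinj : ∀ i, ∀ v ∈ A i, Function.Injective v) :
    ∃ vote : Fin n → Option C → C → ℕ, (∀ i, vote i none = V i) ∧
      (∀ i c d, vote i (some c) d = 0 ↔ d = c) ∧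
      ∀ i o, (swingGame V tb A).Allowed i o → vote i o ∈ A i := by
  have h : ∀ i o, ∃ v : C → ℕ, (o = none → v = V i) ∧ (∀ c, o = some c → ∀ d, v d = 0 ↔ d = c) ∧
      ((swingGame V tb A).Allowed i o → v ∈ A i) := by
    rintro i (_ | c)
    · exact ⟨V i, by simp [hsin]⟩
    · by_cases hc : ∃ v ∈ A i, v c = 0
      · obtain ⟨v, hv, hvc⟩ := hc
        refine ⟨v, by simp, ?_, fun _ => hv⟩
        rintro _ ⟨⟩ d
        exact ⟨fun hd => hinj i v hv (hd.trans hvc.symm), fun hd => hd ▸ hvc⟩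
      · refine ⟨fun d => if d = c then 0 else 1, by simp, ?_, fun h => absurd (h c rfl).2.2 hc⟩
        rintro _ ⟨⟩ d
        simp
  choose vote h₁ h₂ h₃ using h
  exact ⟨vote, fun i => h₁ i none rfl, fun i c => h₂ i _ c rfl, h₃⟩

theorem swingGame_key {V : Fin n → C → ℕ} {tb : C → ℕ} {A : Fin n → Set (C → ℕ)}
    {vote : Fin n → Option C → C → ℕ} (hnone : ∀ i, vote i none = V i)
    (hsome : ∀ i c d, vote i (some c) d = 0 ↔ d = c) (f : Fin n → Option C) (c : C) :
    (swingGame V tb A).key f c = pluralityKey tb (fun i => vote i (f i)) c := by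
  have h : ∀ i, (if vote i (f i) c = 0 then approvalWeight tb else 0) =
      (if V i c = 0 then approvalWeight tb else 0) + (swingGame V tb A).contrib i (f i) c := by
    intro i
    cases hf : f i with
    | none => simp [hnone, SwingGame.contrib]
    | some t =>
      by_cases hv : V i c = 0 <;>
        simp [hsome, SwingGame.contrib, swingGame, eq_comm (a := c), hv]
  simp only [SwingGame.key, pluralityKey, h, Finset.sum_add_distrib]
  simp only [swingGame, pluralityKey]
  ring

variable [Nonempty C]

theorem pluralityKey_lt_winner {tb : C → ℕ} (htb : Function.Injective tb) (P : Fin n → C → ℕ)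
    {c : C} (hc : c ≠ winner 1 P tb) :
    pluralityKey tb P c < pluralityKey tb P (winner 1 P tb) := by
  have h : ∃ w, IsWinner 1 P tb w := by
    obtain ⟨w, hw⟩ := Finite.exists_max (pluralityKey tb P)
    exact ⟨w, fun c hc => (pluralityKey_lt_iff tb P c w).1
      ((hw c).lt_of_ne ((pluralityKey_injective htb P).ne hc))⟩
  have hw : IsWinner 1 P tb (winner 1 P tb) := by
    unfold winner
    rw [dif_pos h]
    exact h.choose_spec
  exact (pluralityKey_lt_iff tb P _ _).2 (hw c hc)

theorem pluralityKey_le_winner {tb : C → ℕ} (htb : Function.Injective tb) (P : Fin n → C → ℕ)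
    (c : C) : pluralityKey tb P c ≤ pluralityKey tb P (winner 1 P tb) := by
  by_cases hc : c = winner 1 P tb
  · rw [← hc]
  · exact (pluralityKey_lt_winner htb P hc).le

theorem winner_congr {tb : C → ℕ} (htb : Function.Injective tb) {P Q : Fin n → C → ℕ}
    (h : ∀ i c, P i c = 0 ↔ Q i c = 0) : winner 1 P tb = winner 1 Q tb := by
  have hkey : pluralityKey tb P = pluralityKey tb Q := by
    ext c
    simp [pluralityKey, h]
  by_contra hne
  have hP := pluralityKey_lt_winner htb P (Ne.symm hne)
  have hQ := pluralityKey_lt_winner htb Q hne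
  rw [hkey] at hP
  exact hP.not_gt hQ

theorem eq_zero_of_winner_update_lt {tb : C → ℕ} (htb : Function.Injective tb)
    {P : Fin n → C → ℕ} {i : Fin n} {v : C → ℕ} {w : C}
    (hw : winner 1 (Function.update P i v) tb = w) (hlt : P i w < P i (winner 1 P tb)) :
    v w = 0 ∧ P i w ≠ 0 ∧
      pluralityKey tb P (winner 1 P tb) < pluralityKey tb P w + approvalWeight tb := by
  have hne : w ≠ winner 1 P tb := by rintro h; rw [← h] at hlt; omega
  have h₁ := pluralityKey_lt_winner htb P hne
  have h₂ := pluralityKey_lt_winner htb (Function.update P i v) (hw ▸ hne.symm)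
  have hpos := lt_approvalWeight tb w
  rw [hw, pluralityKey_update, pluralityKey_update] at h₂
  split_ifs at h₂ <;> grind

theorem exists_target_of_isGSManipulation {tb : C → ℕ} (htb : Function.Injective tb)
    {V : Fin n → C → ℕ} {i : Fin n} {v : C → ℕ} (h : IsGSManipulation 1 V tb i v) :
    ∃ c, v c = 0 ∧ V i c ≠ 0 ∧
      ∀ d, pluralityKey tb V d < pluralityKey tb V c + approvalWeight tb := by
  obtain ⟨hc, hic, hkey⟩ := eq_zero_of_winner_update_lt htb rfl h.2.2.1
  exact ⟨_, hc, hic, fun d => (pluralityKey_le_winner htb V d).trans_lt hkey⟩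

theorem exists_target_of_isCounterManip {tb : C → ℕ} (htb : Function.Injective tb)
    {V : Fin n → C → ℕ} {l i : Fin n} {u v : C → ℕ} (hu : IsGSManipulation 1 V tb l u)
    (h : IsCounterManip 1 V tb l u i v) :
    ∃ c, v c = 0 ∧ V i c ≠ 0 ∧
      ∀ d, pluralityKey tb V d < pluralityKey tb V c + approvalWeight tb := by
  obtain ⟨b, hb⟩ : ∃ b, winner 1 (Function.update V l u) tb = b := ⟨_, rfl⟩
  obtain ⟨hub, hlb, hkey⟩ := eq_zero_of_winner_update_lt htb rfl hu.2.2.1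
  have hi : Function.update V l u i = V i := Function.update_of_ne h.1.symm _ _
  obtain ⟨hc, hic, hkey'⟩ := eq_zero_of_winner_update_lt htb (P := Function.update V l u) rfl
    (by rw [hi]; exact h.2.2.2.1)
  rw [hi] at hic
  refine ⟨_, hc, hic, fun d => ?_⟩
  have hd := pluralityKey_le_winner htb V d
  obtain ⟨c, hc'⟩ : ∃ c, winner 1 (Function.update (Function.update V l u) i v) tb = c := ⟨_, rfl⟩
  have hcb : c ≠ b := by
    have := h.2.2.2.1
    rintro rfl
    rw [hc', hb] at this
    exact this.false
  have huc : u c ≠ 0 := fun h0 => hcb (hu.1 (by rw [h0, ← hb, hub]))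
  rw [hb] at hub hlb hkey
  rw [hb, hc', pluralityKey_update, pluralityKey_update, if_pos hub, if_neg hlb,
    if_neg huc] at hkey'
  rw [hc']
  have := lt_approvalWeight tb c
  split_ifs at hkey' <;> omega

theorem swingGame_isRegular {V : Fin n → C → ℕ} (hV : ∀ i, Function.Injective (V i))
    {tb : C → ℕ} (htb : Function.Injective tb) {A : Fin n → Set (C → ℕ)}
    {vote : Fin n → Option C → C → ℕ} (hnone : ∀ i, vote i none = V i)
    (hsome : ∀ i c d, vote i (some c) d = 0 ↔ d = c) :
    (swingGame V tb A).IsRegular fun f => winner 1 (fun i => vote i (f i)) tb where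
  unit_pos := (Int.natCast_nonneg _).trans_lt (lt_approvalWeight tb (Classical.arbitrary C))
  rank_injective := hV
  base_injective := pluralityKey_injective htb V
  rank_lt i c d hc hd := by
    have hc : V i c = 0 := hc
    have := (hV i).ne hd
    change V i c < V i d
    omega
  not_top _ _ hc := hc.1
  near _ _ hc := hc.2.1
  key_lt f c hc := by
    rw [swingGame_key hnone hsome, swingGame_key hnone hsome]
    exact pluralityKey_lt_winner htb _ hc

end Plurality

/-- Under Plurality, every voting manipulation game (each voter's strategy set
contains his sincere vote, and every insincere strategy is a GS-manipulation
or a countermanipulation against some other voter's GS-manipulation) has a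
pure-strategy Nash equilibrium. -/
theorem stmt9 {C : Type*} [Fintype C] [DecidableEq C] [Nonempty C] {n : ℕ}
    (V : Fin n → C → ℕ) (hV : ∀ i, Function.Injective (V i))
    (tb : C → ℕ) (htb : Function.Injective tb)
    (A : Fin n → Set (C → ℕ))
    (hsin : ∀ i, V i ∈ A i)
    (hinj : ∀ i, ∀ v' ∈ A i, Function.Injective v')
    (hstrat : ∀ i, ∀ v' ∈ A i, v' ≠ V i →
      IsGSManipulation 1 V tb i v' ∨
      ∃ (l : Fin n) (u : C → ℕ), IsGSManipulation 1 V tb l u ∧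
        IsCounterManip 1 V tb l u i v') :
    ∃ σ : Fin n → C → ℕ, (∀ i, σ i ∈ A i) ∧
      ∀ i, ∀ v' ∈ A i,
        ¬ V i (winner 1 (Function.update σ i v') tb) < V i (winner 1 σ tb) := by
  obtain ⟨vote, hnone, hsome, hvote⟩ := exists_profile_of_swingGame V tb hsin hinj
  obtain ⟨f, hf, heq⟩ := (swingGame_isRegular (A := A) hV htb hnone hsome).exists_isEquilibrium
  refine ⟨fun i => vote i (f i), fun i => hvote i _ (hf i), fun i v' hv' => not_lt.2 ?_⟩
  have key : ∀ o, (swingGame V tb A).Allowed i o → (∀ d, vote i o d = 0 ↔ v' d = 0) →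
      V i (winner 1 (fun i => vote i (f i)) tb) ≤
        V i (winner 1 (Function.update (fun i => vote i (f i)) i v') tb) := by
    intro o ho hov
    rw [winner_congr (P := Function.update _ i v')
      (Q := fun j => vote j (Function.update f i o j)) htb fun j c => ?_]
    · exact heq i o ho
    · by_cases hj : j = i
      · subst hj
        simp [hov]
      · simp [hj]
  by_cases hne : v' = V i
  · exact key none (by simp [SwingGame.Allowed]) fun d => by rw [hnone, hne]
  · obtain ⟨c, hc, hic, hnear⟩ : ∃ c, v' c = 0 ∧ V i c ≠ 0 ∧
        ∀ d, pluralityKey tb V d < pluralityKey tb V c + approvalWeight tb := by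
      rcases hstrat i v' hv' hne with h | ⟨l, u, hu, h⟩
      · exact exists_target_of_isGSManipulation htb h
      · exact exists_target_of_isCounterManip htb hu h
    refine key (some c) ?_ fun d => ?_
    · rintro _ ⟨⟩
      exact ⟨hic, hnear, v', hv', hc⟩
    · rw [hsome]
      exact ⟨fun hd => hd ▸ hc, fun hd => hinj i v' hv' (hd.trans hc.symm)⟩
end

section
/- Under the Minimality Assumption, any GS-game for 3-Approval (with fixed tie-breaking) has a pure-strategy Nash equilibrium. -/
/-- Candidates moved up into the approved (top 3) positions by `v'`. -/
def MovedUp {C : Type*} {n : ℕ} (V : Fin n → C → ℕ) (i : Fin n) (v' : C → ℕ) : Set C :=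
  {c | v' c < 3 ∧ ¬ (V i c < 3)}

/-- Candidates moved down out of the approved (top 3) positions by `v'`. -/
def MovedDown {C : Type*} {n : ℕ} (V : Fin n → C → ℕ) (i : Fin n) (v' : C → ℕ) : Set C :=
  {c | V i c < 3 ∧ ¬ (v' c < 3)}

/-- A minimal Type 1 manipulation of voter `i` in favour of `x` under
3-Approval: `w` and `x` are both non-approved sincerely, only `x` is moved
up, into the 3rd position, and the former 3rd-placed candidate drops out of
the approved set (all other approvals are unchanged). -/
def IsMinimalType1 {C : Type*} [Fintype C] [DecidableEq C] [Nonempty C] {n : ℕ}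
    (V : Fin n → C → ℕ) (tb : C → ℕ) (i : Fin n) (v' : C → ℕ) (x : C) : Prop :=
  3 ≤ V i (winner 3 V tb) ∧ 3 ≤ V i x ∧ v' x = 2 ∧
  ∀ c, c ≠ x → (v' c < 3 ↔ V i c < 2)

/-- A minimal Type 2 manipulation of voter `i` in favour of `x` under
3-Approval: `w` and `x` are approved sincerely, `w` is demoted and `x` kept,
the number of demoted candidates is smallest among all manipulations in
favour of `x`, and the promoted candidates are the best (in `i`'s sincere
ranking) previously non-approved candidates. -/
def IsMinimalType2 {C : Type*} [Fintype C] [DecidableEq C] [Nonempty C] {n : ℕ}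
    (V : Fin n → C → ℕ) (tb : C → ℕ) (i : Fin n) (v' : C → ℕ) (x : C) : Prop :=
  V i (winner 3 V tb) < 3 ∧ V i x < 3 ∧
  ¬ (v' (winner 3 V tb) < 3) ∧ v' x < 3 ∧
  (∀ v'' : C → ℕ, Function.Injective v'' →
    winner 3 (Function.update V i v'') tb = x →
    (MovedDown V i v').ncard ≤ (MovedDown V i v'').ncard) ∧
  (∀ c ∈ MovedUp V i v', ∀ c', ¬ (V i c' < 3) → c' ∉ MovedUp V i v' →
    V i c < V i c')

/-- A finite game in which every action of a player shifts the scores of the candidates.  The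
candidates `w`, `b₁`, `b₂` lead the initial ranking `L`; an action can only demote `w` and `b₁`,
and it promotes at most two of the trailing candidates.  Each player `i` has a resting action
`off i` and, if `i ∈ T`, an action `on i` that promotes the single further candidate `τ i`. -/
structure ShiftGame (ι C α : Type*) [Fintype ι] [DecidableEq ι] [DecidableEq C] where
  /-- preference ranking of the players; smaller is better -/
  rank : ι → C → ℕ
  /-- available actions -/
  A : ι → Set α
  /-- score shift caused by an action -/
  d : ι → α → C → ℤ
  /-- initial level of a candidate: score with the tie-breaking built in -/
  L : C → ℤ
  /-- level of one point -/
  N : ℤ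
  w : C
  b₁ : C
  b₂ : C
  /-- sincere approval -/
  ap : ι → C → Prop
  /-- the winner of a profile -/
  win : (ι → α) → C
  /-- the sincere action -/
  s : ι → α
  off : ι → α
  on : ι → α
  τ : ι → C
  /-- players with an `on` action -/
  T : Finset ι
  /-- players approving `b₂` -/
  E : Finset ι
  /-- players able to demote `b₁` -/
  J : Finset ι
  N_pos : 0 < N
  L_inj : ∀ c c', c ≠ c' → ∀ a b : ℤ, L c + N * a ≠ L c' + N * b
  L_b₁ : L b₁ < L w
  L_b₂ : L b₂ < L b₁
  L_lt : ∀ c, c ≠ w → c ≠ b₁ → c ≠ b₂ → L c < L b₂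
  L_w : L w - N < L b₂
  win_spec : ∀ σ c, c ≠ win σ →
    L c + N * ∑ i, d i (σ i) c < L (win σ) + N * ∑ i, d i (σ i) (win σ)
  s_mem : ∀ i, s i ∈ A i
  d_s : ∀ i c, d i (s i) c = 0
  off_mem : ∀ i, off i ∈ A i
  on_mem : ∀ i ∈ T, on i ∈ A i
  d_on : ∀ i ∈ T, ∀ c, c ≠ w → c ≠ b₁ → d i (on i) c = d i (off i) c + if c = τ i then 1 else 0
  τ_ne : ∀ i ∈ T, τ i ≠ w ∧ τ i ≠ b₁
  d_cases : ∀ i, ∀ v ∈ A i,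
    (∀ c, c ≠ w → c ≠ b₁ → d i v c = 0) ∨
    (∀ c, c ≠ w → c ≠ b₁ → d i v c = d i (off i) c) ∨
    (i ∈ T ∧ ∀ c, c ≠ w → c ≠ b₁ → d i v c = d i (on i) c)
  d_zero_or_one : ∀ i, ∀ v ∈ A i, ∀ c, c ≠ w → c ≠ b₁ → d i v c = 0 ∨ d i v c = 1
  d_b₂ : ∀ i, ∀ v ∈ A i, d i v b₂ = 0
  d_w : ∀ i, ∀ v ∈ A i, d i v w = 0 ∨ d i v w = -1
  d_b₁ : ∀ i, ∀ v ∈ A i, d i v b₁ = 0 ∨ d i v b₁ = -1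
  d_eq_zero : ∀ i, ∀ v ∈ A i, d i v w = 0 → ∀ c, d i v c = 0
  mem_J : ∀ i, ∀ v ∈ A i, d i v b₁ = -1 → i ∈ J
  J_d_b₁ : ∀ i ∈ J, ∀ v ∈ A i, d i v w = -1 → d i v b₁ = -1
  J_off : ∀ i ∈ J, d i (off i) b₁ = -1
  J_lt : ∀ i ∈ J, ∀ c, d i (off i) c = 1 → L c + N < L b₂
  J_rank : ∀ i ∈ J, ∀ c, rank i b₂ ≤ rank i c
  J_subset : J ⊆ E
  J_nonempty : J.Nonempty
  rank_up : ∀ i, ∀ v ∈ A i, ∀ c c', d i v c = 1 → d i v c' = 0 → ¬ ap i c' → rank i c < rank i c'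
  rank_ap : ∀ i c c', ap i c → ¬ ap i c' → rank i c < rank i c'
  not_ap : ∀ i, ∀ v ∈ A i, ∀ c, d i v c = 1 → ¬ ap i c
  ap_E : ∀ i ∈ E, ∀ c, ap i c ↔ c = w ∨ c = b₁ ∨ c = b₂
  ap_b₂ : ∀ i, i ∉ E → ¬ ap i b₂
  ap_off : ∀ i, i ∉ E → ∀ c, d i (off i) c = 1 → ∀ c', ap i c' → c' = w ∨ c' = b₁
  active : ∀ i, ∀ v ∈ A i, d i v w = -1 → ap i b₁
  rank_b₁ : ∀ i, i ∉ J → ∀ v ∈ A i, d i v w = -1 → rank i b₁ < rank i w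
  up_le_two : ∀ i, ∀ v ∈ A i, ∀ c₁ c₂ c₃, d i v c₁ = 1 → d i v c₂ = 1 → d i v c₃ = 1 →
    c₁ = c₂ ∨ c₁ = c₃ ∨ c₂ = c₃
  up_le_one : ∀ i ∈ E, i ∉ J → ∀ v ∈ A i, ∀ c₁ c₂, d i v c₁ = 1 → d i v c₂ = 1 → c₁ = c₂

namespace ShiftGame

open Function

variable {ι C α : Type*} [Fintype ι] [DecidableEq ι] [DecidableEq C] (G : ShiftGame ι C α)

/-- The level of a candidate at a profile. -/
def lev (σ : ι → α) (c : C) : ℤ := G.L c + G.N * ∑ i, G.d i (σ i) c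

/-- All players use available actions. -/
def Valid (σ : ι → α) : Prop := ∀ i, σ i ∈ G.A i

/-- Pure Nash equilibria. -/
def IsNash (σ : ι → α) : Prop :=
  G.Valid σ ∧ ∀ i, ∀ v ∈ G.A i, ¬ G.rank i (G.win (update σ i v)) < G.rank i (G.win σ)

/-- Candidates different from `w` and `b₁`. -/
def Trailing (c : C) : Prop := c ≠ G.w ∧ c ≠ G.b₁

variable {G}

lemma Valid.updated {σ : ι → α} (h : G.Valid σ) {i : ι} {v : α} (hv : v ∈ G.A i) :
    G.Valid (update σ i v) := by
  intro k
  by_cases hk : k = i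
  · subst hk; simpa using hv
  · simpa [hk] using h k

variable (G)

lemma lev_update (σ : ι → α) (i : ι) (v : α) (c : C) :
    G.lev (update σ i v) c = G.lev σ c + G.N * (G.d i v c - G.d i (σ i) c) := by
  unfold lev
  rw [← Finset.add_sum_erase _ (fun k => G.d k (update σ i v k) c) (Finset.mem_univ i),
    ← Finset.add_sum_erase _ (fun k => G.d k (σ k) c) (Finset.mem_univ i)]
  have : ∑ k ∈ Finset.univ.erase i, G.d k (update σ i v k) c =
      ∑ k ∈ Finset.univ.erase i, G.d k (σ k) c :=
    Finset.sum_congr rfl fun k hk => by simp [Finset.ne_of_mem_erase hk]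
  rw [this]
  simp only [update_self]
  ring

lemma lev_lt_win (σ : ι → α) {c : C} (h : c ≠ G.win σ) : G.lev σ c < G.lev σ (G.win σ) :=
  G.win_spec σ c h

lemma lev_le_win (σ : ι → α) (c : C) : G.lev σ c ≤ G.lev σ (G.win σ) := by
  by_cases h : c = G.win σ
  · rw [h]
  · exact (G.lev_lt_win σ h).le

lemma lev_ne {c c' : C} (h : c ≠ c') (σ σ' : ι → α) (k : ℤ) :
    G.lev σ c + G.N * k ≠ G.lev σ' c' := by
  unfold lev
  have := G.L_inj c c' h (∑ i, G.d i (σ i) c + k) (∑ i, G.d i (σ' i) c')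
  rw [mul_add, ← add_assoc] at this
  exact this

lemma win_eq {σ : ι → α} {y : C} (h : ∀ c, c ≠ y → G.lev σ c < G.lev σ y) : G.win σ = y := by
  by_contra hne
  exact absurd (h _ hne) (not_lt.2 (G.lev_le_win σ y))

lemma win_congr {σ σ' : ι → α} (h : ∀ c, G.Trailing c → G.lev σ c = G.lev σ' c)
    (hσ : G.Trailing (G.win σ)) (hσ' : G.Trailing (G.win σ')) : G.win σ = G.win σ' := by
  by_contra hne
  have h₁ := G.lev_lt_win σ (Ne.symm hne)
  have h₂ := G.lev_lt_win σ' hne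
  rw [h _ hσ, h _ hσ'] at h₁
  exact absurd h₁ (not_lt.2 h₂.le)

variable {G}

lemma Valid.lev_b₂ {σ : ι → α} (h : G.Valid σ) : G.lev σ G.b₂ = G.L G.b₂ := by
  unfold lev
  rw [Finset.sum_eq_zero fun i _ => G.d_b₂ i _ (h i)]
  simp

lemma Valid.lev_b₁_le {σ : ι → α} (h : G.Valid σ) : G.lev σ G.b₁ ≤ G.L G.b₁ := by
  have : ∑ i, G.d i (σ i) G.b₁ ≤ 0 := Finset.sum_nonpos fun i _ => by
    rcases G.d_b₁ i _ (h i) with h | h <;> omega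
  unfold lev
  nlinarith [G.N_pos]

lemma sum_le_neg_one {f : ι → ℤ} (hf : ∀ i, f i ≤ 0) {i : ι} (hi : f i = -1) :
    ∑ k, f k ≤ -1 := by
  rw [← Finset.add_sum_erase _ _ (Finset.mem_univ i), hi]
  have := Finset.sum_nonpos (s := Finset.univ.erase i) fun k _ => hf k
  omega

lemma Valid.lev_w_le {σ : ι → α} (h : G.Valid σ) {i : ι} (hi : G.d i (σ i) G.w = -1) :
    G.lev σ G.w ≤ G.L G.w - G.N := by
  have := sum_le_neg_one (f := fun k => G.d k (σ k) G.w)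
    (fun k => by rcases G.d_w k _ (h k) with h | h <;> simp [h]) hi
  unfold lev
  nlinarith [G.N_pos]

lemma Valid.d_w_eq {σ : ι → α} (h : G.Valid σ) {i : ι} {c : C} (hi : G.d i (σ i) c ≠ 0) :
    G.d i (σ i) G.w = -1 := by
  rcases G.d_w i _ (h i) with h0 | h1
  · exact absurd (G.d_eq_zero i _ (h i) h0 c) hi
  · exact h1

lemma Trailing.L_le {c : C} (h : G.Trailing c) : G.L c ≤ G.L G.b₂ := by
  by_cases hc : c = G.b₂
  · rw [hc]
  · exact (G.L_lt c h.1 h.2 hc).le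

/-- A trailing candidate above the initial level of `b₁` excludes `w`, `b₁`, `b₂` from winning. -/
lemma Valid.win_of_lt {σ : ι → α} (h : G.Valid σ) {c : C} (hc : G.Trailing c)
    (hlt : G.L G.b₁ < G.lev σ c) : G.Trailing (G.win σ) ∧ G.win σ ≠ G.b₂ := by
  have hle := G.lev_le_win σ c
  have h₁ := h.lev_b₁_le
  have h₂ := h.lev_b₂
  have h₃ := G.L_b₂
  refine ⟨⟨fun hw => ?_, fun hw => ?_⟩, fun hw => ?_⟩
  · by_cases hex : ∃ i, G.d i (σ i) G.w = -1
    · obtain ⟨i, hi⟩ := hex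
      have := h.lev_w_le hi
      have := G.L_w
      rw [hw] at hle
      omega
    · have : G.lev σ c = G.L c := by
        unfold lev
        rw [Finset.sum_eq_zero fun i _ => ?_]
        · simp
        · by_contra hne
          exact hex ⟨i, h.d_w_eq hne⟩
      have := hc.L_le
      omega
  · rw [hw] at hle; omega
  · rw [hw] at hle; omega

/-- If somebody demotes `b₁`, then neither `w` nor `b₁` wins. -/
lemma Valid.win_of_demoted {σ : ι → α} (h : G.Valid σ) {i : ι} (hi : G.d i (σ i) G.b₁ = -1) :
    G.Trailing (G.win σ) := by
  have hle := G.lev_le_win σ G.b₂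
  rw [h.lev_b₂] at hle
  have h₁ := G.L_w
  have h₂ := G.L_b₁
  refine ⟨fun hw => ?_, fun hw => ?_⟩
  · have := h.lev_w_le (h.d_w_eq (i := i) (c := G.b₁) (by omega))
    rw [hw] at hle; omega
  · have := sum_le_neg_one (f := fun k => G.d k (σ k) G.b₁)
      (fun k => by rcases G.d_b₁ k _ (h k) with h | h <;> simp [h]) hi
    have : G.lev σ G.b₁ ≤ G.L G.b₁ - G.N := by
      unfold lev
      nlinarith [G.N_pos]
    rw [hw] at hle; omega

lemma d_off_τ {i : ι} (hi : i ∈ G.T) : G.d i (G.off i) (G.τ i) = 0 := by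
  have hτ := G.τ_ne i hi
  have h₁ := G.d_on i hi _ hτ.1 hτ.2
  rw [if_pos rfl] at h₁
  rcases G.d_zero_or_one i _ (G.on_mem i hi) _ hτ.1 hτ.2 with h | h <;>
  rcases G.d_zero_or_one i _ (G.off_mem i) _ hτ.1 hτ.2 with h' | h' <;> omega

lemma d_on_τ {i : ι} (hi : i ∈ G.T) : G.d i (G.on i) (G.τ i) = 1 := by
  have hτ := G.τ_ne i hi
  rw [G.d_on i hi _ hτ.1 hτ.2, if_pos rfl, d_off_τ hi, zero_add]

lemma d_on_of_ne {i : ι} (hi : i ∈ G.T) {c : C} (hc : G.Trailing c) (hne : c ≠ G.τ i) :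
    G.d i (G.on i) c = G.d i (G.off i) c := by
  rw [G.d_on i hi _ hc.1 hc.2, if_neg hne, add_zero]

/-- A player resting at `off i` or `on i` only has to be tested against the other of these two
actions, provided that no deviation makes an approved leader win. -/
lemma Valid.not_improving {σ : ι → α} (h : G.Valid σ) {i : ι}
    (hσ : G.Trailing (G.win σ))
    (hwin : ∀ v ∈ G.A i, G.Trailing (G.win (update σ i v)) ∧
      (i ∈ G.E → G.win (update σ i v) ≠ G.b₂))
    (hoff : ¬ G.rank i (G.win (update σ i (G.off i))) < G.rank i (G.win σ))
    (hon : i ∈ G.T → ¬ G.rank i (G.win (update σ i (G.on i))) < G.rank i (G.win σ))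
    {v : α} (hv : v ∈ G.A i) : ¬ G.rank i (G.win (update σ i v)) < G.rank i (G.win σ) := by
  have key : ∀ u ∈ G.A i, (∀ c, c ≠ G.w → c ≠ G.b₁ → G.d i v c = G.d i u c) →
      G.win (update σ i v) = G.win (update σ i u) := fun u hu huv =>
    G.win_congr (fun c hc => by rw [G.lev_update, G.lev_update, huv c hc.1 hc.2])
      (hwin v hv).1 (hwin u hu).1
  rcases G.d_cases i v hv with h0 | h1 | ⟨hT, h2⟩
  · intro hlt
    set y := G.win σ with hy
    set y' := G.win (update σ i v) with hy'
    have hne : y ≠ y' := fun e => by rw [← e] at hlt; exact lt_irrefl _ hlt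
    have hy't := (hwin v hv).1
    have h₁ := G.lev_lt_win σ hne.symm
    have h₂ := G.lev_lt_win (update σ i v) hne
    rw [← hy', G.lev_update, G.lev_update, h0 _ hσ.1 hσ.2, h0 _ hy't.1 hy't.2] at h₂
    rw [← hy] at h₁
    have hN := G.N_pos
    have d₁ := G.d_zero_or_one i _ (h i) _ hσ.1 hσ.2
    have d₂ := G.d_zero_or_one i _ (h i) _ hy't.1 hy't.2
    have e₁ : G.d i (σ i) y = 1 := by
      rcases d₁ with e | e
      · rcases d₂ with e' | e' <;> rw [e, e'] at h₂ <;> omega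
      · exact e
    have e₂ : G.d i (σ i) y' = 0 := by
      rcases d₂ with e | e
      · exact e
      · rw [e, e₁] at h₂; omega
    by_cases hex : ∃ c, G.Trailing c ∧ G.d i (G.off i) c = 1
    · obtain ⟨c, -, hc⟩ := hex
      have hnap : ¬ G.ap i y' := by
        intro hap
        by_cases hE : i ∈ G.E
        · rcases (G.ap_E i hE _).1 hap with e | e | e
          · exact hy't.1 e
          · exact hy't.2 e
          · exact (hwin v hv).2 hE e
        · rcases G.ap_off i hE c hc _ hap with e | e
          · exact hy't.1 e
          · exact hy't.2 e
      exact absurd hlt (not_lt.2 (G.rank_up i _ (h i) _ _ e₁ e₂ hnap).le)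
    · have : y' = G.win (update σ i (G.off i)) := by
        refine key _ (G.off_mem i) fun c hcw hcb => ?_
        rw [h0 c hcw hcb]
        rcases G.d_zero_or_one i _ (G.off_mem i) c hcw hcb with e | e
        · exact e.symm
        · exact absurd ⟨c, ⟨hcw, hcb⟩, e⟩ hex
      rw [this] at hlt
      exact hoff hlt
  · rw [key _ (G.off_mem i) h1]; exact hoff
  · rw [key _ (G.on_mem i hT) h2]; exact hon hT

end ShiftGame

namespace ShiftGame

open Function

variable {ι C α : Type*} [Fintype ι] [DecidableEq ι] [DecidableEq C] {G : ShiftGame ι C α}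

lemma Valid.d_nonneg {σ : ι → α} (h : G.Valid σ) (i : ι) {c : C} (hc : G.Trailing c) :
    0 ≤ G.d i (σ i) c := by
  rcases G.d_zero_or_one i _ (h i) c hc.1 hc.2 with e | e <;> omega

lemma win_eq_of_le {σ σ' : ι → α} (hσ' : G.Trailing (G.win σ'))
    (hle : ∀ c, G.Trailing c → G.lev σ' c ≤ G.lev σ c)
    (heq : G.lev σ' (G.win σ) = G.lev σ (G.win σ)) : G.win σ' = G.win σ := by
  by_contra hne
  have h₁ := G.lev_lt_win σ hne
  have h₂ := G.lev_lt_win σ' (Ne.symm hne)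
  have h₃ := hle _ hσ'
  omega

lemma lev_update_of_eq (σ : ι → α) {i : ι} {v : α} {c : C} (h : G.d i v c = G.d i (σ i) c) :
    G.lev (update σ i v) c = G.lev σ c := by
  rw [G.lev_update, h, sub_self, mul_zero, add_zero]

lemma le_lev_update (σ : ι → α) {i : ι} {v : α} (hv : v ∈ G.A i) {c : C}
    (hc : G.Trailing c) : G.lev σ c - G.N * G.d i (σ i) c ≤ G.lev (update σ i v) c := by
  rw [G.lev_update, mul_sub]
  have := G.N_pos
  rcases G.d_zero_or_one i _ hv c hc.1 hc.2 with e | e <;> rw [e] <;> omega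

variable (G)

/-- The profile in which exactly the players of `X` are switched on. -/
def prof (X : Finset ι) (i : ι) : α := if i ∈ X then G.on i else G.off i

variable {G}

lemma prof_valid {X : Finset ι} (hX : X ⊆ G.T) : G.Valid (G.prof X) := by
  intro i
  unfold prof
  split_ifs with h
  · exact G.on_mem i (hX h)
  · exact G.off_mem i

lemma update_prof_on (X : Finset ι) (i : ι) :
    update (G.prof X) i (G.on i) = G.prof (insert i X) := by
  funext k
  by_cases h : k = i
  · subst h; simp [prof]
  · simp [prof, h]

lemma update_prof_off (X : Finset ι) (i : ι) :
    update (G.prof X) i (G.off i) = G.prof (X.erase i) := by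
  funext k
  by_cases h : k = i
  · subst h; simp [prof]
  · simp [prof, h]

lemma lev_prof_insert {X : Finset ι} {i : ι} (hi : i ∈ G.T) (hX : i ∉ X) {c : C}
    (hc : G.Trailing c) :
    G.lev (G.prof (insert i X)) c = G.lev (G.prof X) c + if c = G.τ i then G.N else 0 := by
  rw [← update_prof_on, G.lev_update, show G.prof X i = G.off i by simp [prof, hX],
    G.d_on i hi c hc.1 hc.2]
  split_ifs <;> ring

lemma lev_prof_erase {X : Finset ι} {i : ι} (hi : i ∈ G.T) (hX : i ∈ X) {c : C}
    (hc : G.Trailing c) :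
    G.lev (G.prof (X.erase i)) c = G.lev (G.prof X) c - if c = G.τ i then G.N else 0 := by
  have := lev_prof_insert hi (Finset.notMem_erase i X) hc
  rw [Finset.insert_erase hX] at this
  omega

lemma J_on {i : ι} (hi : i ∈ G.J) (hT : i ∈ G.T) : G.d i (G.on i) G.b₁ = -1 := by
  refine G.J_d_b₁ i hi _ (G.on_mem i hT) ?_
  rcases G.d_w i _ (G.on_mem i hT) with h | h
  · have := G.d_eq_zero i _ (G.on_mem i hT) h (G.τ i)
    rw [d_on_τ hT] at this
    omega
  · exact h

lemma prof_demotes {X : Finset ι} (hX : X ⊆ G.T) {j : ι} (hj : j ∈ G.J) :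
    G.d j (G.prof X j) G.b₁ = -1 := by
  unfold prof
  split_ifs with h
  · exact J_on hj (hX h)
  · exact G.J_off j hj

lemma trailing_win_prof {X : Finset ι} (hX : X ⊆ G.T) : G.Trailing (G.win (G.prof X)) := by
  obtain ⟨j, hj⟩ := G.J_nonempty
  exact (prof_valid hX).win_of_demoted (prof_demotes hX hj)

variable (G)

/-- No player of `X` gains by switching off. -/
def NoDrop (X : Finset ι) : Prop :=
  ∀ t ∈ X, ¬ G.rank t (G.win (G.prof (X.erase t))) < G.rank t (G.win (G.prof X))

/-- No deviation of a single player from `E` brings all trailing candidates down to `b₁`. -/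
def Robust (X : Finset ι) : Prop :=
  ∀ e ∈ G.E, ∃ c, G.Trailing c ∧ G.L G.b₁ < G.lev (G.prof X) c - G.N * G.d e (G.prof X e) c

variable {G}

lemma Robust.lt_win {X : Finset ι} (hX : X ⊆ G.T) (h : G.Robust X) {e : ι} (he : e ∈ G.E) :
    G.L G.b₁ < G.lev (G.prof X) (G.win (G.prof X)) := by
  obtain ⟨c, hc, hlt⟩ := h e he
  have := G.lev_le_win (G.prof X) c
  have := mul_nonneg G.N_pos.le ((prof_valid hX).d_nonneg e hc)
  omega

/-- If switching on `l` changes the winner, then to `τ l`. -/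
lemma win_insert_eq {X : Finset ι} (hX : X ⊆ G.T) {l : ι} (hl : l ∈ G.T) (hlX : l ∉ X)
    (hne : G.win (G.prof (insert l X)) ≠ G.win (G.prof X)) :
    G.win (G.prof (insert l X)) = G.τ l := by
  by_contra h
  refine hne.symm (win_eq_of_le (trailing_win_prof hX) (fun c hc => ?_) ?_)
  · rw [lev_prof_insert hl hlX hc]
    have := G.N_pos
    split_ifs <;> omega
  · rw [lev_prof_insert hl hlX (trailing_win_prof (Finset.insert_subset hl hX)), if_neg h, add_zero]

lemma d_off_eq_zero_of_rank_lt {l : ι} (hl : l ∈ G.T) {y : C} (hy : G.Trailing y)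
    (h : G.rank l (G.τ l) < G.rank l y) : G.d l (G.off l) y = 0 := by
  rcases G.d_zero_or_one l _ (G.off_mem l) y hy.1 hy.2 with e | e
  · exact e
  · have := G.rank_up l _ (G.off_mem l) _ _ e (d_off_τ hl)
      (G.not_ap l _ (G.on_mem l hl) _ (d_on_τ hl))
    omega

lemma Robust.inserted {X : Finset ι} (hX : X ⊆ G.T) (h : G.Robust X) {l : ι} (hl : l ∈ G.T)
    (hlX : l ∉ X)
    (hlt : G.rank l (G.win (G.prof (insert l X))) < G.rank l (G.win (G.prof X))) :
    G.Robust (insert l X) := by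
  have hne : G.win (G.prof (insert l X)) ≠ G.win (G.prof X) := fun e => by
    rw [e] at hlt; exact lt_irrefl _ hlt
  have hτ := win_insert_eq hX hl hlX hne
  rw [hτ] at hlt hne
  have hN := G.N_pos
  have hy := trailing_win_prof hX
  intro e he
  by_cases hel : e = l
  · subst hel
    refine ⟨_, hy, ?_⟩
    rw [lev_prof_insert hl hlX hy, if_neg hne.symm, show G.prof (insert e X) e = G.on e by
      simp [prof], d_on_of_ne hl hy hne.symm, d_off_eq_zero_of_rank_lt hl hy hlt]
    have := h.lt_win hX he
    omega
  · obtain ⟨c, hc, hlt⟩ := h e he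
    refine ⟨c, hc, ?_⟩
    rw [lev_prof_insert hl hlX hc, show G.prof (insert l X) e = G.prof X e by
      simp [prof, hel]]
    split_ifs <;> omega

/-- Replacing `t` by `l` when both promote the same candidate. -/
lemma lev_prof_swap {X : Finset ι} (hX : X ⊆ G.T) {l t : ι} (hl : l ∈ G.T) (hlX : l ∉ X)
    (ht : t ∈ X) (hτ : G.τ t = G.τ l) {c : C} (hc : G.Trailing c) :
    G.lev (G.prof ((insert l X).erase t)) c = G.lev (G.prof X) c := by
  rw [lev_prof_erase (hX ht) (Finset.mem_insert_of_mem ht) hc, lev_prof_insert hl hlX hc, hτ]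
  omega

lemma Robust.swap {X : Finset ι} (hX : X ⊆ G.T) (h : G.Robust X) {l t : ι} (hl : l ∈ G.T)
    (hlX : l ∉ X) (ht : t ∈ X) (hτ : G.τ t = G.τ l) (hne : G.win (G.prof X) ≠ G.τ l)
    (hlt : G.rank l (G.τ l) < G.rank l (G.win (G.prof X))) :
    G.Robust ((insert l X).erase t) := by
  have hlt' : l ≠ t := fun e => hlX (e ▸ ht)
  have hy := trailing_win_prof hX
  intro e he
  by_cases hel : e = l
  · subst hel
    refine ⟨_, hy, ?_⟩
    rw [lev_prof_swap hX hl hlX ht hτ hy,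
      show G.prof ((insert e X).erase t) e = G.on e by simp [prof, hlt'],
      d_on_of_ne hl hy hne, d_off_eq_zero_of_rank_lt hl hy hlt]
    have := h.lt_win hX he
    omega
  · obtain ⟨c, hc, hlt⟩ := h e he
    refine ⟨c, hc, ?_⟩
    rw [lev_prof_swap hX hl hlX ht hτ hc]
    by_cases het : e = t
    · subst het
      rw [show G.prof ((insert l X).erase e) e = G.off e by simp [prof]]
      rw [show G.prof X e = G.on e by simp [prof, ht], G.d_on e (hX ht) c hc.1 hc.2, mul_add] at hlt
      have := G.N_pos
      split_ifs at hlt <;> omega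
    · rwa [show G.prof ((insert l X).erase t) e = G.prof X e by simp [prof, hel, het]]

lemma win_erase_of_ne {X : Finset ι} (hX : X ⊆ G.T) {t : ι} (ht : t ∈ X)
    (hne : G.win (G.prof X) ≠ G.τ t) : G.win (G.prof (X.erase t)) = G.win (G.prof X) := by
  refine win_eq_of_le (trailing_win_prof ((Finset.erase_subset _ _).trans hX)) (fun c hc => ?_) ?_
  · rw [lev_prof_erase (hX ht) ht hc]
    have := G.N_pos
    split_ifs <;> omega
  · rw [lev_prof_erase (hX ht) ht (trailing_win_prof hX), if_neg hne, sub_zero]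

lemma noDrop_of_win_ne {X : Finset ι} (hX : X ⊆ G.T) (h : ∀ t ∈ X, G.win (G.prof X) ≠ G.τ t) :
    G.NoDrop X := fun t ht => by
  rw [win_erase_of_ne hX ht (h t ht)]
  exact lt_irrefl _

lemma win_swap {X : Finset ι} (hX : X ⊆ G.T) {l t : ι} (hl : l ∈ G.T) (hlX : l ∉ X)
    (ht : t ∈ X) (hτ : G.τ t = G.τ l) :
    G.win (G.prof ((insert l X).erase t)) = G.win (G.prof X) :=
  G.win_congr (fun _ hc => lev_prof_swap hX hl hlX ht hτ hc)
    (trailing_win_prof ((Finset.erase_subset _ _).trans (Finset.insert_subset hl hX)))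
    (trailing_win_prof hX)

lemma NoDrop.swap {X : Finset ι} (hX : X ⊆ G.T) (h : G.NoDrop X) {l t : ι} (hl : l ∈ G.T)
    (hlX : l ∉ X) (ht : t ∈ X) (hτ : G.τ t = G.τ l) (hne : G.win (G.prof X) ≠ G.τ l) :
    G.NoDrop ((insert l X).erase t) := by
  have hX₂ : (insert l X).erase t ⊆ G.T :=
    (Finset.erase_subset _ _).trans (Finset.insert_subset hl hX)
  have hwin := win_swap hX hl hlX ht hτ
  intro s hs
  by_cases hsτ : G.τ s = G.τ l
  · rw [win_erase_of_ne hX₂ hs (by rw [hwin, hsτ]; exact hne)]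
    exact lt_irrefl _
  · have hsl : s ≠ l := fun e => hsτ (by rw [e])
    have hst : s ≠ t := fun e => hsτ (by rw [e, hτ])
    have hsX : s ∈ X := by
      rw [Finset.mem_erase, Finset.mem_insert] at hs
      tauto
    have : ((insert l X).erase t).erase s = (insert l (X.erase s)).erase t := by
      ext k
      simp only [Finset.mem_erase, Finset.mem_insert]
      constructor
      · tauto
      · rintro ⟨h₁, rfl | h₂⟩
        · exact ⟨hsl.symm, h₁, Or.inl rfl⟩
        · tauto
    rw [this, win_swap ((Finset.erase_subset _ _).trans hX) hl
      (fun hm => hlX (Finset.mem_of_mem_erase hm)) (Finset.mem_erase.2 ⟨hst.symm, ht⟩) hτ, hwin]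
    exact h s hsX

/-- Starting from a robust set without droppers one reaches a set that is also stable under
joining. -/
lemma exists_stable {X₀ : Finset ι} (hX₀ : X₀ ⊆ G.T) (h₁ : G.NoDrop X₀) (h₂ : G.Robust X₀) :
    ∃ X ⊆ G.T, G.NoDrop X ∧ G.Robust X ∧ ∀ l ∈ G.T, l ∉ X →
      ¬ G.rank l (G.win (G.prof (insert l X))) < G.rank l (G.win (G.prof X)) := by
  classical
  let score (X : Finset ι) : ℤ ×ₗ ℕ := toLex (G.lev (G.prof X) (G.win (G.prof X)),
    (X.filter fun i => G.rank i (G.τ i) < G.rank i (G.win (G.prof X))).card)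
  obtain ⟨X, hXm, hmax⟩ := Finset.exists_max_image
    (G.T.powerset.filter fun X => G.NoDrop X ∧ G.Robust X) score
    ⟨X₀, by simp [hX₀, h₁, h₂]⟩
  simp only [Finset.mem_filter, Finset.mem_powerset] at hXm hmax
  obtain ⟨hX, hnd, hrob⟩ := hXm
  refine ⟨X, hX, hnd, hrob, fun l hl hlX hlt => ?_⟩
  have hne : G.win (G.prof (insert l X)) ≠ G.win (G.prof X) := fun e => by
    rw [e] at hlt; exact lt_irrefl _ hlt
  have hτ := win_insert_eq hX hl hlX hne
  have hlX' : insert l X ⊆ G.T := Finset.insert_subset hl hX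
  have hy := trailing_win_prof hX
  have hyτ : G.win (G.prof X) ≠ G.τ l := by rw [← hτ]; exact hne.symm
  have hlev : G.lev (G.prof X) (G.win (G.prof X)) <
      G.lev (G.prof (insert l X)) (G.win (G.prof (insert l X))) := by
    have := G.lev_lt_win (G.prof (insert l X)) hne.symm
    rwa [lev_prof_insert hl hlX hy, if_neg hyτ, add_zero] at this
  by_cases hnd' : G.NoDrop (insert l X)
  · have := hmax _ ⟨hlX', hnd', hrob.inserted hX hl hlX hlt⟩
    rw [Prod.Lex.toLex_le_toLex] at this
    simp only at this
    omega
  · unfold NoDrop at hnd'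
    push Not at hnd'
    obtain ⟨t, htm, hdrop⟩ := hnd'
    have htl : t ≠ l := by
      rintro rfl
      rw [Finset.erase_insert hlX] at hdrop
      omega
    have ht : t ∈ X := (Finset.mem_insert.1 htm).resolve_left htl
    have hτt : G.τ t = G.τ l := by
      by_contra hcon
      rw [win_erase_of_ne hlX' htm (by rw [hτ]; exact Ne.symm hcon)] at hdrop
      exact lt_irrefl _ hdrop
    have hwin := win_swap hX hl hlX ht hτt
    rw [hτ] at hlt
    have := hmax _ ⟨(Finset.erase_subset t _).trans hlX', hnd.swap hX hl hlX ht hτt hyτ,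
      hrob.swap hX hl hlX ht hτt hyτ hlt⟩
    rw [Prod.Lex.toLex_le_toLex] at this
    simp only [hwin, lev_prof_swap hX hl hlX ht hτt hy] at this
    rw [hwin, hτ, ← hτt] at hdrop
    have hcard : (((insert l X).erase t).filter
        fun i => G.rank i (G.τ i) < G.rank i (G.win (G.prof X))) =
        insert l (X.filter fun i => G.rank i (G.τ i) < G.rank i (G.win (G.prof X))) := by
      ext k
      simp only [Finset.mem_filter, Finset.mem_erase, Finset.mem_insert]
      constructor
      · tauto
      · rintro (rfl | ⟨hk, hr⟩)
        · exact ⟨⟨htl.symm, Or.inl rfl⟩, hlt⟩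
        · refine ⟨⟨?_, Or.inr hk⟩, hr⟩
          rintro rfl
          omega
    rw [hcard, Finset.card_insert_of_notMem (by simp [hlX])] at this
    omega

/-- A robust set without droppers yields an equilibrium. -/
lemma exists_isNash_of_robust {X₀ : Finset ι} (hX₀ : X₀ ⊆ G.T) (h₁ : G.NoDrop X₀)
    (h₂ : G.Robust X₀) : ∃ σ, G.IsNash σ := by
  obtain ⟨X, hX, hnd, hrob, hst⟩ := exists_stable hX₀ h₁ h₂
  have hval := prof_valid hX
  refine ⟨G.prof X, hval, fun i v hv => hval.not_improving (trailing_win_prof hX) ?_ ?_ ?_ hv⟩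
  · intro u hu
    by_cases hE : i ∈ G.E
    · obtain ⟨c, hc, hlt⟩ := hrob i hE
      have := (hval.updated hu).win_of_lt hc (hlt.trans_le (le_lev_update _ hu hc))
      exact ⟨this.1, fun _ => this.2⟩
    · obtain ⟨j, hj⟩ := G.J_nonempty
      have hji : j ≠ i := fun e => hE (e ▸ G.J_subset hj)
      exact ⟨(hval.updated hu).win_of_demoted (i := j) (by
        rw [update_of_ne hji]; exact prof_demotes hX hj), fun h => absurd h hE⟩
  · rw [update_prof_off]
    by_cases hi : i ∈ X
    · exact hnd i hi
    · rw [Finset.erase_eq_of_notMem hi]; exact lt_irrefl _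
  · intro hT
    rw [update_prof_on]
    by_cases hi : i ∈ X
    · rw [Finset.insert_eq_of_mem hi]; exact lt_irrefl _
    · exact hst i hT hi

end ShiftGame

namespace ShiftGame

open Function

variable {ι C α : Type*} [Fintype ι] [DecidableEq ι] [DecidableEq C] {G : ShiftGame ι C α}

variable (G)

/-- The profile in which the players of `X` are switched on and the other players of `E` are
sincere. -/
def rest (X : Finset ι) (i : ι) : α :=
  if i ∈ X then G.on i else if i ∈ G.E then G.s i else G.off i

variable {G}

lemma rest_of_mem {X : Finset ι} {i : ι} (h : i ∈ X) : G.rest X i = G.on i := by simp [rest, h]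

lemma rest_of_notMem {X : Finset ι} {i : ι} (h : i ∉ X) (hE : i ∉ G.E) :
    G.rest X i = G.off i := by simp [rest, h, hE]

lemma rest_of_mem_E {X : Finset ι} (hX : X ⊆ G.T \ G.E) {i : ι} (hE : i ∈ G.E) :
    G.rest X i = G.s i := by
  have : i ∉ X := fun h => (Finset.mem_sdiff.1 (hX h)).2 hE
  simp [rest, this, hE]

lemma rest_valid {X : Finset ι} (hX : X ⊆ G.T \ G.E) : G.Valid (G.rest X) := by
  intro i
  unfold rest
  split_ifs with h
  · exact G.on_mem i (Finset.mem_sdiff.1 (hX h)).1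
  · exact G.s_mem i
  · exact G.off_mem i

lemma update_rest_on (X : Finset ι) (i : ι) :
    update (G.rest X) i (G.on i) = G.rest (insert i X) := by
  funext k
  by_cases h : k = i
  · subst h; simp [rest]
  · simp [rest, h]

lemma lev_rest_insert {X : Finset ι} {i : ι} (hi : i ∈ G.T \ G.E) (hX : i ∉ X) {c : C}
    (hc : G.Trailing c) :
    G.lev (G.rest (insert i X)) c = G.lev (G.rest X) c + if c = G.τ i then G.N else 0 := by
  rw [Finset.mem_sdiff] at hi
  rw [← update_rest_on, G.lev_update, rest_of_notMem hX hi.2, G.d_on i hi.1 c hc.1 hc.2]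
  split_ifs <;> ring

lemma lev_rest {X : Finset ι} (hX : X ⊆ G.T \ G.E) {c : C} (hc : G.Trailing c) :
    G.lev (G.rest X) c = G.lev (G.rest ∅) c + G.N * (X.filter fun i => G.τ i = c).card := by
  induction X using Finset.induction_on with
  | empty => simp
  | insert i X hi ih =>
    rw [Finset.insert_subset_iff] at hX
    rw [lev_rest_insert hX.1 hi hc, ih hX.2, Finset.filter_insert]
    by_cases h : G.τ i = c
    · rw [if_pos h.symm, if_pos h, Finset.card_insert_of_notMem (by simp [hi])]
      push_cast
      ring
    · rw [if_neg (Ne.symm h), if_neg h, add_zero]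

lemma lev_prof {X : Finset ι} (hX : X ⊆ G.T \ G.E) (c : C) :
    G.lev (G.prof X) c = G.lev (G.rest X) c + G.N * ∑ e ∈ G.E, G.d e (G.off e) c := by
  unfold lev
  have : ∑ e ∈ G.E, G.d e (G.off e) c = ∑ e, if e ∈ G.E then G.d e (G.off e) c else 0 := by
    simp
  rw [this, add_assoc, ← mul_add, ← Finset.sum_add_distrib]
  congr 2
  refine Finset.sum_congr rfl fun i _ => ?_
  by_cases hE : i ∈ G.E
  · have : i ∉ X := fun h => (Finset.mem_sdiff.1 (hX h)).2 hE
    rw [rest_of_mem_E hX hE, G.d_s, if_pos hE]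
    simp [prof, this]
  · simp [prof, rest, hE]

lemma prof_of_mem_E {X : Finset ι} (hX : X ⊆ G.T \ G.E) {i : ι} (hE : i ∈ G.E) :
    G.prof X i = G.off i := by
  have : i ∉ X := fun h => (Finset.mem_sdiff.1 (hX h)).2 hE
  simp [prof, this]

lemma d_off_nonneg (i : ι) {c : C} (hc : G.Trailing c) : 0 ≤ G.d i (G.off i) c := by
  rcases G.d_zero_or_one i _ (G.off_mem i) c hc.1 hc.2 with e | e <;> omega

lemma lev_rest_le {X : Finset ι} (hX : X ⊆ G.T \ G.E) {e : ι} (he : e ∈ G.E) {c : C}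
    (hc : G.Trailing c) :
    G.lev (G.rest X) c ≤ G.lev (G.prof X) c - G.N * G.d e (G.prof X e) c := by
  rw [lev_prof hX, prof_of_mem_E hX he]
  have := Finset.single_le_sum (f := fun e => G.d e (G.off e) c) (s := G.E)
    (fun i _ => d_off_nonneg i hc) he
  nlinarith [G.N_pos]

lemma d_rest_b₁ {X : Finset ι} (hX : X ⊆ G.T \ G.E) (i : ι) : G.d i (G.rest X i) G.b₁ = 0 := by
  rcases G.d_b₁ i _ (rest_valid hX i) with e | e
  · exact e
  · rw [rest_of_mem_E hX (G.J_subset (G.mem_J i _ (rest_valid hX i) e)), G.d_s]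

lemma lev_rest_b₁ {X : Finset ι} (hX : X ⊆ G.T \ G.E) : G.lev (G.rest X) G.b₁ = G.L G.b₁ := by
  unfold lev
  rw [Finset.sum_eq_zero fun i _ => d_rest_b₁ hX i]
  simp

lemma lev_update_rest {X : Finset ι} (hX : X ⊆ G.T \ G.E) {j : ι} (hj : j ∈ G.E) (v : α) (c : C) :
    G.lev (update (G.rest X) j v) c = G.lev (G.rest X) c + G.N * G.d j v c := by
  rw [G.lev_update, rest_of_mem_E hX hj, G.d_s, sub_zero]

/-- If `b₁` wins at `rest X`, then the only beneficial deviations are those of players in `J`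
making `b₂` win. -/
lemma exists_win_b₂ {X : Finset ι} (hX : X ⊆ G.T \ G.E) (hw : G.win (G.rest X) = G.b₁)
    (hN : ¬ G.IsNash (G.rest X)) :
    ∃ j ∈ G.J, ∃ v ∈ G.A j, G.win (update (G.rest X) j v) = G.b₂ := by
  have hval := rest_valid hX
  have : ∃ i, ∃ v ∈ G.A i, G.rank i (G.win (update (G.rest X) i v)) < G.rank i G.b₁ := by
    by_contra hcon
    push Not at hcon
    exact hN ⟨hval, fun i v hv => by rw [hw]; exact not_lt.2 (hcon i v hv)⟩
  obtain ⟨i, v, hv, hlt⟩ := this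
  have hne : G.win (update (G.rest X) i v) ≠ G.b₁ := fun e => by
    rw [e] at hlt; exact lt_irrefl _ hlt
  have hact : G.d i v G.w = -1 ∨ G.d i (G.rest X i) G.w = -1 := by
    rcases G.d_w i v hv with h | h
    · rcases G.d_w i _ (hval i) with h' | h'
      · refine absurd (G.win_eq fun c hc => ?_) hne
        have hz : ∀ c, G.lev (update (G.rest X) i v) c = G.lev (G.rest X) c := fun c =>
          lev_update_of_eq _ (by rw [G.d_eq_zero i v hv h, G.d_eq_zero i _ (hval i) h'])
        rw [hz, hz]
        rw [← hw] at hc ⊢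
        exact G.lev_lt_win _ hc
      · exact Or.inr h'
    · exact Or.inl h
  have hapb : G.ap i G.b₁ := by
    rcases hact with h | h
    · exact G.active i _ hv h
    · exact G.active i _ (hval i) h
  have hap : G.ap i (G.win (update (G.rest X) i v)) := by
    by_contra hcon
    have := G.rank_ap i _ _ hapb hcon
    omega
  by_cases hJ : i ∈ G.J
  · have hE := G.J_subset hJ
    have hvw : G.d i v G.w = -1 := by
      rcases hact with h | h
      · exact h
      · rw [rest_of_mem_E hX hE, G.d_s] at h; omega
    have htr := (hval.updated hv).win_of_demoted (i := i) (by
      rw [update_self]; exact G.J_d_b₁ i hJ v hv hvw)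
    rcases (G.ap_E i hE _).1 hap with e | e | e
    · exact absurd e htr.1
    · exact absurd e htr.2
    · exact ⟨i, hJ, v, hv, e⟩
  · exfalso
    have hb : G.lev (update (G.rest X) i v) G.b₁ = G.lev (G.rest X) G.b₁ := by
      refine lev_update_of_eq _ ?_
      rw [d_rest_b₁ hX]
      rcases G.d_b₁ i v hv with h | h
      · exact h
      · exact absurd (G.mem_J i v hv h) hJ
    by_cases hyw : G.win (update (G.rest X) i v) = G.w
    · rw [hyw] at hlt
      rcases hact with h | h
      · have := G.rank_b₁ i hJ _ hv h; omega
      · have := G.rank_b₁ i hJ _ (hval i) h; omega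
    · have hz : ∀ u ∈ G.A i, G.d i u (G.win (update (G.rest X) i v)) = 0 := fun u hu => by
        rcases G.d_zero_or_one i u hu _ hyw hne with h | h
        · exact h
        · exact absurd hap (G.not_ap i u hu _ h)
      have h₁ := lev_update_of_eq (G := G) (G.rest X) (i := i) (v := v)
        (c := G.win (update (G.rest X) i v)) (by rw [hz v hv, hz _ (hval i)])
      have h₂ := G.lev_lt_win (update (G.rest X) i v) hne.symm
      have h₃ := G.lev_le_win (G.rest X) (G.win (update (G.rest X) i v))
      rw [hw] at h₃
      omega

lemma demoted_of_win_b₂ {X : Finset ι} (hX : X ⊆ G.T \ G.E) {j : ι} (hj : j ∈ G.J) {v : α}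
    (hv : v ∈ G.A j) (hw : G.win (update (G.rest X) j v) = G.b₂) : G.d j v G.b₁ = -1 := by
  rcases G.d_b₁ j v hv with h | h
  · have h₁ := G.lev_le_win (update (G.rest X) j v) G.b₁
    rw [hw, ((rest_valid hX).updated hv).lev_b₂, lev_update_rest hX (G.J_subset hj), h,
      lev_rest_b₁ hX] at h₁
    have := G.L_b₂
    omega
  · exact h

/-- If a deviation from `rest X` makes `b₂` win, then only the players outside `E` that are not
yet switched on can gain. -/
lemma exists_joiner {X : Finset ι} (hX : X ⊆ G.T \ G.E) {j : ι} (hj : j ∈ G.J) {v : α}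
    (hv : v ∈ G.A j) (hw : G.win (update (G.rest X) j v) = G.b₂)
    (hN : ¬ G.IsNash (update (G.rest X) j v)) :
    ∃ i ∈ (G.T \ G.E) \ X, G.L G.b₂ < G.lev (update (G.rest X) j v) (G.τ i) + G.N := by
  have hd := demoted_of_win_b₂ hX hj hv hw
  have hval := (rest_valid hX).updated hv
  set R := update (G.rest X) j v with hR
  have : ∃ i, ∃ u ∈ G.A i, G.rank i (G.win (update R i u)) < G.rank i G.b₂ := by
    by_contra hcon
    push Not at hcon
    exact hN ⟨hval, fun i v hv => by rw [hw]; exact not_lt.2 (hcon i v hv)⟩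
  obtain ⟨i, u, hu, hlt⟩ := this
  set y := G.win (update R i u) with hy
  have hiJ : i ∉ G.J := fun h => by have := G.J_rank i h y; omega
  have hij : j ≠ i := fun e => hiJ (e ▸ hj)
  have hytr : G.Trailing y := (hval.updated hu).win_of_demoted (i := j) (by
    rw [update_of_ne hij, hR, update_self]; exact hd)
  have hyb : y ≠ G.b₂ := fun e => by rw [e] at hlt; exact lt_irrefl _ hlt
  have h₁ := G.lev_lt_win R (c := y) (by rw [hw]; exact hyb)
  have h₂ := G.lev_lt_win (update R i u) (c := G.b₂) hyb.symm
  rw [(hval.updated hu).lev_b₂, ← hy, G.lev_update] at h₂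
  rw [hw, hval.lev_b₂] at h₁
  have hNp := G.N_pos
  have hd₀ : G.d i u y = 1 ∧ G.d i (R i) y = 0 := by
    rcases G.d_zero_or_one i u hu y hytr.1 hytr.2 with e | e <;>
    rcases G.d_zero_or_one i _ (hval i) y hytr.1 hytr.2 with e' | e' <;>
    rw [e, e'] at h₂ <;> first | exact ⟨e, e'⟩ | omega
  obtain ⟨hd₁, hd₂⟩ := hd₀
  have hiE : i ∉ G.E := fun hE => by
    have := G.rank_ap i _ _ ((G.ap_E i hE G.b₂).2 (Or.inr (Or.inr rfl))) (G.not_ap i u hu y hd₁)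
    omega
  have hRi : R i = G.rest X i := update_of_ne hij.symm _ _
  rw [hRi] at hd₂ h₂
  have hoff : G.d i (G.off i) y = 0 := by
    by_cases hiX : i ∈ X
    · have hT := (Finset.mem_sdiff.1 (hX hiX)).1
      rw [rest_of_mem hiX, G.d_on i hT y hytr.1 hytr.2] at hd₂
      have := d_off_nonneg i hytr
      split_ifs at hd₂ <;> omega
    · rwa [rest_of_notMem hiX hiE] at hd₂
  rcases G.d_cases i u hu with h | h | ⟨hT, h⟩
  · have := h y hytr.1 hytr.2; omega
  · have := h y hytr.1 hytr.2; omega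
  · have h := h y hytr.1 hytr.2
    have hiX : i ∉ X := fun hiX => by rw [rest_of_mem hiX] at hd₂; omega
    have hτ : y = G.τ i := by
      by_contra hne
      rw [d_on_of_ne hT hytr hne] at h
      omega
    refine ⟨i, by simp [hT, hiE, hiX], ?_⟩
    rw [hd₁, hd₂] at h₂
    rw [← hτ]
    omega

/-- Either there is an equilibrium, or a player of `J` makes `b₂` win against `rest ∅`. -/
lemma exists_isNash_or_win_b₂ : (∃ σ, G.IsNash σ) ∨
    ∃ j ∈ G.J, ∃ v ∈ G.A j, G.win (update (G.rest ∅) j v) = G.b₂ := by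
  have hX : ∅ ⊆ G.T \ G.E := Finset.empty_subset _
  have hval := rest_valid hX
  by_cases hb : G.win (G.rest ∅) = G.b₁
  · by_cases hN : G.IsNash (G.rest ∅)
    · exact Or.inl ⟨_, hN⟩
    · exact Or.inr (exists_win_b₂ hX hb hN)
  by_cases hw : G.win (G.rest ∅) = G.w
  · right
    obtain ⟨j, hj⟩ := G.J_nonempty
    have hE := G.J_subset hj
    refine ⟨j, hj, G.off j, G.off_mem j, G.win_eq fun c hc => ?_⟩
    have hz : ∀ c, G.lev (G.rest ∅) c = G.L c := fun c => by
      unfold lev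
      rw [Finset.sum_eq_zero, mul_zero, add_zero]
      intro i _
      by_contra hne
      have h₁ := hval.lev_w_le (hval.d_w_eq hne)
      have h₂ := G.lev_le_win (G.rest ∅) G.b₂
      rw [hw, hval.lev_b₂] at h₂
      have := G.L_w
      omega
    rw [(hval.updated (G.off_mem j)).lev_b₂, lev_update_rest hX hE, hz]
    have hNp := G.N_pos
    have hwb := G.L_w
    have hJ := G.J_off j hj
    have h₁ := G.L_b₁
    by_cases hcw : c = G.w
    · subst hcw
      have hd : G.d j (G.off j) G.w = -1 := by
        rcases G.d_w j _ (G.off_mem j) with h | h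
        · have := G.d_eq_zero j _ (G.off_mem j) h G.b₁; omega
        · exact h
      rw [hd]; omega
    by_cases hcb : c = G.b₁
    · subst hcb; rw [hJ]; omega
    rcases G.d_zero_or_one j _ (G.off_mem j) c hcw hcb with e | e
    · rw [e]; have := G.L_lt c hcw hcb hc; omega
    · have := G.J_lt j hj c e; rw [e]; omega
  · left
    have h₁ := G.lev_lt_win (G.rest ∅) (c := G.b₁) (Ne.symm hb)
    rw [lev_rest_b₁ hX] at h₁
    refine exists_isNash_of_robust (X₀ := ∅) (Finset.empty_subset _) (by simp [NoDrop]) ?_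
    exact fun e he => ⟨_, ⟨hw, hb⟩, h₁.trans_le (lev_rest_le hX he ⟨hw, hb⟩)⟩

variable (G)

/-- A set `Z` of players promoting the same candidate `z` above `b₁`, together with an action `v`
of some `j ∈ J` after which `z` dominates every other trailing candidate. -/
structure Leader (z : C) (Z : Finset ι) (j : ι) (v : α) : Prop where
  subset : Z ⊆ G.T \ G.E
  τ_eq : ∀ s ∈ Z, G.τ s = z
  mem_J : j ∈ G.J
  mem_A : v ∈ G.A j
  demoted : G.d j v G.b₁ = -1
  d_le : ∀ c, G.Trailing c → G.d j v c ≤ G.d j (G.off j) c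
  trailing : G.Trailing z
  d_z : G.d j v z = 0
  lt : G.L G.b₁ < G.lev (G.rest Z) z
  le : ∀ c, G.Trailing c → c ≠ z → G.lev (update (G.rest Z) j v) c ≤ G.L G.b₂
  join_lt : ∀ s ∈ G.T \ G.E, s ∉ Z → G.τ s ≠ z →
    G.lev (update (G.rest Z) j v) (G.τ s) + G.N < G.lev (G.rest Z) z

variable {G}

lemma exists_action_le_off {X : Finset ι} (hX : X ⊆ G.T \ G.E) {j : ι} (hj : j ∈ G.J) {v : α}
    (hv : v ∈ G.A j) (hw : G.win (update (G.rest X) j v) = G.b₂) :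
    ∃ u ∈ G.A j, G.win (update (G.rest X) j u) = G.b₂ ∧
      ∀ c, G.Trailing c → G.d j u c ≤ G.d j (G.off j) c := by
  have hval := rest_valid hX
  rcases G.d_cases j v hv with h | h | ⟨hT, h⟩
  · exact ⟨v, hv, hw, fun c hc => by rw [h c hc.1 hc.2]; exact d_off_nonneg j hc⟩
  · exact ⟨v, hv, hw, fun c hc => (h c hc.1 hc.2).le⟩
  · refine ⟨_, G.off_mem j, ?_, fun c _ => le_rfl⟩
    have hE := G.J_subset hj
    rw [← hw]
    refine win_eq_of_le ((hval.updated (G.off_mem j)).win_of_demoted (i := j) (by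
      rw [update_self]; exact G.J_off j hj)) (fun c hc => ?_) ?_
    · rw [lev_update_rest hX hE, lev_update_rest hX hE, h c hc.1 hc.2, G.d_on j hT c hc.1 hc.2]
      have := G.N_pos
      split_ifs <;> nlinarith
    · rw [hw, (hval.updated hv).lev_b₂, (hval.updated (G.off_mem j)).lev_b₂]

/-- Either there is an equilibrium, or there is a leading set of players. -/
lemma exists_isNash_or_leader : (∃ σ, G.IsNash σ) ∨ ∃ z Z j v, G.Leader z Z j v := by
  classical
  by_cases hNash : ∃ σ, G.IsNash σ
  · exact Or.inl hNash
  right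
  have hP₀ := (exists_isNash_or_win_b₂ (G := G)).resolve_left hNash
  obtain ⟨X, hXm, hmax⟩ := Finset.exists_max_image ((G.T \ G.E).powerset.filter fun X =>
    ∃ j ∈ G.J, ∃ v ∈ G.A j, G.win (update (G.rest X) j v) = G.b₂) Finset.card
    ⟨∅, by simpa using hP₀⟩
  simp only [Finset.mem_filter, Finset.mem_powerset] at hXm hmax
  obtain ⟨hX, j, hj, v₀, hv₀, hw₀⟩ := hXm
  obtain ⟨v, hv, hw, hdle⟩ := exists_action_le_off hX hj hv₀ hw₀
  have hE := G.J_subset hj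
  have hdem := demoted_of_win_b₂ hX hj hv hw
  have hvalR := (rest_valid hX).updated hv
  have hNp := G.N_pos
  obtain ⟨i₀, hi₀, hlt₀⟩ := exists_joiner hX hj hv hw fun h => hNash ⟨_, h⟩
  obtain ⟨i, hi, himax⟩ := Finset.exists_max_image ((G.T \ G.E) \ X)
    (fun i => G.lev (update (G.rest X) j v) (G.τ i)) ⟨i₀, hi₀⟩
  have hlt : G.L G.b₂ < G.lev (update (G.rest X) j v) (G.τ i) + G.N :=
    hlt₀.trans_le (by have := himax i₀ hi₀; omega)
  rw [Finset.mem_sdiff] at hi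
  obtain ⟨hiTE, hiX⟩ := hi
  have hiT := (Finset.mem_sdiff.1 hiTE).1
  have hX' : insert i X ⊆ G.T \ G.E := Finset.insert_subset hiTE hX
  have hval' := rest_valid hX'
  have hztr : G.Trailing (G.τ i) := G.τ_ne i hiT
  have hRle : ∀ c, G.Trailing c → G.lev (update (G.rest X) j v) c ≤ G.L G.b₂ := fun c _ => by
    have := G.lev_le_win (update (G.rest X) j v) c
    rwa [hw, hvalR.lev_b₂] at this
  have hdv : ∀ c, G.Trailing c → 0 ≤ G.d j v c := fun c hc => by
    rcases G.d_zero_or_one j v hv c hc.1 hc.2 with e | e <;> omega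
  have hrestle : ∀ c, G.Trailing c → G.lev (G.rest X) c ≤ G.L G.b₂ := fun c hc => by
    have h := hRle c hc
    rw [lev_update_rest hX hE] at h
    have := mul_nonneg hNp.le (hdv c hc)
    omega
  have hb₁₂ := G.L_b₂
  have hnb₁ : G.win (G.rest (insert i X)) ≠ G.b₁ := fun h => by
    have := hmax _ ⟨hX', exists_win_b₂ hX' h fun h => hNash ⟨_, h⟩⟩
    rw [Finset.card_insert_of_notMem hiX] at this
    omega
  have hnw : G.win (G.rest (insert i X)) ≠ G.w := fun h => by
    have h₁ := hval'.lev_w_le (i := i) (hval'.d_w_eq (i := i) (c := G.τ i) (by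
      rw [rest_of_mem (Finset.mem_insert_self _ _), d_on_τ hiT]; omega))
    have h₂ := G.lev_le_win (G.rest (insert i X)) G.b₂
    rw [h, hval'.lev_b₂] at h₂
    have := G.L_w
    omega
  have hlt₁ := G.lev_lt_win (G.rest (insert i X)) hnb₁.symm
  rw [lev_rest_b₁ hX'] at hlt₁
  have hwin : G.win (G.rest (insert i X)) = G.τ i := by
    by_contra hne
    have h := hrestle _ ⟨hnw, hnb₁⟩
    rw [lev_rest_insert hiTE hiX ⟨hnw, hnb₁⟩, if_neg hne] at hlt₁
    omega
  rw [hwin] at hlt₁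
  have hz₀ := lev_rest_insert hiTE hiX hztr
  rw [if_pos rfl] at hz₀
  have hdz : G.d j v (G.τ i) = 0 := by
    rcases G.d_zero_or_one j v hv _ hztr.1 hztr.2 with e | e
    · exact e
    · have h := hRle _ hztr
      rw [lev_update_rest hX hE, e] at h
      omega
  have hRz := lev_update_rest hX hE v (G.τ i)
  rw [hdz, mul_zero, add_zero] at hRz
  set Z := (insert i X).filter fun s => G.τ s = G.τ i with hZ
  have hZs : Z ⊆ G.T \ G.E := (Finset.filter_subset _ _).trans hX'
  have hlevz : G.lev (G.rest Z) (G.τ i) = G.lev (G.rest (insert i X)) (G.τ i) := by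
    rw [lev_rest hZs hztr, lev_rest hX' hztr, hZ, Finset.filter_filter]
    simp
  have hlevc : ∀ c, G.Trailing c → c ≠ G.τ i → G.lev (G.rest X) c =
      G.lev (G.rest Z) c + G.N * (X.filter fun s => G.τ s = c).card := fun c hc hne => by
    rw [lev_rest hZs hc, lev_rest hX hc, hZ, Finset.filter_filter]
    have : ((insert i X).filter fun s => G.τ s = G.τ i ∧ G.τ s = c) = ∅ := by
      refine Finset.filter_eq_empty_iff.2 ?_
      rintro s - ⟨h₁, h₂⟩
      exact hne (h₂.symm.trans h₁)
    rw [this]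
    simp
  have hle : ∀ c, G.Trailing c → c ≠ G.τ i →
      G.lev (update (G.rest Z) j v) c ≤ G.lev (update (G.rest X) j v) c := fun c hc hne => by
    rw [lev_update_rest hX hE, lev_update_rest hZs hE, hlevc c hc hne]
    nlinarith
  refine ⟨G.τ i, Z, j, v, hZs, fun s hs => (Finset.mem_filter.1 hs).2, hj, hv, hdem, hdle, hztr,
    hdz, hlevz ▸ hlt₁, fun c hc hne => (hle c hc hne).trans (hRle c hc), fun s hs hsZ hne => ?_⟩
  have hstr : G.Trailing (G.τ s) := G.τ_ne s (Finset.mem_sdiff.1 hs).1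
  rw [hlevz]
  by_cases hsX : s ∈ X
  · have h := hRle _ hstr
    rw [lev_update_rest hX hE, hlevc _ hstr hne] at h
    rw [lev_update_rest hZs hE]
    have hcard : 1 ≤ ((X.filter fun k => G.τ k = G.τ s).card : ℤ) := by
      exact_mod_cast Finset.card_pos.2 ⟨s, by simp [hsX]⟩
    nlinarith
  · have h₁ := hle _ hstr hne
    have h₂ := himax s (Finset.mem_sdiff.2 ⟨hs, hsX⟩)
    have h₃ := G.lev_ne hne (update (G.rest Z) j v) (G.rest (insert i X)) 1
    rw [mul_one] at h₃
    omega

end ShiftGame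

namespace ShiftGame

open Function

variable {ι C α : Type*} [Fintype ι] [DecidableEq ι] [DecidableEq C] {G : ShiftGame ι C α}
  {z : C} {Z : Finset ι} {j : ι} {v : α}

/-- No player outside `Z` gains by switching on at `prof Z`, where `z` wins. -/
def NoJoin (G : ShiftGame ι C α) (z : C) (Z : Finset ι) : Prop :=
  ∀ s ∈ G.T, s ∉ Z → G.τ s ≠ z → G.rank s (G.τ s) < G.rank s z →
    G.lev (G.prof Z) (G.τ s) + G.N < G.lev (G.prof Z) z

namespace Leader

lemma subset_T (h : G.Leader z Z j v) : Z ⊆ G.T := h.subset.trans Finset.sdiff_subset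

lemma j_mem_E (h : G.Leader z Z j v) : j ∈ G.E := G.J_subset h.mem_J

lemma robust (h : G.Leader z Z j v) : G.Robust Z := fun _ he =>
  ⟨z, h.trailing, h.lt.trans_le (lev_rest_le h.subset he h.trailing)⟩

lemma lev_rest_le_L (h : G.Leader z Z j v) {c : C} (hc : G.Trailing c) (hne : c ≠ z) :
    G.lev (G.rest Z) c ≤ G.L G.b₂ := by
  have h₁ := h.le c hc hne
  rw [lev_update_rest h.subset h.j_mem_E] at h₁
  have hN := G.N_pos
  rcases G.d_zero_or_one j v h.mem_A c hc.1 hc.2 with e | e <;> rw [e] at h₁ <;> omega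

lemma lev_update_z (h : G.Leader z Z j v) :
    G.lev (update (G.rest Z) j v) z = G.lev (G.rest Z) z := by
  rw [lev_update_rest h.subset h.j_mem_E, h.d_z, mul_zero, add_zero]

lemma valid (h : G.Leader z Z j v) : G.Valid (update (G.rest Z) j v) :=
  (rest_valid h.subset).updated h.mem_A

lemma win_eq (h : G.Leader z Z j v) : G.win (update (G.rest Z) j v) = z := by
  have hlt := h.lt
  rw [← h.lev_update_z] at hlt
  obtain ⟨htr, -⟩ := h.valid.win_of_lt h.trailing hlt
  by_contra hne
  have h₁ := h.le _ htr hne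
  have h₂ := G.lev_le_win (update (G.rest Z) j v) z
  have := G.L_b₂
  omega

/-- The profile `update (rest Z) j v` is an equilibrium unless a player of `E` can gain. -/
lemma isNash (h : G.Leader z Z j v) (hE : ∀ e ∈ G.E, ∀ u ∈ G.A e,
    ¬ G.rank e (G.win (update (update (G.rest Z) j v) e u)) < G.rank e z) :
    G.IsNash (update (G.rest Z) j v) := by
  have hval := h.valid
  have hN := G.N_pos
  have hb := G.L_b₂
  have hlt := h.lt
  refine ⟨hval, fun i u hu => ?_⟩
  by_cases hi : i ∈ G.E
  · rw [h.win_eq]; exact hE i hi u hu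
  have hij : j ≠ i := fun e => hi (e ▸ h.j_mem_E)
  have hRi : update (G.rest Z) j v i = G.rest Z i := update_of_ne hij.symm _ _
  have htr : ∀ u ∈ G.A i, G.Trailing (G.win (update (update (G.rest Z) j v) i u)) := fun u hu =>
    (hval.updated hu).win_of_demoted (i := j) (by
      rw [update_of_ne hij, update_self]; exact h.demoted)
  refine hval.not_improving (h.win_eq ▸ h.trailing)
    (fun u hu => ⟨htr u hu, fun h => absurd h hi⟩) ?_ (fun hT => ?_) hu
  · by_cases hiZ : i ∈ Z
    · have hT := h.subset_T hiZ
      have htr' := htr _ (G.off_mem i)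
      by_cases hz : G.win (update (update (G.rest Z) j v) i (G.off i)) = z
      · rw [hz, h.win_eq]; exact lt_irrefl _
      have hy : G.win (update (update (G.rest Z) j v) i (G.off i)) = G.b₂ := by
        by_contra hne
        have h₁ := G.lev_lt_win _ (Ne.symm hne)
        rw [(hval.updated (G.off_mem i)).lev_b₂, lev_update_of_eq (G := G) _ (by
          rw [hRi, rest_of_mem hiZ, d_on_of_ne hT htr' (by rw [h.τ_eq i hiZ]; exact hz)])] at h₁
        have := h.le _ htr' hz
        omega
      rw [hy, h.win_eq]
      have := G.rank_up i _ (G.on_mem i hT) (G.τ i) G.b₂ (d_on_τ hT) (G.d_b₂ i _ (G.on_mem i hT))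
        (G.ap_b₂ i hi)
      rw [h.τ_eq i hiZ] at this
      omega
    · rw [update_eq_self_iff.2 (by rw [hRi, rest_of_notMem hiZ hi])]
      exact lt_irrefl _
  · by_cases hiZ : i ∈ Z
    · rw [update_eq_self_iff.2 (by rw [hRi, rest_of_mem hiZ])]
      exact lt_irrefl _
    have htr' := htr _ (G.on_mem i hT)
    suffices hz : G.win (update (update (G.rest Z) j v) i (G.on i)) = z by
      rw [hz, h.win_eq]; exact lt_irrefl _
    by_contra hz
    have h₁ := G.lev_lt_win _ (Ne.symm hz)
    have h₂ := h.le _ htr' hz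
    have h₃ := h.join_lt i (Finset.mem_sdiff.2 ⟨hT, hi⟩) hiZ
    have h₄ := h.lev_update_z
    rw [G.lev_update _ i _ (G.win _), G.lev_update _ i _ z, hRi, rest_of_notMem hiZ hi,
      G.d_on i hT _ htr'.1 htr'.2, G.d_on i hT _ h.trailing.1 h.trailing.2,
      add_sub_cancel_left, add_sub_cancel_left] at h₁
    by_cases hτ : G.win (update (update (G.rest Z) j v) i (G.on i)) = G.τ i
    · rw [hτ] at hz h₁ h₂
      have := h₃ hz
      rw [if_pos rfl] at h₁
      split_ifs at h₁ <;> omega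
    · rw [if_neg hτ] at h₁
      split_ifs at h₁ <;> omega

lemma exists_isNash_of_erase (h : G.Leader z Z j v) {t : ι} (ht : t ∈ Z)
    (hx : G.win (G.prof (Z.erase t)) ≠ z)
    (hrob : ∀ e ∈ G.E, ∃ c, G.Trailing c ∧ G.L G.b₁ <
      G.lev (G.prof Z) c - (if c = z then G.N else 0) - G.N * G.d e (G.off e) c) :
    ∃ σ, G.IsNash σ := by
  have hT := h.subset_T
  have hTE : Z.erase t ⊆ G.T \ G.E := (Finset.erase_subset _ _).trans h.subset
  refine exists_isNash_of_robust (X₀ := Z.erase t) ((Finset.erase_subset _ _).trans hT)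
    (noDrop_of_win_ne ((Finset.erase_subset _ _).trans hT) fun s hs => ?_) fun e he => ?_
  · rw [h.τ_eq s (Finset.mem_of_mem_erase hs)]; exact hx
  · obtain ⟨c, hc, hlt⟩ := hrob e he
    refine ⟨c, hc, ?_⟩
    rwa [lev_prof_erase (hT ht) ht hc, prof_of_mem_E hTE he, h.τ_eq t ht]

lemma exists_isNash_or_noJoin (h : G.Leader z Z j v) (hz : G.win (G.prof Z) = z) :
    (∃ σ, G.IsNash σ) ∨ G.NoJoin z Z := by
  have hT := h.subset_T
  by_cases hex : ∃ s ∈ G.T, s ∉ Z ∧ G.τ s ≠ z ∧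
      G.rank s (G.win (G.prof (insert s Z))) < G.rank s (G.win (G.prof Z))
  · left
    obtain ⟨s, hs, hsZ, hsz, hlt⟩ := hex
    have hne : G.win (G.prof (insert s Z)) ≠ G.win (G.prof Z) := fun e => by
      rw [e] at hlt; exact lt_irrefl _ hlt
    have hτ := win_insert_eq hT hs hsZ hne
    have hT' : insert s Z ⊆ G.T := Finset.insert_subset hs hT
    refine exists_isNash_of_robust hT' (fun k hk => ?_) (h.robust.inserted hT hs hsZ hlt)
    rcases Finset.mem_insert.1 hk with rfl | hkZ
    · rw [Finset.erase_insert hsZ]; exact not_lt.2 hlt.le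
    · rw [win_erase_of_ne hT' hk (by rw [hτ, h.τ_eq k hkZ]; exact hsz)]
      exact lt_irrefl _
  · right
    intro s hs hsZ hsz hrank
    by_contra hcon
    have htr : G.Trailing (G.τ s) := G.τ_ne s hs
    have hwin : G.win (G.prof (insert s Z)) = G.τ s := by
      refine win_insert_eq hT hs hsZ fun e => ?_
      have h₁ := G.lev_le_win (G.prof (insert s Z)) (G.τ s)
      rw [e, hz, lev_prof_insert hs hsZ htr, lev_prof_insert hs hsZ h.trailing, if_pos rfl,
        if_neg (Ne.symm hsz)] at h₁
      have h₂ := G.lev_ne hsz (G.prof Z) (G.prof Z) 1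
      omega
    exact hex ⟨s, hs, hsZ, hsz, by rw [hwin, hz]; exact hrank⟩

/-- Analysis of a deviation of a player in `E` from `update (rest Z) j v`. -/
lemma deviation (h : G.Leader z Z j v) {e : ι} (he : e ∈ G.E) {u : α} (hu : u ∈ G.A e) {y : C}
    (hy : G.win (update (update (G.rest Z) j v) e u) = y) (hne : y ≠ z) :
    G.Trailing y ∧ ∃ l, G.lev (G.rest Z) z + G.N * G.d e u z < l ∧
      (G.d e (G.off e) y = 1 ∧ G.d e (G.off e) z ≤ G.d e u z ∧ l ≤ G.lev (G.prof Z) y ∨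
        e ∈ G.T ∧ y = G.τ e ∧ l ≤ G.lev (G.prof Z) y + G.N) := by
  have hN := G.N_pos
  have hlev : ∀ c, G.lev (update (update (G.rest Z) j v) e u) c =
      G.lev (G.rest Z) c + (if e = j then 0 else G.N * G.d j v c) + G.N * G.d e u c := fun c => by
    by_cases hej : e = j
    · subst hej
      rw [if_pos rfl, update_idem, lev_update_rest h.subset he, add_zero]
    · rw [G.lev_update, lev_update_rest h.subset h.j_mem_E, update_of_ne hej,
        rest_of_mem_E h.subset he, G.d_s, if_neg hej, sub_zero]
  have hlevz := hlev z
  rw [h.d_z, mul_zero, ite_self, add_zero] at hlevz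
  have hdz : 0 ≤ G.d e u z := by
    rcases G.d_zero_or_one e u hu z h.trailing.1 h.trailing.2 with e' | e' <;> omega
  have hlt : G.L G.b₁ < G.lev (update (update (G.rest Z) j v) e u) z := by
    have := mul_nonneg hN.le hdz
    have := h.lt
    omega
  have htr := ((h.valid.updated hu).win_of_lt h.trailing hlt).1
  rw [hy] at htr
  have hly := G.lev_lt_win (update (update (G.rest Z) j v) e u) (c := z)
    (by rw [hy]; exact hne.symm)
  rw [hy] at hly
  have hd : G.d e u y = 1 := by
    rcases G.d_zero_or_one e u hu y htr.1 htr.2 with e' | e'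
    · exfalso
      rw [hlev y, e'] at hly
      have h₁ := h.le y htr hne
      have h₂ := h.lev_rest_le_L htr hne
      rw [lev_update_rest h.subset h.j_mem_E] at h₁
      have := G.L_b₂
      split_ifs at hly <;> omega
    · exact e'
  have hle : G.lev (update (update (G.rest Z) j v) e u) y ≤
      G.lev (G.prof Z) y + G.N * (G.d e u y - G.d e (G.off e) y) := by
    rw [hlev y, lev_prof h.subset]
    have hsum : (if e = j then 0 else G.d j v y) + G.d e (G.off e) y ≤
        ∑ k ∈ G.E, G.d k (G.off k) y := by
      rw [← Finset.add_sum_erase _ _ he, add_comm]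
      refine add_le_add le_rfl ?_
      by_cases hej : e = j
      · rw [if_pos hej]; exact Finset.sum_nonneg fun k _ => d_off_nonneg k htr
      · rw [if_neg hej]
        exact (h.d_le y htr).trans (Finset.single_le_sum (f := fun k => G.d k (G.off k) y)
          (fun k _ => d_off_nonneg k htr) (Finset.mem_erase.2 ⟨Ne.symm hej, h.j_mem_E⟩))
    have := mul_le_mul_of_nonneg_left hsum hN.le
    rw [mul_add] at this
    split_ifs at this ⊢ <;> linarith
  refine ⟨htr, _, by rw [← hlevz]; exact hly, ?_⟩
  rcases G.d_cases e u hu with h₀ | h₁ | ⟨hT, h₂⟩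
  · have := h₀ y htr.1 htr.2; omega
  · left
    rw [h₁ y htr.1 htr.2] at hd hle
    rw [sub_self, mul_zero, add_zero] at hle
    exact ⟨hd, (h₁ z h.trailing.1 h.trailing.2).ge, hle⟩
  · by_cases hτ : y = G.τ e
    · right
      refine ⟨hT, hτ, ?_⟩
      rw [hd, hτ, d_off_τ hT] at hle
      rw [hτ]
      omega
    · left
      rw [h₂ y htr.1 htr.2, d_on_of_ne hT htr hτ] at hd hle
      rw [sub_self, mul_zero, add_zero] at hle
      refine ⟨hd, ?_, hle⟩
      rw [h₂ z h.trailing.1 h.trailing.2, G.d_on e hT z h.trailing.1 h.trailing.2]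
      split_ifs <;> omega

lemma lev_prof_lt (hz : G.win (G.prof Z) = z) {c : C} (hc : c ≠ z) :
    G.lev (G.prof Z) c < G.lev (G.prof Z) z := by
  have := G.lev_lt_win (G.prof Z) (c := c) (by rw [hz]; exact hc)
  rwa [hz] at this

lemma isNash_of_sum_eq_zero (h : G.Leader z Z j v) (hz : G.win (G.prof Z) = z)
    (hNJ : G.NoJoin z Z) (hβ : ∑ e ∈ G.E, G.d e (G.off e) z = 0) :
    G.IsNash (update (G.rest Z) j v) := by
  have hN := G.N_pos
  refine h.isNash fun e he u hu hlt => ?_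
  have hne : G.win (update (update (G.rest Z) j v) e u) ≠ z := fun e' => by
    rw [e'] at hlt; exact lt_irrefl _ hlt
  obtain ⟨htr, l, hl, hcase⟩ := h.deviation he hu rfl hne
  have hdz : 0 ≤ G.N * G.d e u z := by
    rcases G.d_zero_or_one e u hu z h.trailing.1 h.trailing.2 with e' | e' <;> rw [e'] <;> omega
  have hζ := lev_prof h.subset z
  rw [hβ] at hζ
  have hM := lev_prof_lt hz hne
  rcases hcase with ⟨-, -, hle⟩ | ⟨hT, hτ, hle⟩
  · omega
  · rw [hτ] at hlt hle hne
    have := hNJ e hT (fun heZ => (Finset.mem_sdiff.1 (h.subset heZ)).2 he) hne hlt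
    omega

/-- The profile in which `e ∈ J` rests at `off e`, the other players of `E` are sincere and `Z` is
switched on. -/
lemma isNash_update_off (h : G.Leader z Z j v) (hz : G.win (G.prof Z) = z) (hNJ : G.NoJoin z Z)
    {e : ι} (heJ : e ∈ G.J) (heT : e ∉ G.T) (hez : G.d e (G.off e) z = 1) {x : C}
    (hxz : x ≠ z) (hex : G.d e (G.off e) x = 1)
    (hsum : ∑ k ∈ G.E, G.d k (G.off k) z = 1)
    (hx : G.lev (G.rest Z) x + G.N ≤ G.lev (G.rest Z) z) :
    G.IsNash (update (G.rest Z) e (G.off e)) := by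
  have hN := G.N_pos
  have heE := G.J_subset heJ
  have hval := (rest_valid h.subset).updated (G.off_mem e)
  have hltz := h.lt
  have hb := G.L_b₂
  have hζ : G.lev (G.prof Z) z = G.lev (G.rest Z) z + G.N := by
    rw [lev_prof h.subset, hsum, mul_one]
  have hRz : G.lev (update (G.rest Z) e (G.off e)) z = G.lev (G.prof Z) z := by
    rw [lev_update_rest h.subset heE, hez, hζ, mul_one]
  have hRle : ∀ c, G.Trailing c → ∀ k ∈ G.E, k ≠ e →
      G.lev (update (G.rest Z) e (G.off e)) c + G.N * G.d k (G.off k) c ≤ G.lev (G.prof Z) c := by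
    intro c hc k hk hke
    rw [lev_update_rest h.subset heE, lev_prof h.subset, ← Finset.add_sum_erase _ _ heE]
    have := Finset.single_le_sum (f := fun k => G.d k (G.off k) c)
      (fun k _ => d_off_nonneg k hc) (Finset.mem_erase.2 ⟨hke, hk⟩)
    nlinarith
  have hRle' : ∀ c, G.Trailing c →
      G.lev (update (G.rest Z) e (G.off e)) c ≤ G.lev (G.prof Z) c := by
    intro c hc
    have := lev_rest_le h.subset heE hc
    rw [prof_of_mem_E h.subset heE] at this
    rw [lev_update_rest h.subset heE]
    omega
  have hwin : G.win (update (G.rest Z) e (G.off e)) = z := by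
    have htr := (hval.win_of_lt h.trailing (by omega)).1
    by_contra hne
    have h₁ := G.lev_le_win (update (G.rest Z) e (G.off e)) z
    have h₂ := hRle' _ htr
    have h₃ := lev_prof_lt hz hne
    omega
  refine ⟨hval, fun i u hu => ?_⟩
  by_cases hi : i ∈ G.E
  · rw [hwin]
    intro hlt
    have hne : G.win (update (update (G.rest Z) e (G.off e)) i u) ≠ z := fun e' => by
      rw [e'] at hlt; exact lt_irrefl _ hlt
    have hly := G.lev_lt_win _ hne.symm
    by_cases hie : i = e
    · subst hie
      rw [update_idem] at hly hne
      have hlev := lev_update_rest h.subset heE u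
      have hdz : 0 ≤ G.N * G.d i u z := by
        rcases G.d_zero_or_one i u hu z h.trailing.1 h.trailing.2 with e' | e' <;> rw [e'] <;> omega
      have htr := (((rest_valid h.subset).updated hu).win_of_lt h.trailing (by
        rw [hlev]; omega)).1
      rcases G.d_cases i u hu with h₀ | h₁ | ⟨hT, -⟩
      · rw [hlev, hlev, h₀ _ htr.1 htr.2] at hly
        have := h.lev_rest_le_L htr hne
        omega
      · rw [hlev, hlev, h₁ _ htr.1 htr.2, h₁ _ h.trailing.1 h.trailing.2,
          ← lev_update_rest h.subset heE, ← lev_update_rest h.subset heE, hRz] at hly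
        have h₂ := hRle' _ htr
        have h₃ := lev_prof_lt hz hne
        omega
      · exact heT hT
    · have hlev : ∀ c, G.lev (update (update (G.rest Z) e (G.off e)) i u) c =
          G.lev (update (G.rest Z) e (G.off e)) c + G.N * G.d i u c := fun c => by
        rw [G.lev_update, update_of_ne hie, rest_of_mem_E h.subset hi, G.d_s, sub_zero]
      have hdz : 0 ≤ G.N * G.d i u z := by
        rcases G.d_zero_or_one i u hu z h.trailing.1 h.trailing.2 with e' | e' <;> rw [e'] <;> omega
      have htr := ((hval.updated hu).win_of_lt h.trailing (by rw [hlev]; omega)).1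
      rw [hlev, hlev, hRz] at hly
      have h₂ := hRle _ htr i hi hie
      have h₃ := lev_prof_lt hz hne
      have h₄ := mul_nonneg hN.le (d_off_nonneg i htr)
      rcases G.d_cases i u hu with h₀ | h₁ | ⟨hT, h₁⟩
      · rw [h₀ _ htr.1 htr.2] at hly; omega
      · rw [h₁ _ htr.1 htr.2] at hly; omega
      · rw [h₁ _ htr.1 htr.2, G.d_on i hT _ htr.1 htr.2] at hly
        by_cases hτ : G.win (update (update (G.rest Z) e (G.off e)) i u) = G.τ i
        · rw [if_pos hτ, mul_add, mul_one] at hly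
          rw [hτ] at hne hlt hly h₂
          have := hNJ i hT (fun hiZ => (Finset.mem_sdiff.1 (h.subset hiZ)).2 hi) hne hlt
          omega
        · rw [if_neg hτ, add_zero] at hly; omega
  have hie : e ≠ i := fun e' => hi (e' ▸ heE)
  have hRi : update (G.rest Z) e (G.off e) i = G.rest Z i := update_of_ne hie.symm _ _
  have htr : ∀ u ∈ G.A i, G.Trailing (G.win (update (update (G.rest Z) e (G.off e)) i u)) :=
    fun u hu => (hval.updated hu).win_of_demoted (i := e) (by
      rw [update_of_ne hie, update_self]; exact G.J_off e heJ)
  refine hval.not_improving (hwin ▸ h.trailing)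
    (fun u hu => ⟨htr u hu, fun h => absurd h hi⟩) ?_ (fun hT => ?_) hu
  · by_cases hiZ : i ∈ Z
    · have hT := h.subset_T hiZ
      have htr' := htr _ (G.off_mem i)
      suffices hz : G.win (update (update (G.rest Z) e (G.off e)) i (G.off i)) = z by
        rw [hz, hwin]; exact lt_irrefl _
      by_contra hne
      have h₁ := G.lev_lt_win _ (Ne.symm hne)
      rw [lev_update_of_eq (G := G) (c := G.win _) _ (by
        rw [hRi, rest_of_mem hiZ, d_on_of_ne hT htr' (by rw [h.τ_eq i hiZ]; exact hne)]),
        G.lev_update _ i _ z, hRi, rest_of_mem hiZ, ← h.τ_eq i hiZ, d_off_τ hT, d_on_τ hT,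
        h.τ_eq i hiZ, hRz, hζ, lev_update_rest h.subset heE] at h₁
      have h₂ := h.lev_rest_le_L htr' hne
      rcases G.d_zero_or_one e _ (G.off_mem e) _ htr'.1 htr'.2 with h₀ | h₀
      · rw [h₀] at h₁; omega
      · rcases G.up_le_two e _ (G.off_mem e) _ _ _ h₀ hez hex with h' | h' | h'
        · exact hne h'
        · rw [h', hex] at h₁; omega
        · exact hxz h'.symm
    · rw [update_eq_self_iff.2 (by rw [hRi, rest_of_notMem hiZ hi])]
      exact lt_irrefl _
  · by_cases hiZ : i ∈ Z
    · rw [update_eq_self_iff.2 (by rw [hRi, rest_of_mem hiZ])]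
      exact lt_irrefl _
    have htr' := htr _ (G.on_mem i hT)
    rw [hwin]
    intro hlt
    have hne : G.win (update (update (G.rest Z) e (G.off e)) i (G.on i)) ≠ z := fun e' => by
      rw [e'] at hlt; exact lt_irrefl _ hlt
    have h₁ := G.lev_lt_win _ hne.symm
    have h₂ := hRle' _ htr'
    have h₃ := lev_prof_lt hz hne
    rw [G.lev_update _ i _ (G.win _), G.lev_update _ i _ z, hRi, rest_of_notMem hiZ hi,
      G.d_on i hT _ htr'.1 htr'.2, G.d_on i hT _ h.trailing.1 h.trailing.2,
      add_sub_cancel_left, add_sub_cancel_left, hRz] at h₁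
    by_cases hτ : G.win (update (update (G.rest Z) e (G.off e)) i (G.on i)) = G.τ i
    · rw [hτ] at hlt hne h₁ h₂
      have := hNJ i hT hiZ hne hlt
      rw [if_pos rfl] at h₁
      split_ifs at h₁ <;> omega
    · rw [if_neg hτ] at h₁
      split_ifs at h₁ <;> omega

end Leader
end ShiftGame

namespace ShiftGame

open Function

variable {ι C α : Type*} [Fintype ι] [DecidableEq ι] [DecidableEq C] {G : ShiftGame ι C α}
  {z : C} {Z : Finset ι} {j : ι} {v : α}

namespace Leader

/-- The case in which a single resting action promotes `z`, and it also promotes the candidate `x`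
winning after `t` is switched off. -/
lemma exists_isNash_of_sum_eq_one (h : G.Leader z Z j v) (hz : G.win (G.prof Z) = z)
    (hNJ : G.NoJoin z Z) {t : ι} (ht : t ∈ Z) {x : C} (hwx : G.win (G.prof (Z.erase t)) = x)
    (hxz : x ≠ z) (hx : G.lev (G.prof Z) z - G.N < G.lev (G.prof Z) x)
    (hsum : ∑ k ∈ G.E, G.d k (G.off k) z = 1) {e : ι} (heE : e ∈ G.E)
    (hez : G.d e (G.off e) z = 1) (huniq : ∀ k ∈ G.E, k ≠ e → G.d k (G.off k) z = 0) :
    ∃ σ, G.IsNash σ := by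
  have hN := G.N_pos
  have hltz := h.lt
  have hb := G.L_b₂
  have hT := h.subset_T
  have hTe : Z.erase t ⊆ G.T := (Finset.erase_subset _ _).trans hT
  have hxtr : G.Trailing x := hwx ▸ trailing_win_prof hTe
  have hζ : G.lev (G.prof Z) z = G.lev (G.rest Z) z + G.N := by
    rw [lev_prof h.subset, hsum, mul_one]
  have herase : ∀ c, G.Trailing c → c ≠ z → G.d e (G.off e) c = 0 →
      G.L G.b₁ < G.lev (G.prof Z) c → ∃ σ, G.IsNash σ := fun c hc hcz hd hlt => by
    refine h.exists_isNash_of_erase ht (by rw [hwx]; exact hxz) fun k hk => ?_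
    by_cases hke : k = e
    · subst hke
      exact ⟨c, hc, by rw [if_neg hcz, hd]; omega⟩
    · exact ⟨z, h.trailing, by rw [if_pos rfl, huniq k hk hke]; omega⟩
  rcases G.d_zero_or_one e _ (G.off_mem e) x hxtr.1 hxtr.2 with hex | hex
  · exact herase x hxtr hxz hex (by omega)
  have heJ : e ∈ G.J := by
    by_contra heJ
    exact hxz (G.up_le_one e heE heJ _ (G.off_mem e) _ _ hex hez)
  have heT : e ∉ G.T := fun heT => by
    have hτ := d_off_τ heT
    have hxτ : x ≠ G.τ e := fun e' => by rw [e'] at hex; omega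
    have hzτ : z ≠ G.τ e := fun e' => by rw [e'] at hez; omega
    rcases G.up_le_two e _ (G.on_mem e heT) x z (G.τ e) (by rw [d_on_of_ne heT hxtr hxτ, hex])
      (by rw [d_on_of_ne heT h.trailing hzτ, hez]) (d_on_τ heT) with h' | h' | h'
    · exact hxz h'
    · exact hxτ h'
    · exact hzτ h'
  have heoff : ∀ c, G.Trailing c → c ≠ x → c ≠ z → G.d e (G.off e) c = 0 := fun c hc hcx hcz => by
    rcases G.d_zero_or_one e _ (G.off_mem e) c hc.1 hc.2 with h' | h'
    · exact h'
    · rcases G.up_le_two e _ (G.off_mem e) _ _ _ h' hex hez with h'' | h'' | h''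
      · exact absurd h'' hcx
      · exact absurd h'' hcz
      · exact absurd h'' hxz
  by_cases hf : G.lev (G.rest Z) x + G.N ≤ G.lev (G.rest Z) z
  · exact ⟨_, h.isNash_update_off hz hNJ heJ heT hez hxz hex hsum hf⟩
  have hxM := lev_prof_lt hz hxz
  have hox : ∀ k ∈ G.E, k ≠ e → G.d k (G.off k) x = 0 := fun k hk hke => by
    rcases G.d_zero_or_one k _ (G.off_mem k) x hxtr.1 hxtr.2 with h' | h'
    · exact h'
    · exfalso
      have h₁ := Finset.single_le_sum (f := fun k => G.d k (G.off k) x)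
        (fun k _ => d_off_nonneg k hxtr) (Finset.mem_erase.2 ⟨hke, hk⟩)
      rw [lev_prof h.subset, ← Finset.add_sum_erase _ _ heE, hex] at hxM
      nlinarith
  by_cases hc : ∃ c, G.Trailing c ∧ c ≠ x ∧ c ≠ z ∧ G.lev (G.rest Z) z < G.lev (G.prof Z) c
  · obtain ⟨c, hc, hcx, hcz, hlt⟩ := hc
    exact herase c hc hcz (heoff c hc hcx hcz) (by omega)
  push Not at hc
  by_cases hmove : ∃ k ∈ G.E, ∃ u ∈ G.A k,
      G.rank k (G.win (update (update (G.rest Z) j v) k u)) < G.rank k z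
  swap
  · push Not at hmove
    exact ⟨_, h.isNash fun k hk u hu => not_lt.2 (hmove k hk u hu)⟩
  obtain ⟨k, hk, u, hu, hlt⟩ := hmove
  have hne : G.win (update (update (G.rest Z) j v) k u) ≠ z := fun e' => by
    rw [e'] at hlt; exact lt_irrefl _ hlt
  obtain ⟨htr, l, hl, hcase⟩ := h.deviation hk hu rfl hne
  have hdz : 0 ≤ G.N * G.d k u z := by
    rcases G.d_zero_or_one k u hu z h.trailing.1 h.trailing.2 with e' | e' <;> rw [e'] <;> omega
  rcases hcase with ⟨hd, hdle, hle⟩ | ⟨hkT, hτ, hle⟩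
  · exfalso
    by_cases hyx : G.win (update (update (G.rest Z) j v) k u) = x
    · rw [hyx] at hd hle
      have hke : k = e := by
        by_contra hke
        have := hox k hk hke
        omega
      subst hke
      rw [hez] at hdle
      nlinarith
    · have := hc _ htr hyx hne
      omega
  rw [hτ] at hne hlt htr hle
  have hkZ : k ∉ Z := fun hkZ => (Finset.mem_sdiff.1 (h.subset hkZ)).2 hk
  have hke : k ≠ e := fun e' => heT (e' ▸ hkT)
  have hJk := hNJ k hkT hkZ hne hlt
  have hyx : G.τ k ≠ x := fun e' => by rw [e'] at hJk; omega
  have hkZt : k ∉ Z.erase t := fun hm => hkZ (Finset.mem_of_mem_erase hm)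
  have hX : insert k (Z.erase t) ⊆ G.T := Finset.insert_subset hkT hTe
  have hlev : ∀ c, G.Trailing c → G.lev (G.prof (insert k (Z.erase t))) c =
      G.lev (G.prof Z) c - (if c = z then G.N else 0) + (if c = G.τ k then G.N else 0) :=
    fun c hc => by
      rw [lev_prof_insert hkT hkZt hc, lev_prof_erase (hT ht) ht hc, h.τ_eq t ht]
  have hxb : x ≠ G.b₂ := fun e' => by
    rw [e', (prof_valid hT).lev_b₂] at hx
    omega
  refine exists_isNash_of_robust hX ?_ fun m hm => ?_
  · by_cases hw : G.win (G.prof (insert k (Z.erase t))) = x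
    · refine noDrop_of_win_ne hX fun s hs => ?_
      rw [hw]
      rcases Finset.mem_insert.1 hs with rfl | hs
      · exact hyx.symm
      · rw [h.τ_eq s (Finset.mem_of_mem_erase hs)]; exact hxz
    · have hwin := win_insert_eq hTe hkT hkZt (by rw [hwx]; exact hw)
      intro s hs
      rcases Finset.mem_insert.1 hs with rfl | hs'
      · rw [Finset.erase_insert hkZt, hwx, hwin]
        have hap : ¬ G.ap s x := fun hap => by
          rcases (G.ap_E s hk x).1 hap with h' | h' | h'
          · exact hxtr.1 h'
          · exact hxtr.2 h'
          · exact hxb h'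
        have := G.rank_up s _ (G.on_mem s hkT) _ x (d_on_τ hkT)
          (by rw [d_on_of_ne hkT hxtr hyx.symm, hox s hk hke]) hap
        omega
      · rw [win_erase_of_ne hX hs (by
          rw [hwin, h.τ_eq s (Finset.mem_of_mem_erase hs')]; exact hne)]
        exact lt_irrefl _
  · by_cases hme : m = e
    · subst hme
      refine ⟨G.τ k, htr, ?_⟩
      have hmX : m ∉ insert k (Z.erase t) := fun h' => heT (hX h')
      rw [hlev _ htr, if_neg hne, if_pos rfl, show G.prof (insert k (Z.erase t)) m = G.off m from
        if_neg hmX, heoff _ htr hyx hne]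
      omega
    · refine ⟨z, h.trailing, ?_⟩
      have hd : G.d m (G.prof (insert k (Z.erase t)) m) z = 0 := by
        unfold prof
        split_ifs with h'
        · rw [d_on_of_ne (hX h') h.trailing ?_, huniq m hm hme]
          rcases Finset.mem_insert.1 h' with rfl | h''
          · exact hne.symm
          · exact absurd hm (Finset.mem_sdiff.1 (h.subset (Finset.mem_of_mem_erase h''))).2
        · exact huniq m hm hme
      rw [hlev _ h.trailing, if_pos rfl, if_neg hne.symm, hd]
      omega

lemma exists_isNash (h : G.Leader z Z j v) : ∃ σ, G.IsNash σ := by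
  have hN := G.N_pos
  have hltz := h.lt
  have hT := h.subset_T
  by_cases hnd : G.NoDrop Z
  · exact exists_isNash_of_robust hT hnd h.robust
  unfold NoDrop at hnd
  push Not at hnd
  obtain ⟨t, ht, hlt⟩ := hnd
  have hTe : Z.erase t ⊆ G.T := (Finset.erase_subset _ _).trans hT
  have hz : G.win (G.prof Z) = z := by
    by_contra hne
    rw [win_erase_of_ne hT ht (by rw [h.τ_eq t ht]; exact hne)] at hlt
    exact lt_irrefl _ hlt
  have hxz : G.win (G.prof (Z.erase t)) ≠ z := fun e => by
    rw [e, hz] at hlt; exact lt_irrefl _ hlt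
  have hx := G.lev_lt_win (G.prof (Z.erase t)) hxz.symm
  rw [lev_prof_erase (hT ht) ht h.trailing, lev_prof_erase (hT ht) ht (trailing_win_prof hTe),
    h.τ_eq t ht, if_pos rfl, if_neg hxz, sub_zero] at hx
  rcases h.exists_isNash_or_noJoin hz with hNash | hNJ
  · exact hNash
  have hβ : 0 ≤ ∑ e ∈ G.E, G.d e (G.off e) z :=
    Finset.sum_nonneg fun e _ => d_off_nonneg e h.trailing
  have h01 : ∀ e, G.d e (G.off e) z = 0 ∨ G.d e (G.off e) z = 1 := fun e =>
    G.d_zero_or_one e _ (G.off_mem e) z h.trailing.1 h.trailing.2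
  rcases (by omega : ∑ e ∈ G.E, G.d e (G.off e) z = 0 ∨ ∑ e ∈ G.E, G.d e (G.off e) z = 1 ∨
    2 ≤ ∑ e ∈ G.E, G.d e (G.off e) z) with h₀ | h₁ | h₂
  · exact ⟨_, h.isNash_of_sum_eq_zero hz hNJ h₀⟩
  · have hex : ∃ e ∈ G.E, G.d e (G.off e) z = 1 := by
      by_contra hcon
      push Not at hcon
      rw [Finset.sum_eq_zero fun e he => (h01 e).resolve_right (hcon e he)] at h₁
      omega
    obtain ⟨e, he, hez⟩ := hex
    refine h.exists_isNash_of_sum_eq_one hz hNJ ht rfl hxz hx h₁ he hez fun k hk hke => ?_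
    have := Finset.single_le_sum (f := fun k => G.d k (G.off k) z)
      (fun k _ => d_off_nonneg k h.trailing) (Finset.mem_erase.2 ⟨hke, hk⟩)
    rw [← Finset.add_sum_erase _ _ he, hez] at h₁
    rcases h01 k with h' | h'
    · exact h'
    · omega
  · refine h.exists_isNash_of_erase ht hxz fun e _ => ⟨z, h.trailing, ?_⟩
    rw [if_pos rfl, lev_prof h.subset]
    rcases h01 e with h' | h' <;> rw [h'] <;> nlinarith

end Leader

/-- Every shift game has a pure Nash equilibrium. -/
theorem exists_isNash (G : ShiftGame ι C α) : ∃ σ, G.IsNash σ := by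
  rcases exists_isNash_or_leader (G := G) with h | ⟨z, Z, j, v, h⟩
  · exact h
  · exact h.exists_isNash

end ShiftGame

section Levels

variable {C : Type*} {n : ℕ}

/-- `1` if the vote `v` approves `c`, and `0` otherwise. -/
def approves (v : C → ℕ) (c : C) : ℤ := if v c < 3 then 1 else 0

/-- The change of the score of `c` when voter `i` switches from the sincere vote to `v`. -/
def shift (V : Fin n → C → ℕ) (i : Fin n) (v : C → ℕ) (c : C) : ℤ :=
  approves v c - approves (V i) c

lemma shift_self (V : Fin n → C → ℕ) (i : Fin n) (c : C) : shift V i (V i) c = 0 := sub_self _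

variable [Fintype C]

/-- The value of one point in the levels below; it exceeds every tie-breaking rank. -/
def levelUnit (tb : C → ℕ) : ℤ := Finset.univ.sup tb + 1

lemma tb_lt_levelUnit (tb : C → ℕ) (c : C) : (tb c : ℤ) < levelUnit tb := by
  have : tb c ≤ Finset.univ.sup tb := Finset.le_sup (Finset.mem_univ c)
  unfold levelUnit
  omega

lemma levelUnit_pos (tb : C → ℕ) : 0 < levelUnit tb := by
  unfold levelUnit
  omega

lemma levels_ne {tb : C → ℕ} (htb : Function.Injective tb) {c c' : C} (h : c ≠ c') (a b : ℤ) :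
    levelUnit tb * a - tb c ≠ levelUnit tb * b - tb c' := by
  intro heq
  have h₁ := tb_lt_levelUnit tb c
  have h₂ := tb_lt_levelUnit tb c'
  have hN := levelUnit_pos tb
  have hne : (tb c : ℤ) ≠ tb c' := fun e => h (htb (by exact_mod_cast e))
  have h₃ : (0 : ℤ) ≤ tb c := by positivity
  have h₄ : (0 : ℤ) ≤ tb c' := by positivity
  rcases lt_trichotomy a b with hab | hab | hab
  · nlinarith
  · subst hab; omega
  · nlinarith

variable [DecidableEq C]

/-- The 3-Approval score, scaled so as to incorporate the tie-breaking. -/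
def level (tb : C → ℕ) (σ : Fin n → C → ℕ) (c : C) : ℤ :=
  levelUnit tb * approvalScore 3 σ c - tb c

lemma approvalScore_eq_sum (σ : Fin n → C → ℕ) (c : C) :
    (approvalScore 3 σ c : ℤ) = ∑ i, approves (σ i) c := by
  unfold approvalScore approves
  rw [Finset.card_filter]
  push_cast
  rfl

lemma level_eq_add_sum (tb : C → ℕ) (V σ : Fin n → C → ℕ) (c : C) :
    level tb σ c = level tb V c + levelUnit tb * ∑ i, shift V i (σ i) c := by
  unfold level shift
  rw [approvalScore_eq_sum, approvalScore_eq_sum, Finset.sum_sub_distrib]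
  ring

lemma level_update (tb : C → ℕ) (σ : Fin n → C → ℕ) (i : Fin n) (v : C → ℕ) (c : C) :
    level tb (Function.update σ i v) c = level tb σ c + levelUnit tb * shift σ i v c := by
  rw [level_eq_add_sum tb σ, Finset.sum_eq_single i]
  · rw [Function.update_self]
  · intro k _ hk
    rw [Function.update_of_ne hk, shift, sub_self]
  · simp

lemma isWinner_iff {tb : C → ℕ} {σ : Fin n → C → ℕ} {y : C} :
    IsWinner 3 σ tb y ↔ ∀ c, c ≠ y → level tb σ c < level tb σ y := by
  have hN := levelUnit_pos tb
  refine forall_congr' fun c => forall_congr' fun _ => ?_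
  unfold level
  have h₁ := tb_lt_levelUnit tb c
  have h₂ := tb_lt_levelUnit tb y
  have h₃ : (0 : ℤ) ≤ tb c := by positivity
  have h₄ : (0 : ℤ) ≤ tb y := by positivity
  constructor
  · rintro (h | ⟨h, h'⟩)
    · have : (approvalScore 3 σ c : ℤ) + 1 ≤ approvalScore 3 σ y := by exact_mod_cast h
      nlinarith
    · rw [h]; omega
  · intro h
    rcases lt_trichotomy (approvalScore 3 σ c) (approvalScore 3 σ y) with h' | h' | h'
    · exact Or.inl h'
    · rw [h'] at h; exact Or.inr ⟨h', by omega⟩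
    · have : (approvalScore 3 σ y : ℤ) + 1 ≤ approvalScore 3 σ c := by exact_mod_cast h'
      nlinarith

variable [Nonempty C]

lemma level_lt_winner {tb : C → ℕ} (htb : Function.Injective tb) (σ : Fin n → C → ℕ) {c : C}
    (hc : c ≠ winner 3 σ tb) : level tb σ c < level tb σ (winner 3 σ tb) := by
  have hex : ∃ y, IsWinner 3 σ tb y := by
    obtain ⟨y, -, hy⟩ := Finset.exists_max_image Finset.univ (level tb σ) Finset.univ_nonempty
    exact ⟨y, isWinner_iff.2 fun c hc =>
      lt_of_le_of_ne (hy c (Finset.mem_univ c)) (levels_ne htb hc _ _)⟩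
  have hspec : IsWinner 3 σ tb (winner 3 σ tb) := by
    unfold winner
    rw [dif_pos hex]
    exact hex.choose_spec
  exact isWinner_iff.1 hspec c hc

lemma level_le_winner {tb : C → ℕ} (htb : Function.Injective tb) (σ : Fin n → C → ℕ) (c : C) :
    level tb σ c ≤ level tb σ (winner 3 σ tb) := by
  by_cases hc : c = winner 3 σ tb
  · rw [← hc]
  · exact (level_lt_winner htb σ hc).le

lemma winner_eq {tb : C → ℕ} (htb : Function.Injective tb) {σ : Fin n → C → ℕ} {y : C}
    (h : ∀ c, c ≠ y → level tb σ c < level tb σ y) : winner 3 σ tb = y := by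
  by_contra hne
  exact absurd (h _ hne) (not_lt.2 (level_le_winner htb σ y))

end Levels

section Classification

variable {C : Type*} {n : ℕ}

lemma shift_cases (V : Fin n → C → ℕ) (i : Fin n) (v : C → ℕ) (c : C) :
    v c < 3 ∧ ¬ V i c < 3 ∧ shift V i v c = 1 ∨ ¬ v c < 3 ∧ V i c < 3 ∧ shift V i v c = -1 ∨
      (v c < 3 ↔ V i c < 3) ∧ shift V i v c = 0 := by
  unfold shift approves
  by_cases h₁ : v c < 3 <;> by_cases h₂ : V i c < 3 <;> simp [h₁, h₂]

/-- An injective vote approves at most three candidates. -/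
lemma not_four_approved {v : C → ℕ} (hv : Function.Injective v) {a b c d : C} (ha : v a < 3)
    (hb : v b < 3) (hc : v c < 3) (hd : v d < 3) (hab : a ≠ b) (hac : a ≠ c) (had : a ≠ d)
    (hbc : b ≠ c) (hbd : b ≠ d) (hcd : c ≠ d) : False := by
  have := hv.ne hab
  have := hv.ne hac
  have := hv.ne had
  have := hv.ne hbc
  have := hv.ne hbd
  have := hv.ne hcd
  omega

variable [Fintype C] [DecidableEq C] [Nonempty C] {V : Fin n → C → ℕ} {tb : C → ℕ} {i : Fin n}
  {v : C → ℕ}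

lemma level_lt_of_manipulation (htb : Function.Injective tb) {x c : C}
    (hx : winner 3 (Function.update V i v) tb = x) (hc : c ≠ x) :
    level tb V c + levelUnit tb * shift V i v c <
      level tb V x + levelUnit tb * shift V i v x := by
  have := level_lt_winner htb (Function.update V i v) (c := c) (by rw [hx]; exact hc)
  rwa [hx, level_update, level_update] at this

lemma IsMinimalType1.shift_eq {x : C} (h : IsMinimalType1 V tb i v x) :
    shift V i v x = 1 ∧ ∀ c, c ≠ x →
      V i c = 2 ∧ shift V i v c = -1 ∨ V i c ≠ 2 ∧ shift V i v c = 0 := by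
  obtain ⟨-, hx, hvx, h⟩ := h
  refine ⟨?_, fun c hc => ?_⟩
  · rcases shift_cases V i v x with h' | h' | h' <;> omega
  · have := h c hc
    rcases shift_cases V i v c with h' | h' | h' <;> omega

lemma IsMinimalType1.level_lt (htb : Function.Injective tb) {x : C}
    (h : IsMinimalType1 V tb i v x) (hx : winner 3 (Function.update V i v) tb = x)
    (hne : x ≠ winner 3 V tb) :
    level tb V (winner 3 V tb) < level tb V x + levelUnit tb := by
  have h₁ := level_lt_of_manipulation htb hx hne.symm
  have h₂ := h.1
  rcases h.shift_eq.2 _ hne.symm with h' | h'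
  · omega
  · rw [h'.2, h.shift_eq.1] at h₁; omega

/-- A minimal Type 2 manipulation either makes the runner-up `b` win by just demoting the winner,
or demotes the winner and the runner-up in favour of the third candidate. -/
lemma IsMinimalType2.cases (hV : ∀ i, Function.Injective (V i)) (htb : Function.Injective tb)
    {x b : C} (hgs : IsGSManipulation 3 V tb i v) (h : IsMinimalType2 V tb i v x)
    (hx : winner 3 (Function.update V i v) tb = x) (hb : b ≠ winner 3 V tb)
    (hmax : ∀ c, c ≠ winner 3 V tb → c ≠ b → level tb V c < level tb V b) :
    x = b ∧ (∀ c, V i c < 3 → ¬ v c < 3 → c = winner 3 V tb) ∨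
    x ≠ b ∧ V i b < 3 ∧ ¬ v b < 3 ∧ (∀ c, V i c < 3 → c = winner 3 V tb ∨ c = b ∨ c = x) ∧
      (∀ c, V i x ≤ V i c) ∧
      ∀ c, c ≠ winner 3 V tb → c ≠ b → c ≠ x → level tb V c < level tb V x := by
  obtain ⟨hw3, hx3, hvw, hvx, hmin, -⟩ := h
  obtain ⟨-, -, hlt, hopt⟩ := hgs
  rw [hx] at hlt hopt
  set w := winner 3 V tb with hw
  have hxw : x ≠ w := fun e => hvw (e ▸ hvx)
  have hN := levelUnit_pos tb
  have hsx : shift V i v x = 0 := by rcases shift_cases V i v x with h' | h' | h' <;> omega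
  have hsw : shift V i v w = -1 := by rcases shift_cases V i v w with h' | h' | h' <;> omega
  have hlev : ∀ c, c ≠ x → level tb V c + levelUnit tb * shift V i v c < level tb V x :=
    fun c hc => by
      have := level_lt_of_manipulation htb hx hc
      rwa [hsx, mul_zero, add_zero] at this
  have hwx := hlev w hxw.symm
  rw [hsw] at hwx
  have hxb : level tb V x ≤ level tb V b := by
    by_cases e : x = b
    · rw [e]
    · exact (hmax x hxw e).le
  -- the vote that only demotes the winner
  set v' : C → ℕ := Function.update (V i) w (Finset.univ.sup (V i) + 3) with hv'
  have hle : ∀ c, V i c ≤ Finset.univ.sup (V i) := fun c => Finset.le_sup (Finset.mem_univ c)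
  have hv'c : ∀ c, c ≠ w → v' c = V i c := fun c hc => Function.update_of_ne hc _ _
  have hv'w : v' w = Finset.univ.sup (V i) + 3 := Function.update_self _ _ _
  have hv'inj : Function.Injective v' := by
    intro c c' hcc
    by_cases h₁ : c = w <;> by_cases h₂ : c' = w
    · rw [h₁, h₂]
    · rw [h₁, hv'w, hv'c c' h₂] at hcc
      have := hle c'
      omega
    · rw [h₂, hv'w, hv'c c h₁] at hcc
      have := hle c
      omega
    · rw [hv'c c h₁, hv'c c' h₂] at hcc
      exact hV i hcc
  have hs'c : ∀ c, c ≠ w → shift V i v' c = 0 := fun c hc => by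
    unfold shift approves; rw [hv'c c hc, sub_self]
  have hs'w : shift V i v' w = -1 := by
    rcases shift_cases V i v' w with h' | h' | h' <;> omega
  have hwin' : winner 3 (Function.update V i v') tb = b := by
    refine winner_eq htb fun c hc => ?_
    rw [level_update, level_update, hs'c b hb]
    by_cases hcw : c = w
    · rw [hcw, hs'w]; omega
    · rw [hs'c c hcw]; have := hmax c hcw hc; omega
  have hrank : V i x ≤ V i b := by
    have := hopt v' hv'inj
    rwa [hwin'] at this
  by_cases hxb' : x = b
  · refine Or.inl ⟨hxb', fun c hc hvc => ?_⟩
    have hcard := hmin v' hv'inj (by rw [hwin', hxb'])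
    have hdown' : MovedDown V i v' = {w} := by
      ext c
      simp only [MovedDown, Set.mem_ofPred_eq, Set.mem_singleton_iff]
      constructor
      · rintro ⟨h₁, h₂⟩
        by_contra hcw
        rw [hv'c c hcw] at h₂
        exact h₂ h₁
      · rintro rfl
        exact ⟨hw3, by omega⟩
    rw [hdown', Set.ncard_singleton] at hcard
    exact (Set.ncard_le_one (Set.toFinite _)).1 hcard c ⟨hc, hvc⟩ w ⟨hw3, hvw⟩
  · have hb' := hlev b (Ne.symm hxb')
    have hxb'' := hmax x hxw hxb'
    rcases shift_cases V i v b with h' | h' | h'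
    · rw [h'.2.2] at hb'; omega
    · have hap : ∀ c, V i c < 3 → c = w ∨ c = b ∨ c = x := fun c hc => by
        by_contra hcon
        push Not at hcon
        exact not_four_approved (hV i) hc hw3 h'.2.1 hx3 hcon.1 hcon.2.1 hcon.2.2 hb.symm hxw.symm
          (Ne.symm hxb')
      refine Or.inr ⟨hxb', h'.2.1, h'.1, hap, fun c => ?_, fun c hcw hcb hcx => ?_⟩
      · by_cases hc : V i c < 3
        · rcases hap c hc with rfl | rfl | rfl
          · exact hlt.le
          · exact hrank
          · exact le_rfl
        · omega
      · have hc := hlev c hcx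
        rcases shift_cases V i v c with h' | h' | h'
        · rw [h'.2.2] at hc; omega
        · rcases hap c h'.2.1 with e | e | e <;> contradiction
        · rw [h'.2] at hc; omega
    · rw [h'.2] at hb'; omega

lemma exists_runnerUp (htb : Function.Injective tb) {x : C} (hx : x ≠ winner 3 V tb) :
    ∃ b, b ≠ winner 3 V tb ∧
      ∀ c, c ≠ winner 3 V tb → c ≠ b → level tb V c < level tb V b := by
  obtain ⟨b, hb, hmax⟩ := Finset.exists_max_image (Finset.univ.erase (winner 3 V tb))
    (level tb V) ⟨x, by simp [hx]⟩
  exact ⟨b, Finset.ne_of_mem_erase hb, fun c hcw hcb =>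
    lt_of_le_of_ne (hmax c (by simp [hcw])) (levels_ne htb hcb _ _)⟩

end Classification

section Equilibria

variable {C : Type*} [Fintype C] [DecidableEq C] [Nonempty C] {n : ℕ} {V : Fin n → C → ℕ}
  {tb : C → ℕ} {A : Fin n → Set (C → ℕ)}

lemma level_lt_of_two_votes (htb : Function.Injective tb) {i k : Fin n} (hki : k ≠ i)
    (v u : C → ℕ) {y c : C}
    (hy : winner 3 (Function.update (Function.update V i v) k u) tb = y) (hc : c ≠ y) :
    level tb V c + levelUnit tb * shift V i v c + levelUnit tb * shift V k u c <
      level tb V y + levelUnit tb * shift V i v y + levelUnit tb * shift V k u y := by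
  have hs : ∀ c, shift (Function.update V i v) k u c = shift V k u c := fun c => by
    unfold shift; rw [Function.update_of_ne hki]
  have := level_lt_winner htb (Function.update (Function.update V i v) k u) (c := c)
    (by rw [hy]; exact hc)
  rwa [hy, level_update, level_update, level_update, level_update, hs, hs] at this

lemma IsMinimalType2.shift_eq {i : Fin n} {v : C → ℕ} {x : C} (h : IsMinimalType2 V tb i v x) :
    shift V i v x = 0 ∧ shift V i v (winner 3 V tb) = -1 := by
  obtain ⟨h₁, h₂, h₃, h₄, -⟩ := h
  constructor
  · rcases shift_cases V i v x with h' | h' | h' <;> omega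
  · rcases shift_cases V i v (winner 3 V tb) with h' | h' | h' <;> omega

lemma IsGSManipulation.winner_ne {i : Fin n} {v : C → ℕ} {x : C}
    (h : IsGSManipulation 3 V tb i v) (hx : winner 3 (Function.update V i v) tb = x) :
    x ≠ winner 3 V tb := by
  rintro rfl
  exact absurd h.2.2.1 (by rw [hx]; exact lt_irrefl _)

/-- After a Type 1 manipulation in favour of `x`, no other Type 1 manipulation can improve on `x`
unless its own beneficiary starts from a higher level. -/
lemma IsMinimalType1.not_improved_by_type1 (htb : Function.Injective tb) {i k : Fin n}
    (hki : k ≠ i) {v u : C → ℕ} {x y : C} (hv : IsMinimalType1 V tb i v x)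
    (hx : winner 3 (Function.update V i v) tb = x) (hxw : x ≠ winner 3 V tb)
    (hu : IsMinimalType1 V tb k u y)
    (hyw : y ≠ winner 3 V tb) (hyx : level tb V y ≤ level tb V x) :
    ¬ V k (winner 3 (Function.update (Function.update V i v) k u) tb) < V k x := by
  intro hlt
  obtain ⟨z, hz⟩ : ∃ z, winner 3 (Function.update (Function.update V i v) k u) tb = z := ⟨_, rfl⟩
  rw [hz] at hlt
  have hzx : z ≠ x := by rintro rfl; exact lt_irrefl _ hlt
  have hN := levelUnit_pos tb
  have hwx := hv.level_lt htb hx hxw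
  have hcmp := fun c => level_lt_of_two_votes (c := c) htb hki v u hz
  have hxz := hcmp x hzx.symm
  have hle := level_le_winner htb V z
  obtain ⟨hvx, hvc⟩ := hv.shift_eq
  obtain ⟨huy, huc⟩ := hu.shift_eq
  have hvw := hv.1
  have huw := hu.1
  have hky := hu.2.1
  rw [hvx] at hxz
  have hvz := hvc z hzx
  by_cases hxy : x = y
  · subst hxy
    rw [huy] at hxz
    rcases hvz with ⟨-, e₁⟩ | ⟨-, e₁⟩ <;> rcases huc z hzx with ⟨-, e₂⟩ | ⟨-, e₂⟩ <;>
      rw [e₁, e₂] at hxz <;> omega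
  rcases huc x hxy with ⟨hkx, e⟩ | ⟨-, e⟩
  · have hzy : z ≠ y := by rintro rfl; omega
    have hzw : winner 3 V tb ≠ z := by rintro rfl; omega
    have hwz := hcmp _ hzw
    have e₃ : shift V i v (winner 3 V tb) = 0 := by
      rcases hvc _ hxw.symm with h | h <;> omega
    have e₄ : shift V k u (winner 3 V tb) = 0 := by
      rcases huc _ hyw.symm with h | h <;> omega
    have e₂ : shift V k u z = 0 := by
      rcases huc z hzy with h | h <;> omega
    rw [e₃, e₄, e₂] at hwz
    rcases hvz with ⟨-, e₁⟩ | ⟨-, e₁⟩ <;> rw [e₁] at hwz <;> omega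
  · rw [e] at hxz
    by_cases hzy : z = y
    · subst hzy
      rw [huy] at hxz
      rcases hvz with ⟨-, e₁⟩ | ⟨-, e₁⟩ <;> rw [e₁] at hxz <;> omega
    · rcases hvz with ⟨-, e₁⟩ | ⟨-, e₁⟩ <;> rcases huc z hzy with ⟨-, e₂⟩ | ⟨-, e₂⟩ <;>
        rw [e₁, e₂] at hxz <;> omega

/-- After a Type 1 manipulation in favour of `x`, no Type 2 manipulation can improve on `x`. -/
lemma IsMinimalType1.not_improved_by_type2 (hV : ∀ i, Function.Injective (V i))
    (htb : Function.Injective tb) {i k : Fin n}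
    (hki : k ≠ i) {v u : C → ℕ} {x y : C} (hv : IsMinimalType1 V tb i v x)
    (hx : winner 3 (Function.update V i v) tb = x) (hxw : x ≠ winner 3 V tb)
    (hgs : IsGSManipulation 3 V tb k u) (hu : IsMinimalType2 V tb k u y)
    (hy : winner 3 (Function.update V k u) tb = y) :
    ¬ V k (winner 3 (Function.update (Function.update V i v) k u) tb) < V k x := by
  intro hlt
  obtain ⟨z, hz⟩ : ∃ z, winner 3 (Function.update (Function.update V i v) k u) tb = z := ⟨_, rfl⟩
  rw [hz] at hlt
  have hzx : z ≠ x := by rintro rfl; exact lt_irrefl _ hlt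
  have hN := levelUnit_pos tb
  have hwx := hv.level_lt htb hx hxw
  have hyw := hgs.winner_ne hy
  have hxz := level_lt_of_two_votes htb hki v u hz hzx.symm
  have hle := level_le_winner htb V z
  have hyw' := level_lt_winner htb V hyw
  obtain ⟨hvx, hvc⟩ := hv.shift_eq
  obtain ⟨huy, huw⟩ := hu.shift_eq
  have hup : ∀ c, shift V k u c = 1 → level tb V c + levelUnit tb < level tb V y := by
    intro c hc
    have hcy : c ≠ y := by rintro rfl; omega
    have := level_lt_of_manipulation htb hy hcy
    rw [hc, huy] at this
    omega
  rw [hvx] at hxz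
  have hvz := hvc z hzx
  rcases shift_cases V k u x with ⟨-, -, e⟩ | ⟨hux, hkx, e⟩ | ⟨-, e⟩
  · have := hup x e
    omega
  · obtain ⟨b, hb, hmax⟩ := exists_runnerUp htb hxw
    rcases hu.cases hV htb hgs hy hb hmax with ⟨-, h⟩ | ⟨hyb, -, -, hap, -⟩
    · exact hxw (h x hkx hux)
    have hxb : x = b := by
      rcases hap x hkx with h | h | h
      · exact absurd h hxw
      · exact h
      · exact absurd hu.2.2.2.1 (h ▸ hux)
    subst hxb
    have hyx := hmax y hyw hyb
    rw [e] at hxz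
    by_cases hzw : z = winner 3 V tb
    · rw [hzw, huw] at hxz
      rcases hvc _ hxw.symm with ⟨-, e₁⟩ | ⟨-, e₁⟩ <;> rw [e₁] at hxz <;> omega
    · have hzx' := hmax z hzw hzx
      rcases shift_cases V k u z with ⟨-, -, e₂⟩ | ⟨-, -, e₂⟩ | ⟨-, e₂⟩
      · have := hup z e₂
        rcases hvz with ⟨-, e₁⟩ | ⟨-, e₁⟩ <;> rw [e₁, e₂] at hxz <;> omega
      all_goals rcases hvz with ⟨-, e₁⟩ | ⟨-, e₁⟩ <;> rw [e₁, e₂] at hxz <;> omega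
  · rw [e] at hxz
    rcases shift_cases V k u z with ⟨-, -, e₂⟩ | ⟨-, -, e₂⟩ | ⟨-, e₂⟩
    · have := hup z e₂
      rcases hvz with ⟨-, e₁⟩ | ⟨-, e₁⟩ <;> rw [e₁, e₂] at hxz <;> omega
    all_goals rcases hvz with ⟨-, e₁⟩ | ⟨-, e₁⟩ <;> rw [e₁, e₂] at hxz <;> omega

/-- A single manipulation is an equilibrium as soon as the other players cannot improve on it. -/
lemma exists_equilibrium_of_manipulation (hV : ∀ i, Function.Injective (V i))
    (hsin : ∀ i, V i ∈ A i)
    (hmanip : ∀ i, ∀ v ∈ A i, v = V i ∨ IsGSManipulation 3 V tb i v) {i : Fin n} {v : C → ℕ}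
    {x : C} (hv : v ∈ A i) (hx : winner 3 (Function.update V i v) tb = x)
    (hgs : IsGSManipulation 3 V tb i v)
    (hother : ∀ k, k ≠ i → ∀ u ∈ A k, u ≠ V k →
      ¬ V k (winner 3 (Function.update (Function.update V i v) k u) tb) < V k x) :
    ∃ σ : Fin n → C → ℕ, (∀ i, σ i ∈ A i) ∧
      ∀ i, ∀ v' ∈ A i,
        ¬ V i (winner 3 (Function.update σ i v') tb) < V i (winner 3 σ tb) := by
  refine ⟨Function.update V i v, fun k => ?_, fun k u hu => ?_⟩
  · by_cases hk : k = i
    · subst hk; simpa using hv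
    · simpa [hk] using hsin k
  · by_cases hk : k = i
    · subst hk
      rw [Function.update_idem, not_lt]
      refine hgs.2.2.2 u ?_
      rcases hmanip k u hu with rfl | h
      · exact hV k
      · exact h.1
    · rw [hx]
      by_cases huk : u = V k
      · have : Function.update (Function.update V i v) k u = Function.update V i v := by
          rw [huk, Function.update_eq_iff, Function.update_of_ne hk]
          exact ⟨rfl, fun _ _ => rfl⟩
        rw [this, hx]
        exact lt_irrefl _
      · exact hother k hk u hu huk

/-- If some player has a minimal Type 1 manipulation, there is an equilibrium in which exactly one
player manipulates. -/
theorem exists_equilibrium_of_type1 (hV : ∀ i, Function.Injective (V i))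
    (htb : Function.Injective tb) (hsin : ∀ i, V i ∈ A i)
    (hstrat : ∀ i, ∀ v' ∈ A i, v' = V i ∨
      (IsGSManipulation 3 V tb i v' ∧
        (IsMinimalType1 V tb i v' (winner 3 (Function.update V i v') tb) ∨
         IsMinimalType2 V tb i v' (winner 3 (Function.update V i v') tb))))
    (h : ∃ i, ∃ v ∈ A i, IsMinimalType1 V tb i v (winner 3 (Function.update V i v) tb)) :
    ∃ σ : Fin n → C → ℕ, (∀ i, σ i ∈ A i) ∧
      ∀ i, ∀ v' ∈ A i,
        ¬ V i (winner 3 (Function.update σ i v') tb) < V i (winner 3 σ tb) := by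
  classical
  obtain ⟨x, hx, hmax⟩ := Finset.exists_max_image
    (Finset.univ.filter fun x => ∃ i, ∃ v ∈ A i, winner 3 (Function.update V i v) tb = x ∧
      IsMinimalType1 V tb i v x) (level tb V) (by
        obtain ⟨i, v, hv, h⟩ := h
        exact ⟨_, Finset.mem_filter.2 ⟨Finset.mem_univ _, i, v, hv, rfl, h⟩⟩)
  obtain ⟨-, i, v, hv, hx, ht⟩ := Finset.mem_filter.1 hx
  have hgs : IsGSManipulation 3 V tb i v := by
    rcases hstrat i v hv with rfl | h
    · have h₁ := ht.2.1
      have h₂ := ht.2.2.1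
      omega
    · exact h.1
  have hxw := hgs.winner_ne hx
  refine exists_equilibrium_of_manipulation hV hsin
    (fun i v hv => (hstrat i v hv).imp_right And.left) hv hx hgs fun k hk u hu huk => ?_
  rcases hstrat k u hu with h | ⟨hgs', h | h⟩
  · exact absurd h huk
  · exact ht.not_improved_by_type1 htb hk hx hxw h (hgs'.winner_ne rfl)
      (hmax _ (Finset.mem_filter.2 ⟨Finset.mem_univ _, k, u, hu, rfl, h⟩))
  · exact ht.not_improved_by_type2 hV htb hk hx hxw hgs' h rfl

end Equilibria

section RunnerUp

variable {C : Type*} [Fintype C] [DecidableEq C] [Nonempty C] {n : ℕ} {V : Fin n → C → ℕ}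
  {tb : C → ℕ} {A : Fin n → Set (C → ℕ)}

/-- If all manipulations are of Type 2 in favour of the runner-up, there is an equilibrium in which
at most one player manipulates. -/
theorem exists_equilibrium_of_runnerUp (hV : ∀ i, Function.Injective (V i))
    (htb : Function.Injective tb) (hsin : ∀ i, V i ∈ A i)
    (hstrat : ∀ i, ∀ v' ∈ A i, v' = V i ∨
      (IsGSManipulation 3 V tb i v' ∧
        IsMinimalType2 V tb i v' (winner 3 (Function.update V i v') tb)))
    {b : C} (hmax : ∀ c, c ≠ winner 3 V tb → c ≠ b → level tb V c < level tb V b)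
    (h : ∀ i, ∀ v ∈ A i, v ≠ V i → winner 3 (Function.update V i v) tb = b) :
    ∃ σ : Fin n → C → ℕ, (∀ i, σ i ∈ A i) ∧
      ∀ i, ∀ v' ∈ A i,
        ¬ V i (winner 3 (Function.update σ i v') tb) < V i (winner 3 σ tb) := by
  by_cases hex : ∃ i, ∃ v ∈ A i, v ≠ V i
  · obtain ⟨i, v, hv, hvi⟩ := hex
    have hx := h i v hv hvi
    obtain ⟨hgs, ht⟩ := (hstrat i v hv).resolve_left hvi
    rw [hx] at ht
    refine exists_equilibrium_of_manipulation hV hsin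
      (fun i v hv => (hstrat i v hv).imp_right And.left) hv hx hgs fun k hk u hu huk hlt => ?_
    obtain ⟨hgs', ht'⟩ := (hstrat k u hu).resolve_left huk
    rw [h k u hu huk] at ht'
    obtain ⟨z, hz⟩ : ∃ z, winner 3 (Function.update (Function.update V i v) k u) tb = z :=
      ⟨_, rfl⟩
    rw [hz] at hlt
    have hzb : z ≠ b := by rintro rfl; exact lt_irrefl _ hlt
    have hN := levelUnit_pos tb
    have hkb := ht'.2.1
    have hbz := level_lt_of_two_votes htb hk v u hz hzb.symm
    have hbv := level_lt_of_manipulation htb hx hzb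
    rw [ht.shift_eq.1, ht'.shift_eq.1] at hbz
    rw [ht.shift_eq.1] at hbv
    rcases shift_cases V k u z with ⟨-, h', -⟩ | ⟨-, -, e⟩ | ⟨-, e⟩
    · omega
    all_goals rw [e] at hbz; omega
  · push Not at hex
    refine ⟨V, hsin, fun i v hv => ?_⟩
    rw [hex i v hv, Function.update_eq_self]
    exact lt_irrefl _

end RunnerUp

/-- A vote `v` that differs from the sincere vote `s` by demoting the winner `w`, and possibly the
runner-up `b₁`, in favour of `b₁` or of the candidate `b₂`. -/
structure IsLeaderMove {C : Type*} (s : C → ℕ) (L : C → ℤ) (N : ℤ) (w b₁ b₂ : C) (v : C → ℕ) :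
    Prop where
  injective : Function.Injective v
  approved_w : s w < 3
  approved_b₁ : s b₁ < 3
  demoted_w : ¬ v w < 3
  demoted : ∀ c, s c < 3 → ¬ v c < 3 → c = w ∨ c = b₁
  promoted_lt : ∀ c, v c < 3 → ¬ s c < 3 → L c + N < L b₁
  promoted_best : ∀ c c', v c < 3 → ¬ s c < 3 → ¬ s c' < 3 → ¬ v c' < 3 → s c < s c'
  target : v b₁ < 3 ∧ s b₁ < s w ∨
    ¬ v b₁ < 3 ∧ s b₂ < 3 ∧ (∀ c, s b₂ ≤ s c) ∧ ∀ c, v c < 3 → ¬ s c < 3 → L c + N < L b₂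

section LeaderGame

variable {C : Type*}

/-- A chain of sets with at most two elements has, apart from the empty set, at most two members. -/
lemma exists_insert_of_chain [DecidableEq C] {α : Type*} (S : Set α) (U : α → Finset C)
    (hne : S.Nonempty)
    (hchain : ∀ x ∈ S, ∀ y ∈ S, U x ⊆ U y ∨ U y ⊆ U x) (hcard : ∀ x ∈ S, (U x).card ≤ 2) :
    ∃ x ∈ S, (∀ z ∈ S, U z = ∅ ∨ U z = U x) ∨
      ∃ y ∈ S, ∃ a ∉ U x, U y = insert a (U x) ∧
        ∀ z ∈ S, U z = ∅ ∨ U z = U x ∨ U z = U y := by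
  have heq : ∀ x ∈ S, ∀ y ∈ S, (U x).card = (U y).card → U x = U y := by
    intro x hx y hy h
    rcases hchain x hx y hy with h' | h'
    · exact Finset.eq_of_subset_of_card_le h' h.ge
    · exact (Finset.eq_of_subset_of_card_le h' h.le).symm
  by_cases h₁ : ∃ x ∈ S, (U x).card = 1
  · obtain ⟨x, hx, hx₁⟩ := h₁
    refine ⟨x, hx, ?_⟩
    by_cases h₂ : ∃ y ∈ S, (U y).card = 2
    · obtain ⟨y, hy, hy₂⟩ := h₂
      have hsub : U x ⊆ U y := (hchain x hx y hy).resolve_right fun h => by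
        have := Finset.card_le_card h
        omega
      obtain ⟨a, ha, hins⟩ := (Finset.covBy_iff_card_sdiff_eq_one.2
        ⟨hsub, by rw [Finset.card_sdiff_of_subset hsub]; omega⟩).exists_finset_insert
      refine Or.inr ⟨y, hy, a, ha, hins.symm, fun z hz => ?_⟩
      have := hcard z hz
      rcases (by omega : (U z).card = 0 ∨ (U z).card = 1 ∨ (U z).card = 2) with h | h | h
      · exact Or.inl (Finset.card_eq_zero.1 h)
      · exact Or.inr (Or.inl (heq z hz x hx (by omega)))
      · exact Or.inr (Or.inr (heq z hz y hy (by omega)))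
    · push Not at h₂
      refine Or.inl fun z hz => ?_
      have := hcard z hz
      have := h₂ z hz
      rcases (by omega : (U z).card = 0 ∨ (U z).card = 1) with h | h
      · exact Or.inl (Finset.card_eq_zero.1 h)
      · exact Or.inr (heq z hz x hx (by omega))
  · push Not at h₁
    by_cases h₂ : ∃ y ∈ S, (U y).card = 2
    · obtain ⟨y, hy, hy₂⟩ := h₂
      refine ⟨y, hy, Or.inl fun z hz => ?_⟩
      have := hcard z hz
      have := h₁ z hz
      rcases (by omega : (U z).card = 0 ∨ (U z).card = 2) with h | h
      · exact Or.inl (Finset.card_eq_zero.1 h)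
      · exact Or.inr (heq z hz y hy (by omega))
    · push Not at h₂
      obtain ⟨x, hx⟩ := hne
      refine ⟨x, hx, Or.inl fun z hz => Or.inl (Finset.card_eq_zero.1 ?_)⟩
      have := hcard z hz
      have := h₁ z hz
      have := h₂ z hz
      omega

lemma IsLeaderMove.exists_kept {s v : C → ℕ} {L : C → ℤ} {N : ℤ} {w b₁ b₂ : C}
    (h : IsLeaderMove s L N w b₁ b₂ v) (hw₂ : b₂ ≠ w) (h₁₂ : b₂ ≠ b₁) :
    ∃ y, v y < 3 ∧ s y < 3 := by
  rcases h.target with h' | h'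
  · exact ⟨b₁, h'.1, h.approved_b₁⟩
  · refine ⟨b₂, ?_, h'.2.1⟩
    by_contra hv
    exact (h.demoted b₂ h'.2.1 hv).elim hw₂ h₁₂

variable [Fintype C]

/-- The candidates approved by `v` but not by `s`. -/
def promoted (s v : C → ℕ) : Finset C := Finset.univ.filter fun c => v c < 3 ∧ ¬ s c < 3

lemma mem_promoted {s v : C → ℕ} {c : C} : c ∈ promoted s v ↔ v c < 3 ∧ ¬ s c < 3 := by
  simp [promoted]

lemma promoted_self (s : C → ℕ) : promoted s s = ∅ := by
  ext c
  simp [mem_promoted]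

lemma shift_eq_one_iff {n : ℕ} {V : Fin n → C → ℕ} {i : Fin n} {v : C → ℕ} {c : C} :
    shift V i v c = 1 ↔ c ∈ promoted (V i) v := by
  rw [mem_promoted]
  rcases shift_cases V i v c with h | h | h <;> omega

namespace IsLeaderMove

variable {s v v' : C → ℕ} {L : C → ℤ} {N : ℤ} {w b₁ b₂ : C}

lemma promoted_chain (h : IsLeaderMove s L N w b₁ b₂ v) (h' : IsLeaderMove s L N w b₁ b₂ v') :
    promoted s v ⊆ promoted s v' ∨ promoted s v' ⊆ promoted s v := by
  by_contra hcon
  push Not at hcon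
  obtain ⟨⟨c, hc, hc'⟩, ⟨e, he, he'⟩⟩ :=
    And.intro (Finset.not_subset.1 hcon.1) (Finset.not_subset.1 hcon.2)
  rw [mem_promoted] at hc hc' he he'
  have h₁ := h.promoted_best c e hc.1 hc.2 he.2 fun h => he' ⟨h, he.2⟩
  have h₂ := h'.promoted_best e c he.1 he.2 hc.2 fun h => hc' ⟨h, hc.2⟩
  omega

lemma promoted_le_two (h : IsLeaderMove s L N w b₁ b₂ v) (hw₂ : b₂ ≠ w) (h₁₂ : b₂ ≠ b₁)
    {c₁ c₂ c₃ : C} (hc₁ : c₁ ∈ promoted s v) (hc₂ : c₂ ∈ promoted s v)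
    (hc₃ : c₃ ∈ promoted s v) : c₁ = c₂ ∨ c₁ = c₃ ∨ c₂ = c₃ := by
  by_contra hcon
  push Not at hcon
  obtain ⟨y, hy, hsy⟩ := h.exists_kept hw₂ h₁₂
  rw [mem_promoted] at hc₁ hc₂ hc₃
  exact not_four_approved h.injective hy hc₁.1 hc₂.1 hc₃.1 (fun e => hc₁.2 (e ▸ hsy))
    (fun e => hc₂.2 (e ▸ hsy)) (fun e => hc₃.2 (e ▸ hsy)) hcon.1 hcon.2.1 hcon.2.2

lemma promoted_le_one (h : IsLeaderMove s L N w b₁ b₂ v) (hv : v b₁ < 3) {o : C} (ho : s o < 3)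
    (how : o ≠ w) (ho₁ : o ≠ b₁) {c₁ c₂ : C} (hc₁ : c₁ ∈ promoted s v)
    (hc₂ : c₂ ∈ promoted s v) : c₁ = c₂ := by
  by_contra hcon
  have hvo : v o < 3 := by
    by_contra hvo
    exact (h.demoted o ho hvo).elim how ho₁
  have hs := h.approved_b₁
  rw [mem_promoted] at hc₁ hc₂
  exact not_four_approved h.injective hv hvo hc₁.1 hc₂.1 ho₁.symm (fun e => hc₁.2 (e ▸ hs))
    (fun e => hc₂.2 (e ▸ hs)) (fun e => hc₁.2 (e ▸ ho)) (fun e => hc₂.2 (e ▸ ho)) hcon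

end IsLeaderMove

/-- The resting action `x` of a player and, possibly, a further action promoting one more
candidate, which together account for all promotions that the player can bring about. -/
lemma exists_resting_action [DecidableEq C] {s : C → ℕ} {L : C → ℤ} {N : ℤ} {w b₁ b₂ : C}
    {A : Set (C → ℕ)}
    (hs : s ∈ A) (hw₂ : b₂ ≠ w) (h₁₂ : b₂ ≠ b₁)
    (hA : ∀ v ∈ A, v = s ∨ IsLeaderMove s L N w b₁ b₂ v)
    (htarget : ∀ v ∈ A, ∀ v' ∈ A, v ≠ s → v' ≠ s → v b₁ < 3 → v' b₁ < 3) :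
    ∃ x ∈ A, ((∀ z ∈ A, promoted s z = ∅ ∨ promoted s z = promoted s x) ∨
      ∃ y ∈ A, ∃ a ∉ promoted s x, promoted s y = insert a (promoted s x) ∧
        ∀ z ∈ A, promoted s z = ∅ ∨ promoted s z = promoted s x ∨ promoted s z = promoted s y) ∧
      (∀ v ∈ A, s b₁ < 3 → ¬ v b₁ < 3 → ¬ x b₁ < 3) ∧
      (¬ s b₂ < 3 → ∀ c ∈ promoted s x, ∀ c', s c' < 3 → c' = w ∨ c' = b₁) := by
  have hempty : ∀ {z}, z ∈ A → ¬ (z ∈ A ∧ z ≠ s) → promoted s z = ∅ := fun {z} hz hzs => by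
    have : z = s := by by_contra h; exact hzs ⟨hz, h⟩
    rw [this, promoted_self]
  have hchain : ∀ x ∈ A, ∀ y ∈ A, promoted s x ⊆ promoted s y ∨ promoted s y ⊆ promoted s x := by
    intro x hx y hy
    rcases hA x hx with rfl | hx'
    · left; simp [promoted_self]
    rcases hA y hy with rfl | hy'
    · right; simp [promoted_self]
    exact hx'.promoted_chain hy'
  by_cases hact : ∃ v ∈ A, v ≠ s
  swap
  · push Not at hact
    refine ⟨s, hs, Or.inl fun z hz => Or.inl ?_, fun v hv h₁ h₂ => ?_, fun _ c hc => ?_⟩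
    · rw [hact z hz, promoted_self]
    · rwa [hact v hv] at h₂
    · simp [promoted_self] at hc
  by_cases hother : ¬ s b₂ < 3 ∧ ∃ o, s o < 3 ∧ o ≠ w ∧ o ≠ b₁
  · obtain ⟨hs₂, o, ho, how, ho₁⟩ := hother
    have hkeep : ∀ v ∈ A, s b₁ < 3 → v b₁ < 3 := by
      intro v hv h₁
      rcases hA v hv with rfl | h
      · exact h₁
      · exact h.target.elim And.left fun h' => absurd h'.2.1 hs₂
    refine ⟨s, hs, ?_, fun v hv h₁ h₂ => absurd (hkeep v hv h₁) h₂, fun _ c hc => ?_⟩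
    swap
    · simp [promoted_self] at hc
    by_cases hup : ∃ y ∈ A, (promoted s y).Nonempty
    swap
    · push Not at hup
      exact Or.inl fun z hz => Or.inl (by simpa using hup z hz)
    obtain ⟨y, hy, a, ha⟩ := hup
    have hsingle : ∀ z ∈ A, ∀ c ∈ promoted s z, promoted s z = {c} := by
      intro z hz c hc
      rcases hA z hz with rfl | h
      · simp [promoted_self] at hc
      refine Finset.eq_singleton_iff_unique_mem.2 ⟨hc, fun c' hc' => ?_⟩
      exact h.promoted_le_one (hkeep z hz h.approved_b₁) ho how ho₁ hc' hc
    refine Or.inr ⟨y, hy, a, by simp [promoted_self], ?_, fun z hz => ?_⟩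
    · rw [promoted_self, hsingle y hy a ha]
      rfl
    · rcases Finset.eq_empty_or_nonempty (promoted s z) with h | ⟨c, hc⟩
      · exact Or.inl h
      · right; right
        have h₁ := hsingle z hz c hc
        have h₂ := hsingle y hy a ha
        rcases hchain z hz y hy with h | h
        · rw [h₁, h₂, Finset.singleton_subset_singleton] at h
          rw [h₁, h₂, h]
        · rw [h₁, h₂, Finset.singleton_subset_singleton] at h
          rw [h₁, h₂, h]
  · obtain ⟨x, ⟨hx, hxs⟩, hcases⟩ := exists_insert_of_chain {v | v ∈ A ∧ v ≠ s} (promoted s)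
      hact (fun x hx y hy => hchain x hx.1 y hy.1) (fun x hx => by
        have h := (hA x hx.1).resolve_left hx.2
        by_contra hcard
        obtain ⟨c₁, c₂, c₃, h₁, h₂, h₃, h₁₂', h₁₃, h₂₃⟩ :=
          Finset.two_lt_card_iff.1 (not_le.1 hcard)
        rcases h.promoted_le_two hw₂ h₁₂ h₁ h₂ h₃ with e | e | e <;> contradiction)
    refine ⟨x, hx, ?_, fun v hv h₁ h₂ hx₁ => ?_, fun hs₂ c _ c' hc' => ?_⟩
    · rcases hcases with h | ⟨y, hy, a, ha, hins, h⟩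
      · refine Or.inl fun z hz => ?_
        by_cases hzs : z ∈ A ∧ z ≠ s
        · exact h z hzs
        · exact Or.inl (hempty hz hzs)
      · refine Or.inr ⟨y, hy.1, a, ha, hins, fun z hz => ?_⟩
        by_cases hzs : z ∈ A ∧ z ≠ s
        · exact h z hzs
        · exact Or.inl (hempty hz hzs)
    · have hvs : v ≠ s := by rintro rfl; exact h₂ h₁
      exact h₂ (htarget x hx v hv hxs hvs hx₁)
    · by_contra hcon
      push Not at hcon
      exact hother ⟨hs₂, c', hc', hcon.1, hcon.2⟩

end LeaderGame

section LeaderEquilibrium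

variable {C : Type*} [Fintype C] [DecidableEq C] [Nonempty C] {n : ℕ} {V : Fin n → C → ℕ}
  {tb : C → ℕ} {A : Fin n → Set (C → ℕ)}

/-- If all manipulations favour the runner-up `b₁` or the third candidate `b₂`, and some
manipulation favours `b₂`, there is an equilibrium. -/
theorem exists_equilibrium_of_leaderMoves (hV : ∀ i, Function.Injective (V i))
    (htb : Function.Injective tb) (hsin : ∀ i, V i ∈ A i) {w b₁ b₂ : C} (hw₁ : b₁ ≠ w)
    (hw₂ : b₂ ≠ w) (h₁₂ : b₂ ≠ b₁) (hL₁ : level tb V b₁ < level tb V w)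
    (hL₂ : level tb V b₂ < level tb V b₁)
    (hL : ∀ c, c ≠ w → c ≠ b₁ → c ≠ b₂ → level tb V c < level tb V b₂)
    (hLw : level tb V w - levelUnit tb < level tb V b₂)
    (hA : ∀ i, ∀ v ∈ A i, v = V i ∨ IsLeaderMove (V i) (level tb V) (levelUnit tb) w b₁ b₂ v)
    (htarget : ∀ i, ∀ v ∈ A i, ∀ v' ∈ A i, v ≠ V i → v' ≠ V i → v b₁ < 3 → v' b₁ < 3)
    (hJ : ∃ j, ∃ u ∈ A j, u ≠ V j ∧ ¬ u b₁ < 3) :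
    ∃ σ : Fin n → C → ℕ, (∀ i, σ i ∈ A i) ∧
      ∀ i, ∀ v' ∈ A i,
        ¬ V i (winner 3 (Function.update σ i v') tb) < V i (winner 3 σ tb) := by
  classical
  have hex : ∀ i, ∃ (x : C → ℕ) (y : C → ℕ) (a : C) (t : Prop), x ∈ A i ∧
      (t → y ∈ A i ∧ a ∉ promoted (V i) x ∧ promoted (V i) y = insert a (promoted (V i) x)) ∧
      (∀ z ∈ A i, promoted (V i) z = ∅ ∨ promoted (V i) z = promoted (V i) x ∨
        t ∧ promoted (V i) z = promoted (V i) y) ∧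
      (∀ v ∈ A i, V i b₁ < 3 → ¬ v b₁ < 3 → ¬ x b₁ < 3) ∧
      (¬ V i b₂ < 3 → ∀ c ∈ promoted (V i) x, ∀ c', V i c' < 3 → c' = w ∨ c' = b₁) := by
    intro i
    obtain ⟨x, hx, h, h₁, h₂⟩ := exists_resting_action (hsin i) hw₂ h₁₂ (hA i) (htarget i)
    rcases h with h | ⟨y, hy, a, ha, hya, h⟩
    · exact ⟨x, x, w, False, hx, False.elim, fun z hz => (h z hz).imp_right Or.inl, h₁, h₂⟩
    · exact ⟨x, y, a, True, hx, fun _ => ⟨hy, ha, hya⟩,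
        fun z hz => (h z hz).imp_right (Or.imp_right fun h => ⟨trivial, h⟩), h₁, h₂⟩
  choose off on τ t hoff hon hcases hoff_b₁ hoff_ap using hex
  have hN := levelUnit_pos tb
  have hmove : ∀ i, ∀ v ∈ A i, v ≠ V i →
      IsLeaderMove (V i) (level tb V) (levelUnit tb) w b₁ b₂ v :=
    fun i v hv hvs => (hA i v hv).resolve_left hvs
  have hne_of_shift : ∀ {i v c}, shift V i v c ≠ 0 → v ≠ V i := fun h e =>
    h (by rw [e, shift_self])
  have hshift_w : ∀ i, ∀ v ∈ A i, v ≠ V i → shift V i v w = -1 := fun i v hv hvs => by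
    have h₁ := (hmove i v hv hvs).approved_w
    have h₂ := (hmove i v hv hvs).demoted_w
    rcases shift_cases V i v w with h | h | h <;> omega
  have hshift_b₁ : ∀ i, ∀ v ∈ A i, v ≠ V i →
      v b₁ < 3 ∧ shift V i v b₁ = 0 ∨ ¬ v b₁ < 3 ∧ shift V i v b₁ = -1 := fun i v hv hvs => by
    have h₁ := (hmove i v hv hvs).approved_b₁
    rcases shift_cases V i v b₁ with h | h | h <;> omega
  have hshift : ∀ i, ∀ v ∈ A i, ∀ c, c ≠ w → c ≠ b₁ →
      shift V i v c = if c ∈ promoted (V i) v then 1 else 0 := by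
    intro i v hv c hcw hc₁
    simp only [← shift_eq_one_iff]
    rcases shift_cases V i v c with h | h | h
    · rw [if_pos h.2.2, h.2.2]
    · exact absurd ((hmove i v hv (hne_of_shift (c := c) (by omega))).demoted c h.2.1 h.1)
        (by tauto)
    · rw [h.2]; rfl
  have hlt : ∀ i, ∀ v ∈ A i, ∀ c, c ∈ promoted (V i) v → level tb V c + levelUnit tb <
      level tb V b₁ ∧ c ≠ w ∧ c ≠ b₁ ∧ c ≠ b₂ := by
    intro i v hv c hc
    have hvs : v ≠ V i := hne_of_shift (c := c) (by rw [shift_eq_one_iff.2 hc]; decide)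
    have h := hmove i v hv hvs
    rw [mem_promoted] at hc
    have := h.promoted_lt c hc.1 hc.2
    refine ⟨this, ?_, ?_, ?_⟩ <;> rintro rfl <;> omega
  have hpromoted_ne : ∀ {i v c}, c ∈ promoted (V i) v → v ≠ V i := fun {i v c} hc =>
    hne_of_shift (c := c) (by rw [shift_eq_one_iff.2 hc]; decide)
  let ap : Fin n → C → Prop := fun i c => (∃ v ∈ A i, v ≠ V i) ∧ V i c < 3
  let J : Finset (Fin n) := Finset.univ.filter fun i => ∃ v ∈ A i, v ≠ V i ∧ ¬ v b₁ < 3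
  let E : Finset (Fin n) := Finset.univ.filter fun i => ap i b₂
  have mem_J : ∀ {i}, i ∈ J ↔ ∃ v ∈ A i, v ≠ V i ∧ ¬ v b₁ < 3 := by simp [J]
  have mem_E : ∀ {i}, i ∈ E ↔ ap i b₂ := by simp [E]
  have hJ_target : ∀ i ∈ J, ∀ v ∈ A i, v ≠ V i → ¬ v b₁ < 3 := fun i hi v hv hvs hlt => by
    obtain ⟨u, hu, hus, hub⟩ := mem_J.1 hi
    exact hub (htarget i v hv u hu hvs hus hlt)
  have hJ_off : ∀ i ∈ J, off i ≠ V i ∧ ¬ off i b₁ < 3 := fun i hi => by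
    obtain ⟨u, hu, hus, hub⟩ := mem_J.1 hi
    have h₁ := (hmove i u hu hus).approved_b₁
    have h₂ := hoff_b₁ i u hu h₁ hub
    exact ⟨fun e => h₂ (e ▸ h₁), h₂⟩
  have hJ_move : ∀ i ∈ J, V i b₂ < 3 ∧ (∀ c, V i b₂ ≤ V i c) ∧
      ∀ c ∈ promoted (V i) (off i), level tb V c + levelUnit tb < level tb V b₂ := by
    intro i hi
    obtain ⟨h₁, h₂⟩ := hJ_off i hi
    rcases (hmove i _ (hoff i) h₁).target with h | h
    · exact absurd h.1 h₂
    · exact ⟨h.2.1, h.2.2.1, fun c hc => h.2.2.2 c (mem_promoted.1 hc).1 (mem_promoted.1 hc).2⟩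
  obtain ⟨σ, hσ, hnash⟩ := ShiftGame.exists_isNash
    { rank := V
      A := A
      d := shift V
      L := level tb V
      N := levelUnit tb
      w := w
      b₁ := b₁
      b₂ := b₂
      ap := ap
      win := fun σ => winner 3 σ tb
      s := V
      off := off
      on := on
      τ := τ
      T := Finset.univ.filter t
      E := E
      J := J
      N_pos := hN
      L_inj := fun c c' hc a b => by
        have := levels_ne htb hc (approvalScore 3 V c + a) (approvalScore 3 V c' + b)
        unfold level
        intro h
        apply this
        linarith
      L_b₁ := hL₁
      L_b₂ := hL₂
      L_lt := hL
      L_w := hLw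
      win_spec := fun σ c hc => by
        rw [← level_eq_add_sum, ← level_eq_add_sum]
        exact level_lt_winner htb σ hc
      s_mem := hsin
      d_s := shift_self V
      off_mem := hoff
      on_mem := fun i hi => (hon i (Finset.mem_filter.1 hi).2).1
      d_on := fun i hi c hcw hc₁ => by
        obtain ⟨h₁, h₂, h₃⟩ := hon i (Finset.mem_filter.1 hi).2
        rw [hshift i _ h₁ c hcw hc₁, hshift i _ (hoff i) c hcw hc₁, h₃]
        by_cases e : c = τ i
        · subst e; simp [h₂]
        · simp [e]
      τ_ne := fun i hi => by
        obtain ⟨h₁, h₂, h₃⟩ := hon i (Finset.mem_filter.1 hi).2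
        have := hlt i _ h₁ (τ i) (by rw [h₃]; exact Finset.mem_insert_self _ _)
        exact ⟨this.2.1, this.2.2.1⟩
      d_cases := fun i v hv => by
        rcases hcases i v hv with h | h | ⟨ht, h⟩
        · refine Or.inl fun c hcw hc₁ => ?_
          rw [hshift i v hv c hcw hc₁, h]
          rfl
        · refine Or.inr (Or.inl fun c hcw hc₁ => ?_)
          rw [hshift i v hv c hcw hc₁, hshift i _ (hoff i) c hcw hc₁, h]
        · refine Or.inr (Or.inr ⟨Finset.mem_filter.2 ⟨Finset.mem_univ _, ht⟩, fun c hcw hc₁ => ?_⟩)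
          rw [hshift i v hv c hcw hc₁, hshift i _ (hon i ht).1 c hcw hc₁, h]
      d_zero_or_one := fun i v hv c hcw hc₁ => by
        rw [hshift i v hv c hcw hc₁]
        split_ifs <;> simp
      d_b₂ := fun i v hv => by
        rw [hshift i v hv b₂ hw₂ h₁₂, if_neg fun h => (hlt i v hv b₂ h).2.2.2 rfl]
      d_w := fun i v hv => by
        by_cases hvs : v = V i
        · rw [hvs, shift_self]; exact Or.inl rfl
        · exact Or.inr (hshift_w i v hv hvs)
      d_b₁ := fun i v hv => by
        by_cases hvs : v = V i
        · rw [hvs, shift_self]; exact Or.inl rfl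
        · exact (hshift_b₁ i v hv hvs).imp And.right And.right
      d_eq_zero := fun i v hv h c => by
        by_cases hvs : v = V i
        · rw [hvs, shift_self]
        · have := hshift_w i v hv hvs
          omega
      mem_J := fun i v hv h => by
        have hvs : v ≠ V i := hne_of_shift (c := b₁) (by omega)
        refine mem_J.2 ⟨v, hv, hvs, ?_⟩
        rcases hshift_b₁ i v hv hvs with h' | h'
        · omega
        · exact h'.1
      J_d_b₁ := fun i hi v hv h => by
        have hvs : v ≠ V i := hne_of_shift (c := w) (by omega)
        exact ((hshift_b₁ i v hv hvs).resolve_left fun h' => hJ_target i hi v hv hvs h'.1).2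
      J_off := fun i hi =>
        ((hshift_b₁ i _ (hoff i) (hJ_off i hi).1).resolve_left fun h => (hJ_off i hi).2 h.1).2
      J_lt := fun i hi c hc => (hJ_move i hi).2.2 c (shift_eq_one_iff.1 hc)
      J_rank := fun i hi => (hJ_move i hi).2.1
      J_subset := fun i hi =>
        mem_E.2 ⟨⟨_, hoff i, (hJ_off i hi).1⟩, (hJ_move i hi).1⟩
      J_nonempty := hJ.imp fun j h => mem_J.2 h
      rank_up := fun i v hv c c' hc hc' hap => by
        rw [shift_eq_one_iff] at hc
        have hvs := hpromoted_ne hc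
        have hs : ¬ V i c' < 3 := fun h => hap ⟨⟨v, hv, hvs⟩, h⟩
        refine (hmove i v hv hvs).promoted_best c c' (mem_promoted.1 hc).1 (mem_promoted.1 hc).2
          hs fun h => ?_
        have := shift_eq_one_iff.2 (mem_promoted.2 ⟨h, hs⟩)
        omega
      rank_ap := fun i c c' hc hc' => by
        have h₁ := hc.2
        have h₂ : ¬ V i c' < 3 := fun h => hc' ⟨hc.1, h⟩
        omega
      not_ap := fun i v _ c hc h => (mem_promoted.1 (shift_eq_one_iff.1 hc)).2 h.2
      ap_E := fun i hi c => by
        obtain ⟨⟨v, hv, hvs⟩, h₂⟩ := mem_E.1 hi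
        have h := hmove i v hv hvs
        refine ⟨fun hc => ?_, ?_⟩
        · by_contra hcon
          push Not at hcon
          exact not_four_approved (hV i) hc.2 h.approved_w h.approved_b₁ h₂ hcon.1 hcon.2.1
            hcon.2.2 hw₁.symm hw₂.symm h₁₂.symm
        · rintro (rfl | rfl | rfl)
          · exact ⟨⟨v, hv, hvs⟩, h.approved_w⟩
          · exact ⟨⟨v, hv, hvs⟩, h.approved_b₁⟩
          · exact ⟨⟨v, hv, hvs⟩, h₂⟩
      ap_b₂ := fun i hi h => hi (mem_E.2 h)
      ap_off := fun i hi c hc c' hc' =>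
        hoff_ap i (fun h => hi (mem_E.2 ⟨hc'.1, h⟩)) c (shift_eq_one_iff.1 hc) c' hc'.2
      active := fun i v hv h => by
        have hvs : v ≠ V i := hne_of_shift (c := w) (by omega)
        exact ⟨⟨v, hv, hvs⟩, (hmove i v hv hvs).approved_b₁⟩
      rank_b₁ := fun i hi v hv h => by
        have hvs : v ≠ V i := hne_of_shift (c := w) (by omega)
        rcases (hmove i v hv hvs).target with h' | h'
        · exact h'.2
        · exact absurd (mem_J.2 ⟨v, hv, hvs, h'.1⟩) hi
      up_le_two := fun i v hv c₁ c₂ c₃ h₁ h₂ h₃ => by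
        rw [shift_eq_one_iff] at h₁ h₂ h₃
        exact (hmove i v hv (hpromoted_ne h₁)).promoted_le_two hw₂ h₁₂ h₁ h₂ h₃
      up_le_one := fun i hi hiJ v hv c₁ c₂ h₁ h₂ => by
        rw [shift_eq_one_iff] at h₁ h₂
        have hvs := hpromoted_ne h₁
        refine (hmove i v hv hvs).promoted_le_one ?_ (mem_E.1 hi).2 hw₂ h₁₂ h₁ h₂
        by_contra h
        exact hiJ (mem_J.2 ⟨v, hv, hvs, h⟩) : ShiftGame (Fin n) C (C → ℕ) }
  exact ⟨σ, hσ, hnash⟩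

/-- A Type 2 manipulation in a game with a third candidate `b₂` close behind is a leader move. -/
lemma IsMinimalType2.isLeaderMove (hV : ∀ i, Function.Injective (V i))
    (htb : Function.Injective tb) {i : Fin n} {v : C → ℕ} {x b₁ b₂ : C}
    (hgs : IsGSManipulation 3 V tb i v) (h : IsMinimalType2 V tb i v x)
    (hx : winner 3 (Function.update V i v) tb = x) (hb : b₁ ≠ winner 3 V tb)
    (hmax : ∀ c, c ≠ winner 3 V tb → c ≠ b₁ → level tb V c < level tb V b₁)
    (hwb₁ : level tb V (winner 3 V tb) - levelUnit tb < level tb V b₁)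
    (hb₂ : b₂ ≠ winner 3 V tb) (h₁₂ : b₂ ≠ b₁)
    (hmax₂ : ∀ c, c ≠ winner 3 V tb → c ≠ b₁ → c ≠ b₂ → level tb V c < level tb V b₂) :
    IsLeaderMove (V i) (level tb V) (levelUnit tb) (winner 3 V tb) b₁ b₂ v ∧
      (v b₁ < 3 ↔ x = b₁) := by
  have hcases := h.cases hV htb hgs hx hb hmax
  have hxw := hgs.winner_ne hx
  have hrank := hgs.2.2.1
  rw [hx] at hrank
  have hup : ∀ c, v c < 3 → ¬ V i c < 3 → level tb V c + levelUnit tb < level tb V x := by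
    intro c hvc hsc
    have hcx : c ≠ x := by rintro rfl; exact hsc h.2.1
    have := level_lt_of_manipulation htb hx hcx
    rw [shift_eq_one_iff.2 (mem_promoted.2 ⟨hvc, hsc⟩), h.shift_eq.1] at this
    omega
  have hbest : ∀ c c', v c < 3 → ¬ V i c < 3 → ¬ V i c' < 3 → ¬ v c' < 3 → V i c < V i c' :=
    fun c c' h₁ h₂ h₃ h₄ => h.2.2.2.2.2 c ⟨h₁, h₂⟩ c' h₃ fun h' => h₄ h'.1
  obtain ⟨hw3, hx3, hvw, hvx, -, -⟩ := h
  rcases hcases with ⟨rfl, hdown⟩ | ⟨hxb, hb3, hvb, hap, htop, hlt⟩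
  · exact ⟨⟨hgs.1, hw3, hx3, hvw, fun c h₁ h₂ => Or.inl (hdown c h₁ h₂), hup, hbest,
      Or.inl ⟨hvx, hrank⟩⟩, by simp [hvx]⟩
  · have hx₂ : x = b₂ := by
      by_contra hne
      have h₁ := hlt b₂ hb₂ h₁₂ (Ne.symm hne)
      have h₂ := hmax₂ x hxw hxb hne
      omega
    have hxb' := hmax x hxw hxb
    subst hx₂
    refine ⟨⟨hgs.1, hw3, hb3, hvw, fun c h₁ h₂ => ?_, fun c h₁ h₂ => (hup c h₁ h₂).trans hxb',
      hbest, Or.inr ⟨hvb, hx3, htop, hup⟩⟩, by simp [hvb, hxb]⟩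
    rcases hap c h₁ with e | e | e
    · exact Or.inl e
    · exact Or.inr e
    · exact absurd hvx (e ▸ h₂)

/-- If all manipulations are of Type 2, there is an equilibrium. -/
theorem exists_equilibrium_of_type2 (hV : ∀ i, Function.Injective (V i))
    (htb : Function.Injective tb) (hsin : ∀ i, V i ∈ A i)
    (hstrat : ∀ i, ∀ v' ∈ A i, v' = V i ∨
      (IsGSManipulation 3 V tb i v' ∧
        IsMinimalType2 V tb i v' (winner 3 (Function.update V i v') tb))) :
    ∃ σ : Fin n → C → ℕ, (∀ i, σ i ∈ A i) ∧
      ∀ i, ∀ v' ∈ A i,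
        ¬ V i (winner 3 (Function.update σ i v') tb) < V i (winner 3 σ tb) := by
  by_cases hex : ∃ i, ∃ v ∈ A i, v ≠ V i
  swap
  · push Not at hex
    refine exists_equilibrium_of_runnerUp hV htb hsin hstrat (b := winner 3 V tb)
      (fun c h _ => level_lt_winner htb V h) fun i v hv h => absurd (hex i v hv) h
  obtain ⟨i, v, hv, hvi⟩ := hex
  have hne := ((hstrat i v hv).resolve_left hvi).1.winner_ne rfl
  obtain ⟨b₁, hb₁, hmax⟩ := exists_runnerUp htb hne
  by_cases hall : ∀ i, ∀ v ∈ A i, v ≠ V i → winner 3 (Function.update V i v) tb = b₁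
  · exact exists_equilibrium_of_runnerUp hV htb hsin hstrat hmax hall
  push Not at hall
  obtain ⟨j, u, hu, huj, hx⟩ := hall
  obtain ⟨b₂, hb₂⟩ : ∃ x, winner 3 (Function.update V j u) tb = x := ⟨_, rfl⟩
  obtain ⟨hgs, ht⟩ := (hstrat j u hu).resolve_left huj
  rw [hb₂] at ht hx
  have hb₂w := hgs.winner_ne hb₂
  have hlw := level_lt_of_manipulation htb hb₂ hb₂w.symm
  rw [ht.shift_eq.1, ht.shift_eq.2] at hlw
  have hL₂ := hmax b₂ hb₂w hx
  obtain ⟨-, -, hub, -, -, hmax₂⟩ := (ht.cases hV htb hgs hb₂ hb₁ hmax).resolve_left fun h => hx h.1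
  have hmove : ∀ i, ∀ v ∈ A i, v ≠ V i →
      IsLeaderMove (V i) (level tb V) (levelUnit tb) (winner 3 V tb) b₁ b₂ v ∧
        (v b₁ < 3 ↔ winner 3 (Function.update V i v) tb = b₁) := fun i v hv hvi => by
    obtain ⟨hgs', ht'⟩ := (hstrat i v hv).resolve_left hvi
    exact ht'.isLeaderMove hV htb hgs' rfl hb₁ hmax (by omega) hb₂w hx hmax₂
  refine exists_equilibrium_of_leaderMoves hV htb hsin hb₁ hb₂w hx (level_lt_winner htb V hb₁)
    hL₂ hmax₂ (by omega) (fun i v hv => ?_) (fun i v hv v' hv' hvi hvi' hlt => ?_)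
    ⟨j, u, hu, huj, hub⟩
  · by_cases hvi : v = V i
    · exact Or.inl hvi
    · exact Or.inr (hmove i v hv hvi).1
  · rw [(hmove i v' hv' hvi').2]
    rw [(hmove i v hv hvi).2] at hlt
    have h₁ := ((hstrat i v hv).resolve_left hvi).1
    have h₂ := ((hstrat i v' hv').resolve_left hvi').1
    rw [← hlt]
    exact hV i (le_antisymm (h₂.2.2.2 v h₁.1) (h₁.2.2.2 v' h₂.1))

end LeaderEquilibrium

/-- Under the Minimality Assumption, every GS-game for 3-Approval has a
pure-strategy Nash equilibrium. -/
theorem stmt14 {C : Type*} [Fintype C] [DecidableEq C] [Nonempty C] {n : ℕ}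
    (V : Fin n → C → ℕ) (hV : ∀ i, Function.Injective (V i))
    (tb : C → ℕ) (htb : Function.Injective tb)
    (A : Fin n → Set (C → ℕ))
    (hsin : ∀ i, V i ∈ A i)
    (hstrat : ∀ i, ∀ v' ∈ A i, v' = V i ∨
      (IsGSManipulation 3 V tb i v' ∧
        (IsMinimalType1 V tb i v' (winner 3 (Function.update V i v') tb) ∨
         IsMinimalType2 V tb i v' (winner 3 (Function.update V i v') tb)))) :
    ∃ σ : Fin n → C → ℕ, (∀ i, σ i ∈ A i) ∧
      ∀ i, ∀ v' ∈ A i,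
        ¬ V i (winner 3 (Function.update σ i v') tb) < V i (winner 3 σ tb) := by
  by_cases h : ∃ i, ∃ v ∈ A i, IsMinimalType1 V tb i v (winner 3 (Function.update V i v) tb)
  · exact exists_equilibrium_of_type1 hV htb hsin hstrat h
  · push Not at h
    exact exists_equilibrium_of_type2 hV htb hsin fun i v hv =>
      (hstrat i v hv).imp_right (And.imp_right (Or.resolve_left · (h i v hv)))
end
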